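/- There exist a collection of norms ‖·‖_(r) on V_r (r ∈ ℕ₆), a sequence of positive real numbers (ε(r))_{r≥6} converging to zero, and real numbers 0 < α, β < ∞ such that for every A ⊆ ℕ₆ and every j ∈ A there exists a map ξ_j : L(R_A) → ℝ satisfying: (a) if T ∈ L(R_A) and μ ∈ ℝ satisfy π_j^W(Tw) = μw for all w ∈ W_j, then ξ_j(T) = μ; (b) |ξ_j(TS) − ξ_j(T)ξ_j(S)| ≤ α·j^(−β)·‖T‖·‖S‖ for all T, S ∈ L(R_A); (c) if both j and j+1 belong to A, then |ξ_{j+1}(T) − ξ_j(T)| ≤ ε(j+1)·‖T‖ for all T ∈ L(R_A). -/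

import Mathlib

open scoped Classical

noncomputable section

/-- `a_r = 5·10^(r−2)`. -/
def aIdx (r : ℕ) : ℕ := 5 * 10 ^ (r - 2)

/-- `b_r = 10^r`. -/
def bIdx (r : ℕ) : ℕ := 10 ^ r

/-- The index set of the subspace `V_r = lin{e_i : a_r < i ≤ b_r}`. -/
def VIdx (r : ℕ) : Set ℕ := {i | aIdx r < i ∧ i ≤ bIdx r}

/-- The index set of the subspace `W_r = lin{e_i : a_{r+1} < i ≤ b_r}`. -/
def WIdx (r : ℕ) : Set ℕ := {i | aIdx (r + 1) < i ∧ i ≤ bIdx r}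

/-- The index set `E(r)`. -/
def EIdx (r : ℕ) : Set ℕ :=
  if r = 6 then {i | aIdx 6 < i ∧ i ≤ bIdx 6} else {i | bIdx (r - 1) < i ∧ i ≤ bIdx r}

/-- The vector space `V` with basis `{e_i : i > a_6}`, realized as the space of finitely
supported real families indexed by `{i : ℕ // a_6 < i}`. -/
abbrev Vb : Type := {i : ℕ // aIdx 6 < i} →₀ ℝ

/-- `x ∈ V` is supported in the index set `s ⊆ ℕ`. -/
def SuppIn (x : Vb) (s : Set ℕ) : Prop := ∀ i, x i ≠ 0 → (i : ℕ) ∈ s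

/-- The coordinate projection of `V` onto the coordinates lying in `s` (e.g. `π_r^V`, `π_r^W`
for `s = VIdx r`, `WIdx r`). -/
def projTo (s : Set ℕ) : Vb →ₗ[ℝ] Vb where
  toFun x := Finsupp.onFinset x.support (fun i => if (i : ℕ) ∈ s then x i else 0)
    (fun i h => Finsupp.mem_support_iff.2 (fun hx => h (by simp [hx])))
  map_add' x y := by
    ext i
    by_cases h : (i : ℕ) ∈ s <;> simp [Finsupp.onFinset_apply, h]
  map_smul' c x := by
    ext i
    by_cases h : (i : ℕ) ∈ s <;> simp [Finsupp.onFinset_apply, h]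

/-- `N` is a norm on the coordinate subspace of `V` supported in `s`. -/
structure IsNormOn (N : Vb → ℝ) (s : Set ℕ) : Prop where
  nonneg : ∀ x, SuppIn x s → 0 ≤ N x
  eq_zero_iff : ∀ x, SuppIn x s → N x = 0 → x = 0
  add_le : ∀ x y, SuppIn x s → SuppIn y s → N (x + y) ≤ N x + N y
  smul : ∀ (c : ℝ) (x), SuppIn x s → N (c • x) = |c| * N x

/-- A collection of norms `‖·‖_(r)` on the spaces `V_r`, `r ∈ ℕ₆`. -/
def NormFamily (N : ℕ → Vb → ℝ) : Prop := ∀ r, 6 ≤ r → IsNormOn (N r) (VIdx r)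

/-- The norm on `V` induced by the collection `N`:
`‖x‖² = Σ_{r≥6} [‖π_r^V x‖_(r)² + (1/log r)(‖π_r^W x‖_(r)² + ‖π_r^W x‖_(r+1)²)]`. -/
def VNorm (N : ℕ → Vb → ℝ) (x : Vb) : ℝ :=
  Real.sqrt (∑' r : ℕ,
    if 6 ≤ r then
      N r (projTo (VIdx r) x) ^ 2 +
        (1 / Real.log r) *
          (N r (projTo (WIdx r) x) ^ 2 + N (r + 1) (projTo (WIdx r) x) ^ 2)
    else 0)

/-- The unique block `j ∈ ℕ₆` with `i ∈ E(j)` (for `i > a_6`). -/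
def blockOf (i : ℕ) : ℕ := max 6 (Nat.clog 10 i)

/-- The multiplier `M_f`, acting on `e_i` as multiplication by `f(j)` for `i ∈ E(j)`. -/
def Mf (f : ℕ → ℝ) : Vb →ₗ[ℝ] Vb where
  toFun x := Finsupp.onFinset x.support (fun i => f (blockOf i) * x i)
    (fun i h => Finsupp.mem_support_iff.2 (fun hx => h (by simp [hx])))
  map_add' x y := by
    ext i
    simp [Finsupp.onFinset_apply, mul_add]
  map_smul' c x := by
    ext i
    simp [Finsupp.onFinset_apply]
    ring

/-- The closed linear span `R_A` in `R` of the basis vectors `e_i`, `i ∈ ∪_{j∈A} E(j)`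
(where `R` is a realization of the completion of `V` via a dense isometric embedding
`eV : V → R`). -/
def RA {R : Type} [NormedAddCommGroup R] [NormedSpace ℝ R] (eV : Vb →ₗ[ℝ] R) (A : Set ℕ) :
    Submodule ℝ R :=
  (Submodule.span ℝ (⇑eV '' {v : Vb | SuppIn v (⋃ j ∈ A, EIdx j)})).topologicalClosure

/-! ### Counting sign patterns -/

/-- The sign `±1` encoded by a Boolean. -/
def sgn (b : Bool) : ℝ := if b then 1 else -1

theorem sgn_sq (b : Bool) : sgn b ^ 2 = 1 := by cases b <;> simp [sgn]

theorem abs_sgn (b : Bool) : |sgn b| = 1 := by cases b <;> simp [sgn]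

theorem sgn_exp_le (b : Bool) (u : ℝ) :
    Real.exp (sgn b * u - u ^ 2 / 2) + Real.exp (sgn (!b) * u - u ^ 2 / 2) ≤ 2 := by
  have h := Real.cosh_le_exp_half_sq u
  rw [Real.cosh_eq] at h
  have e1 : Real.exp (u - u ^ 2 / 2) = Real.exp u * Real.exp (-(u ^ 2 / 2)) := by
    rw [← Real.exp_add]; ring_nf
  have e2 : Real.exp (-u - u ^ 2 / 2) = Real.exp (-u) * Real.exp (-(u ^ 2 / 2)) := by
    rw [← Real.exp_add]; ring_nf
  have e3 : Real.exp (u ^ 2 / 2) * Real.exp (-(u ^ 2 / 2)) = 1 := by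
    rw [← Real.exp_add]; simp
  have hpos := Real.exp_pos (-(u ^ 2 / 2))
  have key : Real.exp (u - u ^ 2 / 2) + Real.exp (-u - u ^ 2 / 2) ≤ 2 := by
    rw [e1, e2]
    have := mul_le_mul_of_nonneg_right h hpos.le
    rw [e3] at this
    linarith
  cases b
  · simp [sgn] at key ⊢; linarith
  · simp [sgn] at key ⊢; linarith

/-- Exponential moment bound for decoupled Rademacher sums. -/
theorem sum_exp_rademacher_le {ι : Type*} [Fintype ι] (I : Finset ι) (ρ : ι → ℕ)
    (φ : ι → (ι → Bool) → ℝ)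
    (hφ : ∀ i ∈ I, ∀ k ∈ I, ρ i ≤ ρ k → ∀ τ b, φ i (Function.update τ k b) = φ i τ) :
    ∑ τ : ι → Bool, Real.exp (∑ i ∈ I, (sgn (τ i) * φ i τ - φ i τ ^ 2 / 2)) ≤
      2 ^ Fintype.card ι := by
  induction I using Finset.induction_on_max_value ρ with
  | empty => simp
  | insert k I hk hmax ih =>
    have ih' := ih (fun i hi l hl => hφ i (Finset.mem_insert_of_mem hi) l
      (Finset.mem_insert_of_mem hl))
    refine le_trans ?_ ih'
    set F : (ι → Bool) → ℝ := fun τ =>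
      Real.exp (∑ i ∈ insert k I, (sgn (τ i) * φ i τ - φ i τ ^ 2 / 2)) with hF
    set G : (ι → Bool) → ℝ := fun τ =>
      Real.exp (∑ i ∈ I, (sgn (τ i) * φ i τ - φ i τ ^ 2 / 2)) with hG
    let fl : (ι → Bool) → (ι → Bool) := fun τ => Function.update τ k (!τ k)
    have hinv : Function.Involutive fl := by
      intro τ
      simp [fl]
    have hsum : ∑ τ, F (fl τ) = ∑ τ, F τ :=
      (hinv.toPerm fl).sum_comp Finset.univ F (fun _ _ => Finset.mem_univ _)
    have hGfl : ∀ τ, G (fl τ) = G τ := by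
      intro τ
      simp only [hG, fl]
      congr 1
      refine Finset.sum_congr rfl fun i hi => ?_
      have hik : i ≠ k := fun h => hk (h ▸ hi)
      rw [hφ i (Finset.mem_insert_of_mem hi) k (Finset.mem_insert_self _ _) (hmax i hi),
        Function.update_of_ne hik]
    have hFG : ∀ τ, F τ = Real.exp (sgn (τ k) * φ k τ - φ k τ ^ 2 / 2) * G τ := by
      intro τ
      simp only [hF, hG]
      rw [Finset.sum_insert hk, Real.exp_add]
    have hpt : ∀ τ, F τ + F (fl τ) ≤ 2 * G τ := by
      intro τ
      rw [hFG, hFG, hGfl]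
      have h1 : φ k (fl τ) = φ k τ :=
        hφ k (Finset.mem_insert_self _ _) k (Finset.mem_insert_self _ _) le_rfl _ _
      have h2 : fl τ k = !τ k := by simp [fl]
      rw [h1, h2, ← add_mul]
      exact mul_le_mul_of_nonneg_right (sgn_exp_le _ _) (Real.exp_pos _).le
    have : ∑ τ, (F τ + F (fl τ)) ≤ ∑ τ, 2 * G τ := Finset.sum_le_sum fun τ _ => hpt τ
    rw [Finset.sum_add_distrib, hsum, ← Finset.mul_sum] at this
    linarith

/-- Decoupled Hoeffding inequality, as a counting statement. -/
theorem card_rademacher_le {ι : Type*} [Fintype ι] (I : Finset ι) (ρ : ι → ℕ)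
    (φ : ι → (ι → Bool) → ℝ)
    (hφ : ∀ i ∈ I, ∀ k ∈ I, ρ i ≤ ρ k → ∀ τ b, φ i (Function.update τ k b) = φ i τ)
    {s V : ℝ} (hs : 0 ≤ s) (hV : 0 < V) :
    ((Finset.univ.filter fun τ : ι → Bool =>
      s ≤ ∑ i ∈ I, sgn (τ i) * φ i τ ∧ ∑ i ∈ I, φ i τ ^ 2 ≤ V).card : ℝ) ≤
      2 ^ Fintype.card ι * Real.exp (-(s ^ 2 / (2 * V))) := by
  set θ : ℝ := s / V with hθ
  have hθ0 : 0 ≤ θ := div_nonneg hs hV.le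
  have h := sum_exp_rademacher_le I ρ (fun i τ => θ * φ i τ)
    (fun i hi k hk hr τ b => by simp [hφ i hi k hk hr τ b])
  set B := Finset.univ.filter fun τ : ι → Bool =>
      s ≤ ∑ i ∈ I, sgn (τ i) * φ i τ ∧ ∑ i ∈ I, φ i τ ^ 2 ≤ V with hB
  have h1 : (B.card : ℝ) * Real.exp (s ^ 2 / (2 * V)) ≤ 2 ^ Fintype.card ι := by
    refine le_trans ?_ h
    refine le_trans ?_ (Finset.sum_le_sum_of_subset_of_nonneg (Finset.subset_univ B)
      (fun _ _ _ => (Real.exp_pos _).le))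
    rw [← nsmul_eq_mul]
    refine Finset.card_nsmul_le_sum _ _ _ fun τ hτ => ?_
    simp only [hB, Finset.mem_filter, Finset.mem_univ, true_and] at hτ
    refine Real.exp_le_exp.2 ?_
    have e : ∑ i ∈ I, (sgn (τ i) * (θ * φ i τ) - (θ * φ i τ) ^ 2 / 2) =
        θ * ∑ i ∈ I, sgn (τ i) * φ i τ - θ ^ 2 / 2 * ∑ i ∈ I, φ i τ ^ 2 := by
      rw [Finset.mul_sum, Finset.mul_sum, ← Finset.sum_sub_distrib]
      exact Finset.sum_congr rfl fun i _ => by ring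
    rw [e]
    have a1 := mul_le_mul_of_nonneg_left hτ.1 hθ0
    have a2 := mul_le_mul_of_nonneg_left hτ.2 (by positivity : 0 ≤ θ ^ 2 / 2)
    have e2 : s ^ 2 / (2 * V) = θ * s - θ ^ 2 / 2 * V := by
      rw [hθ]; field_simp; ring
    rw [e2]; linarith
  rw [Real.exp_neg, ← div_eq_mul_inv, le_div_iff₀ (Real.exp_pos _)]
  exact h1

variable {ι : Type*}

/-- Extension by `false` of a sign pattern on a finite set. -/
def extS (S : Finset ι) (τ : S → Bool) : ι → Bool :=
  fun x => if h : x ∈ S then τ ⟨x, h⟩ else false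

/-- The density of an event among the sign patterns supported on `S`. -/
def dens (S : Finset ι) (B : Set (ι → Bool)) : ℝ :=
  ((Finset.univ.filter fun τ : S → Bool => extS S τ ∈ B).card : ℝ) / 2 ^ S.card

theorem dens_mono (S : Finset ι) {B B' : Set (ι → Bool)} (h : B ⊆ B') : dens S B ≤ dens S B' := by
  unfold dens
  gcongr

theorem dens_iUnion_le {κ : Type*} (S : Finset ι) (F : Finset κ) (B : κ → Set (ι → Bool)) :
    dens S {σ | ∃ x ∈ F, σ ∈ B x} ≤ ∑ x ∈ F, dens S (B x) := by
  unfold dens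
  rw [← Finset.sum_div]
  gcongr
  refine le_trans (Nat.cast_le.2 ((Finset.card_le_card (t := F.biUnion fun x =>
    Finset.univ.filter fun τ : S → Bool => extS S τ ∈ B x) ?_).trans
    Finset.card_biUnion_le)) (le_of_eq (by push_cast; rfl))
  intro τ hτ
  simpa using hτ

theorem dens_union_le (S : Finset ι) (B B' : Set (ι → Bool)) :
    dens S (B ∪ B') ≤ dens S B + dens S B' := by
  unfold dens
  rw [← add_div]
  gcongr
  refine le_trans (Nat.cast_le.2 ((Finset.card_le_card
    (t := (Finset.univ.filter fun τ : S → Bool => extS S τ ∈ B) ∪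
      (Finset.univ.filter fun τ : S → Bool => extS S τ ∈ B')) ?_).trans
    (Finset.card_union_le _ _))) (le_of_eq (by push_cast; rfl))
  intro τ hτ
  simpa using hτ

/-- A union bound over a finite type of events of uniformly small density. -/
theorem dens_exists_le {κ : Type*} [Fintype κ] (S : Finset ι) (B : κ → Set (ι → Bool)) {ε : ℝ}
    (h : ∀ x, dens S (B x) ≤ ε) : dens S {σ | ∃ x, σ ∈ B x} ≤ Fintype.card κ * ε := by
  have := dens_iUnion_le S Finset.univ B
  simp only [Finset.mem_univ, true_and] at this
  refine this.trans ?_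
  have := Finset.sum_le_card_nsmul Finset.univ (fun x => dens S (B x)) ε (fun x _ => h x)
  simpa using this

/-- Exponential bound for the density of the event that a sum of predictable multiples of signs
is large while its quadratic variation is small. -/
theorem dens_rademacher_le (S I : Finset ι) (hI : I ⊆ S) (ρ : ι → ℕ)
    (φ : ι → (ι → Bool) → ℝ)
    (hφ : ∀ i ∈ I, ∀ k ∈ I, ρ i ≤ ρ k → ∀ τ b, φ i (Function.update τ k b) = φ i τ)
    {s V : ℝ} (hs : 0 ≤ s) (hV : 0 < V) :
    dens S {σ | s ≤ ∑ i ∈ I, sgn (σ i) * φ i σ ∧ ∑ i ∈ I, φ i σ ^ 2 ≤ V} ≤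
      Real.exp (-(s ^ 2 / (2 * V))) := by
  unfold dens
  rw [div_le_iff₀ (by positivity), mul_comm]
  set J : Finset S := Finset.univ.filter fun x => (x : ι) ∈ I with hJ
  have hsum : ∀ f : ι → ℝ, ∑ i ∈ I, f i = ∑ x ∈ J, f x := by
    intro f
    have : I = J.map (Function.Embedding.subtype _) := by
      ext x
      simp only [hJ, Finset.mem_map, Finset.mem_filter, Finset.mem_univ, true_and,
        Function.Embedding.coe_subtype, Subtype.exists, exists_and_left, exists_prop]
      constructor
      · intro hx; exact ⟨x, hx, hI hx, rfl⟩
      · rintro ⟨y, hy, _, rfl⟩; exact hy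
    conv_lhs => rw [this]
    rw [Finset.sum_map]
    rfl
  have hup : ∀ (τ : S → Bool) (k : S) (b : Bool),
      extS S (Function.update τ k b) = Function.update (extS S τ) (k : ι) b := by
    intro τ k b
    funext x
    by_cases hx : x = k
    · subst hx; simp [extS]
    · rw [Function.update_of_ne hx]
      unfold extS
      split_ifs with h
      · rw [Function.update_of_ne]
        intro h'; exact hx (by rw [← h'])
      · rfl
  have hext : ∀ (τ : S → Bool) (x : S), extS S τ x = τ x := by
    intro τ x; simp [extS]
  have key := card_rademacher_le J (fun x : S => ρ x) (fun (x : S) τ => φ x (extS S τ))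
    (by
      intro i hi k hk hr τ b
      simp only [hJ, Finset.mem_filter, Finset.mem_univ, true_and] at hi hk
      have h1 := hφ i hi k hk hr (extS S τ) b
      rw [← hup] at h1
      convert h1) hs hV
  rw [Fintype.card_coe] at key
  refine le_trans (le_of_eq ?_) key
  congr 2
  ext τ
  simp only [Finset.mem_filter, Finset.mem_univ, true_and, Set.mem_ofPred_eq]
  rw [hsum, hsum]
  simp only [hext]

/-- Compactness: countably many finitely determined events of small total density can be avoided
simultaneously. -/
theorem exists_avoiding {κ : Type*} [Countable κ] [DecidableEq κ] (B : κ → Set (ι → Bool))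
    (C : κ → Finset ι)
    (hdep : ∀ x σ σ', (∀ i ∈ C x, σ i = σ' i) → σ ∈ B x → σ' ∈ B x)
    (hsmall : ∀ F : Finset κ, ∃ S : Finset ι, ∑ x ∈ F, dens S (B x) < 1) :
    ∃ σ : ι → Bool, ∀ x, σ ∉ B x := by
  have hclosed : ∀ x, IsClosed (B x)ᶜ := by
    intro x
    have : (B x)ᶜ = (fun σ : ι → Bool => fun i : C x => σ i) ⁻¹'
        {τ | ∃ σ, σ ∉ B x ∧ ∀ i : C x, τ i = σ i} := by
      ext σ
      simp only [Set.mem_compl_iff, Set.mem_preimage, Set.mem_ofPred_eq]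
      constructor
      · intro h; exact ⟨σ, h, fun _ => rfl⟩
      · rintro ⟨σ', h, he⟩ hσ
        exact h (hdep x σ σ' (fun i hi => he ⟨i, hi⟩) hσ)
    rw [this]
    exact (isClosed_discrete _).preimage (by fun_prop)
  have hfin : ∀ F : Finset κ, (Set.univ ∩ ⋂ x ∈ F, (B x)ᶜ).Nonempty := by
    intro F
    obtain ⟨S, hS⟩ := hsmall F
    by_contra hne
    have hall : ∀ σ, ∃ x ∈ F, σ ∈ B x := by
      intro σ
      by_contra hσ
      push Not at hσ
      exact hne ⟨σ, by simpa using hσ⟩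
    have h1 := dens_iUnion_le S F B
    have h2 : dens S {σ | ∃ x ∈ F, σ ∈ B x} = 1 := by
      have : {σ | ∃ x ∈ F, σ ∈ B x} = Set.univ := Set.eq_univ_of_forall hall
      rw [this]
      simp [dens]
    linarith
  have := isCompact_univ.inter_iInter_nonempty (fun x => (B x)ᶜ) hclosed hfin
  obtain ⟨σ, hσ⟩ := this
  exact ⟨σ, fun x => by simpa using Set.mem_iInter.1 hσ.2 x⟩

/-! ### Asymptotic comparisons -/

theorem eventually_pow_le_exp (K : ℝ) (m : ℕ) {δ : ℝ} (hδ : 0 < δ) :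
    ∀ᶠ j : ℕ in Filter.atTop, K * (j : ℝ) ^ m ≤ Real.exp (δ * j) := by
  have h := (isLittleO_pow_exp_pos_mul_atTop m hδ).bound
    (show (0 : ℝ) < 1 / (|K| + 1) by positivity)
  filter_upwards [tendsto_natCast_atTop_atTop.eventually h] with j hj
  rw [Real.norm_of_nonneg (by positivity), Real.norm_of_nonneg (by positivity),
    div_mul_eq_mul_div, one_mul, le_div_iff₀ (by positivity)] at hj
  nlinarith [le_abs_self K, pow_nonneg (Nat.cast_nonneg (α := ℝ) j) m]

theorem eventually_mul_pow_le_pow (K : ℝ) {m l : ℕ} (h : m < l) :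
    ∀ᶠ j : ℕ in Filter.atTop, K * (j : ℝ) ^ m ≤ (j : ℝ) ^ l := by
  filter_upwards [Filter.eventually_ge_atTop (max 1 ⌈K⌉₊)] with j hj
  have h1 : (1 : ℝ) ≤ j := by exact_mod_cast (le_max_left _ _).trans hj
  have h2 : K ≤ j := (Nat.le_ceil K).trans (by exact_mod_cast (le_max_right _ _).trans hj)
  calc K * (j : ℝ) ^ m ≤ j * (j : ℝ) ^ m := by gcongr
    _ = (j : ℝ) ^ (m + 1) := by ring
    _ ≤ (j : ℝ) ^ l := pow_le_pow_right₀ h1 h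

theorem two_pow_le_exp (j : ℕ) : (2 : ℝ) ^ j ≤ Real.exp j := by
  have : (2 : ℝ) ≤ Real.exp 1 := by have := Real.add_one_le_exp (1 : ℝ); linarith
  calc (2 : ℝ) ^ j ≤ Real.exp 1 ^ j := by gcongr
    _ = Real.exp j := by rw [← Real.exp_nat_mul, mul_one]

theorem exp_half_le_two_pow (j : ℕ) : Real.exp (j / 2) ≤ (2 : ℝ) ^ j := by
  have : Real.exp (1 / 2) ≤ 2 := by
    have h : Real.exp (1 / 2) ^ 2 = Real.exp 1 := by rw [← Real.exp_nat_mul]; norm_num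
    have := Real.exp_one_lt_d9
    nlinarith [Real.exp_pos (1 / 2)]
  calc Real.exp (j / 2) = Real.exp (1 / 2) ^ j := by rw [← Real.exp_nat_mul]; ring_nf
    _ ≤ 2 ^ j := by gcongr

/-! ### Random points -/

/-- Exponent of the weights `D_j = j ^ dE`. -/
@[irreducible] def dE : ℕ := 110

theorem dE_eq : dE = 110 := by unfold dE; rfl

/-- Exponent of the oversampling ratio `A_j / n_j = j ^ cE`. -/
@[irreducible] def cE : ℕ := 440

theorem cE_eq : cE = 440 := by unfold cE; rfl

/-- The number of points used on level `j`. -/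
def numPts (j : ℕ) : ℕ := 2 ^ j * j ^ cE

/-- The normalization `n_j ^ (-1/2)`. -/
def rt (j : ℕ) : ℝ := (√(2 ^ j))⁻¹

theorem rt_pos (j : ℕ) : 0 < rt j := by unfold rt; positivity

theorem rt_sq (j : ℕ) : rt j ^ 2 = ((2 : ℝ) ^ j)⁻¹ := by
  unfold rt; rw [inv_pow, Real.sq_sqrt (by positivity)]

theorem rt_le_one (j : ℕ) : rt j ≤ 1 := by
  unfold rt
  refine inv_le_one_of_one_le₀ (Real.one_le_sqrt.2 (one_le_pow₀ (by norm_num)))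

theorem two_pow_mul_rt_sq (j : ℕ) : (2 : ℝ) ^ j * rt j ^ 2 = 1 := by
  rw [rt_sq]; field_simp

/-- Sign patterns, indexed by level, point and coordinate. -/
abbrev Signs : Type := ℕ × ℕ × ℕ → Bool

/-- The points determined by a sign pattern. -/
def gv (σ : Signs) (j a i : ℕ) : ℝ := rt j * sgn (σ (j, a, i))

/-- The inner product of the first `n` coordinates. -/
def ip (n : ℕ) (x y : ℕ → ℝ) : ℝ := ∑ i ∈ Finset.range n, x i * y i

/-- The sum of squares of the first `n` coordinates. -/
def ssq (n : ℕ) (x : ℕ → ℝ) : ℝ := ∑ i ∈ Finset.range n, x i ^ 2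

theorem ssq_nonneg (n : ℕ) (x : ℕ → ℝ) : 0 ≤ ssq n x := Finset.sum_nonneg fun _ _ => sq_nonneg _

theorem ip_self (n : ℕ) (x : ℕ → ℝ) : ip n x x = ssq n x := by
  unfold ip ssq; simp only [pow_two]

theorem ip_comm (n : ℕ) (x y : ℕ → ℝ) : ip n x y = ip n y x := by
  unfold ip; simp only [mul_comm]

theorem ip_sq_le (n : ℕ) (x y : ℕ → ℝ) : ip n x y ^ 2 ≤ ssq n x * ssq n y :=
  Finset.sum_mul_sq_le_sq_mul_sq _ _ _

theorem gv_sq (σ : Signs) (j a i : ℕ) : gv σ j a i ^ 2 = rt j ^ 2 := by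
  unfold gv; rw [mul_pow, sgn_sq, mul_one]

theorem ssq_gv (σ : Signs) (j a : ℕ) : ssq (2 ^ j) (gv σ j a) = 1 := by
  unfold ssq; simp [gv_sq, two_pow_mul_rt_sq]

/-- The sign indices used on level `j`. -/
def lvl (j : ℕ) : Finset (ℕ × ℕ × ℕ) :=
  {j} ×ˢ (Finset.range (numPts j) ×ˢ Finset.range (2 ^ j))

theorem mem_lvl {j : ℕ} {p : ℕ × ℕ × ℕ} :
    p ∈ lvl j ↔ p.1 = j ∧ p.2.1 < numPts j ∧ p.2.2 < 2 ^ j := by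
  simp only [lvl, Finset.mem_product, Finset.mem_singleton, Finset.mem_range]

theorem sum_lvl (j : ℕ) (f : ℕ × ℕ × ℕ → ℝ) :
    ∑ p ∈ lvl j, f p =
      ∑ a ∈ Finset.range (numPts j), ∑ i ∈ Finset.range (2 ^ j), f (j, a, i) := by
  unfold lvl
  rw [Finset.sum_product, Finset.sum_singleton, Finset.sum_product]

/-! ### Discretization -/

/-- The real number in `[-1, 1]` coded by an element of `Fin (2 * H + 1)`. -/
def dec (H : ℕ) (k : Fin (2 * H + 1)) : ℝ := ((k : ℝ) - H) / H

theorem exists_dec {H : ℕ} (hH : 0 < H) {u : ℝ} (hu : |u| ≤ 1) :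
    ∃ k, |dec H k| ≤ |u| ∧ |u - dec H k| ≤ 1 / H := by
  have hH' : (0 : ℝ) < H := by exact_mod_cast hH
  set f : ℕ := ⌊|u| * H⌋₊ with hf
  have h1 : (f : ℝ) ≤ |u| * H := Nat.floor_le (by positivity)
  have h2 : |u| * H < f + 1 := Nat.lt_floor_add_one _
  have h3 : f ≤ H := by
    have : (f : ℝ) ≤ H := h1.trans (by nlinarith)
    exact_mod_cast this
  have e1 : (f : ℝ) / H ≤ |u| := by rw [div_le_iff₀ hH']; exact h1
  have e2 : |u| - f / H ≤ 1 / H := by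
    rw [sub_le_iff_le_add, ← add_div, le_div_iff₀ hH']; linarith
  rcases le_total 0 u with h | h
  · refine ⟨⟨H + f, by omega⟩, ?_⟩
    have : dec H ⟨H + f, by omega⟩ = f / H := by simp [dec]
    rw [this]
    rw [abs_of_nonneg h] at e1 e2 ⊢
    rw [abs_of_nonneg (by positivity), abs_of_nonneg (by linarith)]
    exact ⟨e1, e2⟩
  · refine ⟨⟨H - f, by omega⟩, ?_⟩
    have : dec H ⟨H - f, by omega⟩ = -(f / H) := by
      simp only [dec, Nat.cast_sub h3]; ring
    rw [this]
    rw [abs_of_nonpos h] at e1 e2 ⊢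
    rw [abs_neg, abs_of_nonneg (by positivity), abs_of_nonpos (by linarith)]
    exact ⟨e1, by linarith⟩

/-- The vector in `[-1, 1] ^ n`, padded by zeros, coded by `k`. -/
def decF (H n : ℕ) (k : Fin n → Fin (2 * H + 1)) (i : ℕ) : ℝ :=
  if h : i < n then dec H (k ⟨i, h⟩) else 0

theorem exists_decF {H : ℕ} (hH : 0 < H) (n : ℕ) {u : ℕ → ℝ} (hu : ∀ i < n, |u i| ≤ 1) :
    ∃ k, ∀ i < n, |decF H n k i| ≤ |u i| ∧ |u i - decF H n k i| ≤ 1 / H := by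
  choose k hk using fun i : Fin n => exists_dec hH (hu i i.2)
  refine ⟨k, fun i hi => ?_⟩
  simpa [decF, hi] using hk ⟨i, hi⟩

theorem abs_le_one_of_sq {n : ℕ} {x : ℕ → ℝ} (h : ssq n x ≤ 1) {i : ℕ} (hi : i < n) : |x i| ≤ 1 := by
  have : x i ^ 2 ≤ ssq n x :=
    Finset.single_le_sum (f := fun i => x i ^ 2) (fun _ _ => sq_nonneg _) (Finset.mem_range.2 hi)
  exact (sq_le_one_iff_abs_le_one _).1 (this.trans h)

/-! ### The frame bound -/

/-- Upper frame bound for the points of level `j`. -/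
def FrameBd (g : ℕ → ℕ → ℕ → ℝ) (j : ℕ) : Prop :=
  ∀ x, ∑ a ∈ Finset.range (numPts j), ip (2 ^ j) (g j a) x ^ 2 ≤ (j : ℝ) ^ (cE + 2) * ssq (2 ^ j) x

theorem dens_le_of_subset_exists {ι κ : Type*} [Fintype κ] {S : Finset ι} {B : Set (ι → Bool)}
    (B' : κ → Set (ι → Bool)) {ε : ℝ} (hB : B ⊆ {σ | ∃ x, σ ∈ B' x})
    (h : ∀ x, dens S (B' x) ≤ ε) : dens S B ≤ Fintype.card κ * ε :=
  (dens_mono S hB).trans (dens_exists_le S B' h)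

theorem numPts_pos {j : ℕ} (hj : 1 ≤ j) : 0 < numPts j := by unfold numPts; positivity

theorem bilinear_round {n m : ℕ} {x x' y y' : ℕ → ℝ} {G : ℕ → ℕ → ℝ} {h : ℝ}
    (hx : ∀ i < n, |x i| ≤ 1) (hx' : ∀ i < n, |x i - x' i| ≤ h)
    (hy' : ∀ i < m, |y' i| ≤ 1) (hyy : ∀ i < m, |y i - y' i| ≤ h)
    (hG : ∀ a i, |G a i| ≤ 1) :
    |∑ a ∈ Finset.range m, ∑ i ∈ Finset.range n, G a i * (y a * x i) -
      ∑ a ∈ Finset.range m, ∑ i ∈ Finset.range n, G a i * (y' a * x' i)| ≤ m * (n * (2 * h)) := by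
  rw [← Finset.sum_sub_distrib]
  refine (Finset.abs_sum_le_sum_abs _ _).trans ?_
  have : ∀ a ∈ Finset.range m, |∑ i ∈ Finset.range n, G a i * (y a * x i) -
      ∑ i ∈ Finset.range n, G a i * (y' a * x' i)| ≤ n * (2 * h) := by
    intro a ha
    rw [← Finset.sum_sub_distrib]
    refine (Finset.abs_sum_le_sum_abs _ _).trans ?_
    have : ∀ i ∈ Finset.range n, |G a i * (y a * x i) - G a i * (y' a * x' i)| ≤ 2 * h := by
      intro i hi
      have e : G a i * (y a * x i) - G a i * (y' a * x' i) =
        G a i * ((y a - y' a) * x i + y' a * (x i - x' i)) := by ring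
      rw [e, abs_mul]
      have h1 := hx i (Finset.mem_range.1 hi)
      have h2 := hx' i (Finset.mem_range.1 hi)
      have h3 := hy' a (Finset.mem_range.1 ha)
      have h4 := hyy a (Finset.mem_range.1 ha)
      have h5 : |(y a - y' a) * x i + y' a * (x i - x' i)| ≤ 2 * h := by
        refine (abs_add_le _ _).trans ?_
        rw [abs_mul, abs_mul]
        have := mul_le_mul h4 h1 (abs_nonneg _) ((abs_nonneg _).trans h4)
        have := mul_le_mul h3 h2 (abs_nonneg _) zero_le_one
        linarith
      have := mul_le_mul (hG a i) h5 (abs_nonneg _) zero_le_one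
      linarith
    refine (Finset.sum_le_sum this).trans ?_
    simp
  refine (Finset.sum_le_sum this).trans ?_
  simp

theorem abs_gv_le_one (σ : Signs) (j a i : ℕ) : |gv σ j a i| ≤ 1 := by
  unfold gv
  rw [abs_mul, abs_sgn, mul_one, abs_of_pos (rt_pos j)]
  exact rt_le_one j

theorem not_frameBd_subset {j : ℕ} (hj : 1 ≤ j) {H : ℕ} (hH : H = 4 * (numPts j * 2 ^ j)) :
    {σ | ¬ FrameBd (gv σ) j} ⊆
      {σ | ∃ κ : (Fin (2 ^ j) → Fin (2 * H + 1)) × (Fin (numPts j) → Fin (2 * H + 1)),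
        σ ∈ {σ : Signs | √((j : ℝ) ^ (cE + 2)) / 2 ≤ ∑ p ∈ lvl j, sgn (σ p) *
            (rt j * (decF H (numPts j) κ.2 p.2.1 * decF H (2 ^ j) κ.1 p.2.2)) ∧
          ∑ p ∈ lvl j, (rt j * (decF H (numPts j) κ.2 p.2.1 * decF H (2 ^ j) κ.1 p.2.2)) ^ 2 ≤
            rt j ^ 2}} := by
  intro σ hσ
  simp only [Set.mem_ofPred_eq, FrameBd, not_forall, not_le] at hσ
  obtain ⟨x, hx⟩ := hσ
  set n := 2 ^ j with hn
  set A := numPts j with hA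
  set Λ : ℝ := (j : ℝ) ^ (cE + 2) with hΛ
  have hj' : (1 : ℝ) ≤ j := by exact_mod_cast hj
  have hΛ1 : 1 ≤ Λ := one_le_pow₀ hj'
  have hsx : 0 < ssq n x := by
    rcases (ssq_nonneg n x).lt_or_eq with h | h
    · exact h
    · rw [← h, mul_zero] at hx
      have : ∑ a ∈ Finset.range A, ip n (gv σ j a) x ^ 2 ≤ 0 := by
        refine Finset.sum_nonpos fun a _ => ?_
        have := ip_sq_le n (gv σ j a) x
        rw [← h, mul_zero] at this
        exact this
      linarith
  set q2 := ∑ a ∈ Finset.range A, ip n (gv σ j a) x ^ 2 with hq2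
  have hq2pos : 0 < q2 := lt_of_le_of_lt (by positivity) hx
  set r := √(ssq n x) with hr
  have hrpos : 0 < r := Real.sqrt_pos.2 hsx
  have hr2 : r ^ 2 = ssq n x := Real.sq_sqrt hsx.le
  set q := √q2 with hq
  have hqpos : 0 < q := Real.sqrt_pos.2 hq2pos
  have hqq : q ^ 2 = q2 := Real.sq_sqrt hq2pos.le
  set X : ℕ → ℝ := fun i => x i / r with hX
  set Y : ℕ → ℝ := fun a => ip n (gv σ j a) x / q with hY
  have hX1 : ssq n X = 1 := by
    unfold ssq
    simp only [hX, div_pow, hr2]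
    rw [← Finset.sum_div]
    exact div_self hsx.ne'
  have hY1 : ssq A Y = 1 := by
    unfold ssq
    simp only [hY, div_pow, hqq]
    rw [← Finset.sum_div]
    exact div_self hq2pos.ne'
  have hbil : ∑ a ∈ Finset.range A, ∑ i ∈ Finset.range n, gv σ j a i * (Y a * X i) = q / r := by
    have : ∀ a ∈ Finset.range A, ∑ i ∈ Finset.range n, gv σ j a i * (Y a * X i) =
        ip n (gv σ j a) x ^ 2 / (q * r) := by
      intro a _
      have : ∀ i ∈ Finset.range n, gv σ j a i * (Y a * X i) =
          (gv σ j a i * x i) * (ip n (gv σ j a) x / (q * r)) := by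
        intro i _; simp only [hY, hX]; field_simp
      rw [Finset.sum_congr rfl this, ← Finset.sum_mul]
      change ip n (gv σ j a) x * _ = _
      ring
    rw [Finset.sum_congr rfl this, ← Finset.sum_div, ← hq2, ← hqq]
    field_simp
  have hqr : √Λ ≤ q / r := by
    rw [le_div_iff₀ hrpos, hr, ← Real.sqrt_mul (by positivity)]
    exact Real.sqrt_le_sqrt hx.le
  have hApos : 0 < A := numPts_pos hj
  have hnpos : 0 < n := by positivity
  have hHpos : 0 < H := by rw [hH]; positivity
  obtain ⟨kx, hkx⟩ := exists_decF hHpos n (u := X) (fun i hi => abs_le_one_of_sq hX1.le hi)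
  obtain ⟨ky, hky⟩ := exists_decF hHpos A (u := Y) (fun i hi => abs_le_one_of_sq hY1.le hi)
  refine ⟨(kx, ky), ?_, ?_⟩
  · have hb := bilinear_round (x := X) (x' := decF H n kx) (y := Y) (y' := decF H A ky)
      (G := gv σ j) (h := 1 / H) (m := A) (n := n)
      (fun i hi => abs_le_one_of_sq hX1.le hi) (fun i hi => (hkx i hi).2)
      (fun i hi => (hky i hi).1.trans (abs_le_one_of_sq hY1.le hi)) (fun i hi => (hky i hi).2)
      (abs_gv_le_one σ j)
    have hval : (A : ℝ) * (n * (2 * (1 / (H : ℝ)))) = 1 / 2 := by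
      have : (0 : ℝ) < A := by exact_mod_cast hApos
      have h2 : (0 : ℝ) < n := by exact_mod_cast hnpos
      rw [hH]; push_cast; field_simp; norm_num
    rw [hbil, hval] at hb
    have hs : 1 ≤ √Λ := Real.one_le_sqrt.2 hΛ1
    have := (abs_le.1 hb).2
    rw [sum_lvl]
    have e : ∀ a i, sgn (σ (j, a, i)) * (rt j * (decF H A ky a * decF H n kx i)) =
        gv σ j a i * (decF H A ky a * decF H n kx i) := by
      intro a i; unfold gv; ring
    simp only [e]
    linarith
  · rw [sum_lvl]
    have e : ∀ a i, (rt j * (decF H A ky a * decF H n kx i)) ^ 2 =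
        rt j ^ 2 * (decF H A ky a ^ 2 * decF H n kx i ^ 2) := by intro a i; ring
    simp only [e, ← Finset.mul_sum]
    rw [← Finset.sum_mul]
    have h1 : ∑ i ∈ Finset.range n, decF H n kx i ^ 2 ≤ 1 := by
      rw [← hX1]
      exact Finset.sum_le_sum fun i hi => sq_le_sq.2 (hkx i (Finset.mem_range.1 hi)).1
    have h2 : ∑ i ∈ Finset.range A, decF H A ky i ^ 2 ≤ 1 := by
      rw [← hY1]
      exact Finset.sum_le_sum fun i hi => sq_le_sq.2 (hky i (Finset.mem_range.1 hi)).1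
    have h3 : 0 ≤ ∑ i ∈ Finset.range n, decF H n kx i ^ 2 := ssq_nonneg _ _
    have := mul_le_mul h2 h1 h3 zero_le_one
    rw [one_mul] at this
    exact mul_le_of_le_one_right (sq_nonneg _) this

theorem eventually_dens_frameBd : ∀ᶠ j : ℕ in Filter.atTop, ∀ S : Finset (ℕ × ℕ × ℕ), lvl j ⊆ S →
    dens S {σ | ¬ FrameBd (gv σ) j} ≤ Real.exp (-(10 * j)) := by
  filter_upwards [Filter.eventually_ge_atTop 200, eventually_pow_le_exp 9 cE zero_lt_one]
    with j hj hexp S hS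
  have hj1 : 1 ≤ j := by omega
  have hjr : (200 : ℝ) ≤ j := by exact_mod_cast hj
  set H := 4 * (numPts j * 2 ^ j) with hH
  have key := dens_le_of_subset_exists (S := S) _ (not_frameBd_subset hj1 hH)
    (fun κ => dens_rademacher_le S (lvl j) hS (fun _ => 0)
      (fun p _ => (rt j * (decF H (numPts j) κ.2 p.2.1 * decF H (2 ^ j) κ.1 p.2.2)))
      (fun _ _ _ _ _ _ _ => rfl) (by positivity) (pow_pos (rt_pos j) 2))
  refine key.trans ?_
  simp only [Fintype.card_prod, Fintype.card_fun, Fintype.card_fin]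
  have hjc : (1 : ℝ) ≤ (j : ℝ) ^ cE := one_le_pow₀ (by linarith)
  have h2j : (1 : ℝ) ≤ 2 ^ j := one_le_pow₀ (by norm_num)
  have hA : (numPts j : ℝ) = 2 ^ j * (j : ℝ) ^ cE := by unfold numPts; push_cast; ring
  have hAj : (j : ℝ) ≤ numPts j := by
    rw [hA]
    have : (j : ℝ) ≤ 2 ^ j := by exact_mod_cast Nat.lt_two_pow_self.le
    nlinarith
  have hn : (2 ^ j : ℕ) ≤ numPts j := by
    have : (1 : ℕ) ≤ j ^ cE := Nat.one_le_pow _ _ hj1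
    unfold numPts; nlinarith [Nat.one_le_two_pow (n := j)]
  have hbase : ((2 * H + 1 : ℕ) : ℝ) ≤ Real.exp (j ^ 2 / 32) := by
    have e1 : ((2 * H + 1 : ℕ) : ℝ) ≤ 9 * (j : ℝ) ^ cE * (2 ^ j * 2 ^ j) := by
      rw [hH]; push_cast; rw [hA]
      have : (1 : ℝ) ≤ (j : ℝ) ^ cE * (2 ^ j * 2 ^ j) := by
        have := mul_le_mul h2j h2j zero_le_one (by positivity)
        nlinarith
      nlinarith
    refine e1.trans ?_
    have e2 := two_pow_le_exp j
    calc 9 * (j : ℝ) ^ cE * (2 ^ j * 2 ^ j) ≤ Real.exp (1 * j) * (Real.exp j * Real.exp j) := by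
          gcongr
      _ = Real.exp (3 * j) := by rw [← Real.exp_add, ← Real.exp_add]; ring_nf
      _ ≤ Real.exp (j ^ 2 / 32) := by
          refine Real.exp_le_exp.2 ?_
          nlinarith
  have hs : (√((j : ℝ) ^ (cE + 2)) / 2) ^ 2 / (2 * rt j ^ 2) = numPts j * j ^ 2 / 8 := by
    rw [div_pow, Real.sq_sqrt (by positivity), rt_sq, hA, pow_add]
    field_simp; norm_num
  rw [hs]
  push_cast [← pow_add]
  calc ((2 * H + 1 : ℝ)) ^ (2 ^ j + numPts j) * Real.exp (-(numPts j * j ^ 2 / 8))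
      ≤ Real.exp (j ^ 2 / 32) ^ (2 * numPts j) * Real.exp (-(numPts j * j ^ 2 / 8)) := by
        gcongr
        calc ((2 * H + 1 : ℝ)) ^ (2 ^ j + numPts j) ≤ Real.exp (j ^ 2 / 32) ^ (2 ^ j + numPts j) := by
              gcongr; exact_mod_cast hbase
          _ ≤ Real.exp (j ^ 2 / 32) ^ (2 * numPts j) :=
              pow_le_pow_right₀ (Real.one_le_exp (by positivity)) (by omega)
    _ = Real.exp (-(numPts j * j ^ 2 / 16)) := by
        rw [← Real.exp_nat_mul, ← Real.exp_add]; push_cast; ring_nf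
    _ ≤ _ := by
        refine Real.exp_le_exp.2 ?_
        have : (j : ℝ) * j ^ 2 ≤ numPts j * j ^ 2 := by gcongr
        nlinarith [sq_nonneg ((j : ℝ) - 200)]

/-! ### Incoherence -/

/-- Distinct points of level `j` are almost orthogonal. -/
def Incoherent (g : ℕ → ℕ → ℕ → ℝ) (j : ℕ) : Prop :=
  ∀ a < numPts j, ∀ b < numPts j, a ≠ b → |ip (2 ^ j) (g j a) (g j b)| ≤ j * rt j

theorem gv_update_of_ne {d : DecidableEq (ℕ × ℕ × ℕ)} (σ : Signs) {j a i : ℕ}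
    {q : ℕ × ℕ × ℕ} (v : Bool) (h : (j, a, i) ≠ q) :
    gv (@Function.update _ _ d σ q v) j a i = gv σ j a i := by
  unfold gv; rw [Function.update_of_ne h]

theorem eventually_dens_incoherent : ∀ᶠ j : ℕ in Filter.atTop,
    ∀ S : Finset (ℕ × ℕ × ℕ), lvl j ⊆ S →
    dens S {σ | ¬ Incoherent (gv σ) j} ≤ Real.exp (-(10 * j)) := by
  filter_upwards [Filter.eventually_ge_atTop 200, eventually_pow_le_exp 1 cE zero_lt_one,
    eventually_pow_le_exp 2 0 zero_lt_one] with j hj hexp hexp2 S hS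
  have hj1 : 1 ≤ j := by omega
  have hjr : (200 : ℝ) ≤ j := by exact_mod_cast hj
  set n := 2 ^ j with hn
  let φ : (Fin (numPts j) × Fin (numPts j)) × Bool → (ℕ × ℕ × ℕ) → Signs → ℝ := fun κ p σ =>
    if κ.1.1 = κ.1.2 then 0 else sgn κ.2 * (rt j * gv σ j κ.1.2 p.2.2)
  let I : (Fin (numPts j) × Fin (numPts j)) × Bool → Finset (ℕ × ℕ × ℕ) := fun κ =>
    {j} ×ˢ ({(κ.1.1 : ℕ)} ×ˢ Finset.range n)
  have hsum : ∀ κ (f : ℕ × ℕ × ℕ → ℝ), ∑ p ∈ I κ, f p = ∑ i ∈ Finset.range n, f (j, κ.1.1, i) := by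
    intro κ f
    simp only [I]
    rw [Finset.sum_product, Finset.sum_singleton, Finset.sum_product, Finset.sum_singleton]
  have hmem : ∀ κ p, p ∈ I κ → p.1 = j ∧ p.2.1 = κ.1.1 ∧ p.2.2 < n := by
    intro κ p hp
    simpa only [I, Finset.mem_product, Finset.mem_singleton, Finset.mem_range] using hp
  have hsub : {σ | ¬ Incoherent (gv σ) j} ⊆ {σ | ∃ κ, σ ∈ {σ : Signs |
      j * rt j ≤ ∑ p ∈ I κ, sgn (σ p) * φ κ p σ ∧ ∑ p ∈ I κ, φ κ p σ ^ 2 ≤ rt j ^ 2}} := by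
    intro σ hσ
    simp only [Set.mem_ofPred_eq, Incoherent, not_forall, not_le] at hσ
    obtain ⟨a, ha, b, hb, hab, hlt⟩ := hσ
    set u := ip (2 ^ j) (gv σ j a) (gv σ j b) with hu
    refine ⟨((⟨a, ha⟩, ⟨b, hb⟩), decide (0 ≤ u)), ?_⟩
    have hne : ¬ ((⟨a, ha⟩ : Fin (numPts j)) = ⟨b, hb⟩) := by simpa using hab
    simp only [Set.mem_ofPred_eq, hsum, φ, if_neg hne]
    constructor
    · have : ∑ i ∈ Finset.range n, sgn (σ (j, a, i)) * (sgn (decide (0 ≤ u)) *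
          (rt j * gv σ j b i)) = sgn (decide (0 ≤ u)) * u := by
        rw [hu, ip, Finset.mul_sum]
        refine Finset.sum_congr rfl fun i _ => ?_
        unfold gv; ring
      rw [this]
      refine hlt.le.trans (le_of_eq ?_)
      by_cases h : 0 ≤ u
      · simp [sgn, h, abs_of_nonneg]
      · simp [sgn, h, abs_of_neg (not_le.1 h)]
    · have : ∀ i, (sgn (decide (0 ≤ u)) * (rt j * gv σ j b i)) ^ 2 = rt j ^ 2 * rt j ^ 2 := by
        intro i; rw [mul_pow, mul_pow, sgn_sq, gv_sq, one_mul]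
      simp only [this]
      have := two_pow_mul_rt_sq j
      rw [Finset.sum_const, Finset.card_range, nsmul_eq_mul, hn]
      push_cast
      rw [← mul_assoc, this, one_mul]
  have key := dens_le_of_subset_exists (S := S) _ hsub
    (fun κ => dens_rademacher_le S (I κ) (by
      intro p hp
      obtain ⟨h1, h2, h3⟩ := hmem κ p hp
      exact hS (mem_lvl.2 ⟨h1, by rw [h2]; exact κ.1.1.2, h3⟩)) (fun _ => 0) (φ κ) (by
      intro p hp q hq _ τ v
      simp only [φ]
      split_ifs with h
      · rfl
      · rw [gv_update_of_ne]
        intro he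
        rw [← he] at hq
        have := (hmem κ _ hq).2.1
        exact h (Fin.ext this.symm)) (by have := rt_pos j; positivity) (pow_pos (rt_pos j) 2))
  refine key.trans ?_
  simp only [Fintype.card_prod, Fintype.card_fin, Fintype.card_bool]
  have hs : (j * rt j) ^ 2 / (2 * rt j ^ 2) = (j : ℝ) ^ 2 / 2 := by
    have := rt_pos j
    field_simp
  have hA : (numPts j : ℝ) ≤ Real.exp (2 * j) := by
    unfold numPts; push_cast
    calc (2 : ℝ) ^ j * (j : ℝ) ^ cE ≤ Real.exp j * Real.exp (1 * j) := by
          have := two_pow_le_exp j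
          gcongr; linarith
      _ = _ := by rw [← Real.exp_add]; ring_nf
  rw [hs]
  push_cast
  calc (numPts j : ℝ) * numPts j * 2 * Real.exp (-(j ^ 2 / 2))
      ≤ Real.exp (2 * j) * Real.exp (2 * j) * Real.exp (1 * j) * Real.exp (-(j ^ 2 / 2)) := by
        gcongr
        simpa using hexp2
    _ = Real.exp (5 * j - j ^ 2 / 2) := by
        rw [← Real.exp_add, ← Real.exp_add, ← Real.exp_add]; ring_nf
    _ ≤ _ := Real.exp_le_exp.2 (by nlinarith)

/-! ### Diagonal concentration -/

/-- The quadratic forms of a matrix at the points of level `j` average to its trace. -/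
def DiagConc (g : ℕ → ℕ → ℕ → ℝ) (j : ℕ) : Prop :=
  ∀ T : ℕ → ℕ → ℝ,
    ∑ l ∈ Finset.range (2 ^ j), ssq (2 ^ j) (T l) ≤ 2 ^ j * (j : ℝ) ^ 8 →
    ∑ a ∈ Finset.range (numPts j),
      |∑ l ∈ Finset.range (2 ^ j), g j a l * ip (2 ^ j) (T l) (g j a) -
        (∑ i ∈ Finset.range (2 ^ j), T i i) / 2 ^ j| ≤ numPts j / (j : ℝ) ^ 5

/-- The matrix coded by `k`, padded by zeros. -/
def decM (H m n : ℕ) (k : Fin m → Fin n → Fin (2 * H + 1)) (l i : ℕ) : ℝ :=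
  if h : l < m then decF H n (k ⟨l, h⟩) i else 0

theorem exists_decM {H : ℕ} (hH : 0 < H) (m n : ℕ) {u : ℕ → ℕ → ℝ}
    (hu : ∀ l < m, ∀ i < n, |u l i| ≤ 1) :
    ∃ k, ∀ l < m, ∀ i < n, |decM H m n k l i| ≤ |u l i| ∧ |u l i - decM H m n k l i| ≤ 1 / H := by
  choose k hk using fun l : Fin m => exists_decF hH n (hu l l.2)
  refine ⟨k, fun l hl i hi => ?_⟩
  simpa [decM, hl] using hk ⟨l, hl⟩ i hi

/-- The strictly lower (for `o = true`) or upper triangular part of a matrix. -/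
def tri (o : Bool) (T : ℕ → ℕ → ℝ) (l i : ℕ) : ℝ :=
  if (if o then i < l else l < i) then T l i else 0

theorem tri_sq_le (o : Bool) (T : ℕ → ℕ → ℝ) (l i : ℕ) : tri o T l i ^ 2 ≤ T l i ^ 2 := by
  by_cases h : (if o then i < l else l < i)
  · simp [tri, h]
  · simp only [tri, if_neg h, zero_pow two_ne_zero]; positivity

theorem tri_add_tri (T : ℕ → ℕ → ℝ) (l i : ℕ) :
    T l i = tri true T l i + tri false T l i + if i = l then T l i else 0 := by
  rcases lt_trichotomy i l with h | h | h
  · simp [tri, h, h.not_gt, h.ne]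
  · simp [tri, h]
  · simp [tri, h, h.not_gt, h.ne']

theorem quad_gv_sub_trace (σ : Signs) (j a : ℕ) (T : ℕ → ℕ → ℝ) :
    ∑ l ∈ Finset.range (2 ^ j), gv σ j a l * ip (2 ^ j) (T l) (gv σ j a) -
        (∑ i ∈ Finset.range (2 ^ j), T i i) / 2 ^ j =
      ∑ l ∈ Finset.range (2 ^ j), gv σ j a l * ip (2 ^ j) (tri true T l) (gv σ j a) +
      ∑ l ∈ Finset.range (2 ^ j), gv σ j a l * ip (2 ^ j) (tri false T l) (gv σ j a) := by
  rw [sub_eq_iff_eq_add, Finset.sum_div, ← Finset.sum_add_distrib, ← Finset.sum_add_distrib]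
  refine Finset.sum_congr rfl fun l hl => ?_
  have : ip (2 ^ j) (T l) (gv σ j a) = ip (2 ^ j) (tri true T l) (gv σ j a) +
      ip (2 ^ j) (tri false T l) (gv σ j a) + T l l * gv σ j a l := by
    unfold ip
    rw [← Finset.sum_add_distrib]
    have e : T l l * gv σ j a l =
        ∑ i ∈ Finset.range (2 ^ j), (if i = l then T l i else 0) * gv σ j a i := by
      simp only [ite_mul, zero_mul]
      rw [Finset.sum_ite_eq' _ l]
      simp [hl]
    rw [e, ← Finset.sum_add_distrib]
    refine Finset.sum_congr rfl fun i _ => ?_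
    conv_lhs => rw [tri_add_tri T l i]
    ring
  rw [this]
  have h2 := gv_sq σ j a l
  rw [rt_sq] at h2
  have : gv σ j a l * (T l l * gv σ j a l) = T l l / 2 ^ j := by
    rw [div_eq_mul_inv, ← h2]; ring
  linear_combination this

theorem quad_abs_sub_le (σ : Signs) (j a : ℕ) {T T' : ℕ → ℕ → ℝ} {h : ℝ}
    (hT : ∀ l < 2 ^ j, ∀ i < 2 ^ j, |T l i - T' l i| ≤ h) :
    |∑ l ∈ Finset.range (2 ^ j), gv σ j a l * ip (2 ^ j) (T l) (gv σ j a) -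
      ∑ l ∈ Finset.range (2 ^ j), gv σ j a l * ip (2 ^ j) (T' l) (gv σ j a)| ≤
      2 ^ j * (2 ^ j * h) := by
  rw [← Finset.sum_sub_distrib]
  refine (Finset.abs_sum_le_sum_abs _ _).trans ?_
  have : ∀ l ∈ Finset.range (2 ^ j), |gv σ j a l * ip (2 ^ j) (T l) (gv σ j a) -
      gv σ j a l * ip (2 ^ j) (T' l) (gv σ j a)| ≤ 2 ^ j * h := by
    intro l hl
    rw [← mul_sub, abs_mul]
    have h1 : |ip (2 ^ j) (T l) (gv σ j a) - ip (2 ^ j) (T' l) (gv σ j a)| ≤ 2 ^ j * h := by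
      unfold ip
      rw [← Finset.sum_sub_distrib]
      refine (Finset.abs_sum_le_sum_abs _ _).trans ?_
      have : ∀ i ∈ Finset.range (2 ^ j), |T l i * gv σ j a i - T' l i * gv σ j a i| ≤ h := by
        intro i hi
        rw [← sub_mul, abs_mul]
        have h2 := hT l (Finset.mem_range.1 hl) i (Finset.mem_range.1 hi)
        have := mul_le_mul h2 (abs_gv_le_one σ j a i) (abs_nonneg _) ((abs_nonneg _).trans h2)
        linarith
      refine (Finset.sum_le_sum this).trans ?_
      simp
    have := mul_le_mul (abs_gv_le_one σ j a l) h1 (abs_nonneg _) zero_le_one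
    linarith
  refine (Finset.sum_le_sum this).trans ?_
  simp

theorem tri_sub_le (o : Bool) {T T' : ℕ → ℕ → ℝ} {l i : ℕ} {h : ℝ} (hT : |T l i - T' l i| ≤ h) :
    |tri o T l i - tri o T' l i| ≤ h := by
  unfold tri
  split_ifs
  all_goals first | exact hT | (simp; exact (abs_nonneg _).trans hT)

theorem eventually_pow_le_two_pow (K : ℝ) (m : ℕ) :
    ∀ᶠ j : ℕ in Filter.atTop, K * (j : ℝ) ^ m ≤ 2 ^ j := by
  filter_upwards [eventually_pow_le_exp K m (show (0 : ℝ) < 1 / 2 by norm_num)] with j hj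
  refine hj.trans (le_trans (le_of_eq ?_) (exp_half_le_two_pow j))
  ring_nf

/-- The increments whose sum is one triangular half of a signed sum of quadratic forms. -/
def diagIncr (j : ℕ) (o : Bool) (ε : ℕ → Bool) (T : ℕ → ℕ → ℝ) (p : ℕ × ℕ × ℕ) (σ : Signs) : ℝ :=
  rt j * (sgn (ε p.2.1) * ip (2 ^ j) (tri o T p.2.2) (gv σ j p.2.1))

/-- Extension of a Boolean vector by `false`. -/
def extB (n : ℕ) (ε : Fin n → Bool) (a : ℕ) : Bool := if h : a < n then ε ⟨a, h⟩ else false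

theorem diagIncr_update {j : ℕ} (o : Bool) (ε : ℕ → Bool) (T : ℕ → ℕ → ℝ)
    {d : DecidableEq (ℕ × ℕ × ℕ)} {p q : ℕ × ℕ × ℕ} (hq : q.2.2 < 2 ^ j)
    (h : (if o then p.2.2 else 2 ^ j - p.2.2) ≤ (if o then q.2.2 else 2 ^ j - q.2.2))
    (τ : Signs) (v : Bool) :
    diagIncr j o ε T p (@Function.update _ _ d τ q v) = diagIncr j o ε T p τ := by
  unfold diagIncr ip
  congr 2
  refine Finset.sum_congr rfl fun i _ => ?_
  by_cases hi : (if o then i < p.2.2 else p.2.2 < i)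
  · rw [gv_update_of_ne]
    rintro rfl
    cases o <;> simp at hi h hq <;> omega
  · simp [tri, hi]

theorem sum_diagIncr_sq_le {j : ℕ} {σ : Signs} (hF : FrameBd (gv σ) j) (o : Bool) (ε : ℕ → Bool)
    {T : ℕ → ℕ → ℝ} (hT : ∑ l ∈ Finset.range (2 ^ j), ssq (2 ^ j) (T l) ≤ 2 ^ j * (j : ℝ) ^ 8) :
    ∑ p ∈ lvl j, diagIncr j o ε T p σ ^ 2 ≤ (j : ℝ) ^ (cE + 10) := by
  rw [sum_lvl]
  simp only [diagIncr, mul_pow, sgn_sq, one_mul]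
  rw [Finset.sum_comm]
  have h1 : ∀ l ∈ Finset.range (2 ^ j), ∑ a ∈ Finset.range (numPts j),
      rt j ^ 2 * ip (2 ^ j) (tri o T l) (gv σ j a) ^ 2 ≤
      rt j ^ 2 * ((j : ℝ) ^ (cE + 2) * ssq (2 ^ j) (T l)) := by
    intro l _
    rw [← Finset.mul_sum]
    refine mul_le_mul_of_nonneg_left ?_ (sq_nonneg _)
    have := hF (tri o T l)
    simp only [ip_comm (2 ^ j) (gv σ j _)] at this
    refine this.trans (mul_le_mul_of_nonneg_left ?_ (by positivity))
    exact Finset.sum_le_sum fun i _ => tri_sq_le o T l i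
  refine (Finset.sum_le_sum h1).trans ?_
  rw [← Finset.mul_sum, ← Finset.mul_sum, rt_sq]
  calc ((2 : ℝ) ^ j)⁻¹ * ((j : ℝ) ^ (cE + 2) * ∑ l ∈ Finset.range (2 ^ j), ssq (2 ^ j) (T l))
      ≤ ((2 : ℝ) ^ j)⁻¹ * ((j : ℝ) ^ (cE + 2) * (2 ^ j * (j : ℝ) ^ 8)) := by gcongr
    _ = _ := by field_simp; ring

theorem not_diagConc_subset {j : ℕ} (hj : 1 ≤ j) {L H : ℕ} (hL : L = 2 ^ j * j ^ 4)
    (hH : H = 8 * (2 ^ j * 2 ^ j * L) * j ^ 5) :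
    {σ | FrameBd (gv σ) j ∧ ¬ DiagConc (gv σ) j} ⊆
      {σ | ∃ κ : Bool × (Fin (numPts j) → Bool) × (Fin (2 ^ j) → Fin (2 ^ j) → Fin (2 * H + 1)),
        σ ∈ {σ : Signs | (numPts j : ℝ) / (j : ℝ) ^ 5 / 4 ≤ ∑ p ∈ lvl j, sgn (σ p) *
            diagIncr j κ.1 (extB _ κ.2.1) (fun l i => L * decM H _ _ κ.2.2 l i) p σ ∧
          ∑ p ∈ lvl j, diagIncr j κ.1 (extB _ κ.2.1)
            (fun l i => L * decM H _ _ κ.2.2 l i) p σ ^ 2 ≤ (j : ℝ) ^ (cE + 10)}} := by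
  rintro σ ⟨hF, hσ⟩
  simp only [DiagConc, not_forall, not_le] at hσ
  obtain ⟨T, hT, hlt⟩ := hσ
  set n := 2 ^ j with hn
  set A := numPts j with hA
  have hj' : (1 : ℝ) ≤ j := by exact_mod_cast hj
  have hLpos : 0 < L := by rw [hL]; positivity
  have hLr : (0 : ℝ) < L := by exact_mod_cast hLpos
  have hHpos : 0 < H := by rw [hH]; positivity
  have hLval : (L : ℝ) = 2 ^ j * (j : ℝ) ^ 4 := by rw [hL, hn]; push_cast; ring
  have h2j : (1 : ℝ) ≤ 2 ^ j := one_le_pow₀ (by norm_num)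
  have hent : ∀ l < n, ∀ i < n, |T l i / L| ≤ 1 := by
    intro l hl i hi
    rw [abs_div, abs_of_pos hLr, div_le_one hLr]
    refine abs_le_of_sq_le_sq ?_ hLr.le
    have e1 : T l i ^ 2 ≤ ssq n (T l) :=
      Finset.single_le_sum (f := fun i => T l i ^ 2) (fun _ _ => sq_nonneg _)
        (Finset.mem_range.2 hi)
    have e2 : ssq n (T l) ≤ ∑ l ∈ Finset.range n, ssq n (T l) :=
      Finset.single_le_sum (f := fun l => ssq n (T l)) (fun _ _ => ssq_nonneg _ _)
        (Finset.mem_range.2 hl)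
    refine (e1.trans (e2.trans hT)).trans ?_
    have e8 : ((j : ℝ) ^ 4) ^ 2 = (j : ℝ) ^ 8 := by ring
    have : (2 : ℝ) ^ j ≤ (2 ^ j) ^ 2 := by nlinarith
    rw [hLval, mul_pow, e8]
    exact mul_le_mul_of_nonneg_right this (by positivity)
  obtain ⟨k, hk⟩ := exists_decM hHpos n n hent
  set T' : ℕ → ℕ → ℝ := fun l i => L * decM H _ _ k l i with hT'
  have hle : ∀ l < n, ∀ i < n, |T' l i| ≤ |T l i| := by
    intro l hl i hi
    have := (hk l hl i hi).1
    rw [abs_div, abs_of_pos hLr, le_div_iff₀ hLr] at this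
    rw [hT', abs_mul, abs_of_pos hLr]; linarith
  have hsub : ∀ l < n, ∀ i < n, |T l i - T' l i| ≤ L / H := by
    intro l hl i hi
    have := (hk l hl i hi).2
    have e : T l i - T' l i = L * (T l i / L - decM H _ _ k l i) := by
      rw [hT']; field_simp
    rw [e, abs_mul, abs_of_pos hLr]
    calc (L : ℝ) * |T l i / L - decM H _ _ k l i| ≤ L * (1 / H) := by gcongr
      _ = L / H := by ring
  have hT'n : ∑ l ∈ Finset.range n, ssq n (T' l) ≤ 2 ^ j * (j : ℝ) ^ 8 := by
    refine le_trans ?_ hT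
    refine Finset.sum_le_sum fun l hl => Finset.sum_le_sum fun i hi => ?_
    exact sq_le_sq.2 (hle l (Finset.mem_range.1 hl) i (Finset.mem_range.1 hi))
  set Q : (ℕ → ℕ → ℝ) → Bool → ℕ → ℝ := fun T o a =>
    ∑ l ∈ Finset.range (2 ^ j), gv σ j a l * ip (2 ^ j) (tri o T l) (gv σ j a) with hQ
  have hQsub : ∀ o a, |Q T o a - Q T' o a| ≤ 1 / (8 * (j : ℝ) ^ 5) := by
    intro o a
    have := quad_abs_sub_le σ j a (T := tri o T) (T' := tri o T') (h := L / H)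
      (fun l hl i hi => tri_sub_le o (hsub l hl i hi))
    refine this.trans (le_of_eq ?_)
    have hnr : (n : ℝ) = 2 ^ j := by rw [hn]; push_cast; rfl
    rw [hH]; push_cast; rw [hnr]; field_simp
  set qa : ℕ → ℝ := fun a => Q T true a + Q T false a with hqa
  have hlt' : (A : ℝ) / (j : ℝ) ^ 5 < ∑ a ∈ Finset.range A, |qa a| := by
    refine hlt.trans_le (le_of_eq (Finset.sum_congr rfl fun a _ => ?_))
    rw [quad_gv_sub_trace]
  set ε : Fin A → Bool := fun a => decide (0 ≤ qa a) with hε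
  have hε' : ∀ a < A, sgn (extB A ε a) * qa a = |qa a| := by
    intro a ha
    simp only [extB, ha, dif_pos, hε]
    by_cases h : 0 ≤ qa a
    · simp [sgn, h, abs_of_nonneg]
    · simp [sgn, h, abs_of_neg (not_le.1 h)]
  have hsum : (A : ℝ) / (j : ℝ) ^ 5 / 2 ≤ ∑ a ∈ Finset.range A, sgn (extB A ε a) * Q T' true a +
      ∑ a ∈ Finset.range A, sgn (extB A ε a) * Q T' false a := by
    have h1 : ∀ a ∈ Finset.range A, |qa a| - 1 / (4 * (j : ℝ) ^ 5) ≤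
        sgn (extB A ε a) * Q T' true a + sgn (extB A ε a) * Q T' false a := by
      intro a ha
      rw [← hε' a (Finset.mem_range.1 ha)]
      have e : sgn (extB A ε a) * qa a - (sgn (extB A ε a) * Q T' true a +
          sgn (extB A ε a) * Q T' false a) = sgn (extB A ε a) *
          ((Q T true a - Q T' true a) + (Q T false a - Q T' false a)) := by
        simp only [hqa]; ring
      have h2 : |(Q T true a - Q T' true a) + (Q T false a - Q T' false a)| ≤
          1 / (4 * (j : ℝ) ^ 5) := by
        refine (abs_add_le _ _).trans ?_
        have := hQsub true a
        have := hQsub false a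
        have e : 1 / (4 * (j : ℝ) ^ 5) = 1 / (8 * (j : ℝ) ^ 5) + 1 / (8 * (j : ℝ) ^ 5) := by
          field_simp; norm_num
        linarith
      have h3 : sgn (extB A ε a) *
          ((Q T true a - Q T' true a) + (Q T false a - Q T' false a)) ≤ 1 / (4 * (j : ℝ) ^ 5) := by
        refine (le_abs_self _).trans ?_
        rw [abs_mul, abs_sgn, one_mul]; exact h2
      linarith
    rw [← Finset.sum_add_distrib]
    refine le_trans ?_ (Finset.sum_le_sum h1)
    rw [Finset.sum_sub_distrib]
    simp only [Finset.sum_const, Finset.card_range, nsmul_eq_mul]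
    have : (A : ℝ) * (1 / (4 * (j : ℝ) ^ 5)) = A / (j : ℝ) ^ 5 / 4 := by field_simp
    have : (0 : ℝ) ≤ A / (j : ℝ) ^ 5 := by positivity
    linarith
  have hform : ∀ o, ∑ p ∈ lvl j, sgn (σ p) * diagIncr j o (extB A ε) T' p σ =
      ∑ a ∈ Finset.range A, sgn (extB A ε a) * Q T' o a := by
    intro o
    rw [sum_lvl]
    refine Finset.sum_congr rfl fun a _ => ?_
    simp only [hQ]
    rw [Finset.mul_sum]
    refine Finset.sum_congr rfl fun l _ => ?_
    unfold diagIncr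
    change sgn (σ (j, a, l)) * (rt j * (sgn (extB A ε a) * ip (2 ^ j) (tri o T' l) (gv σ j a))) =
      sgn (extB A ε a) * (rt j * sgn (σ (j, a, l)) * ip (2 ^ j) (tri o T' l) (gv σ j a))
    ring
  have hor : ∃ o, (A : ℝ) / (j : ℝ) ^ 5 / 4 ≤
      ∑ a ∈ Finset.range A, sgn (extB A ε a) * Q T' o a := by
    by_contra hcon
    push Not at hcon
    have := hcon true
    have := hcon false
    linarith
  obtain ⟨o, ho⟩ := hor
  refine ⟨(o, ε, k), ?_, ?_⟩
  · rw [← hform o] at ho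
    exact ho
  · exact sum_diagIncr_sq_le hF o _ hT'n

theorem eventually_dens_diagConc : ∀ᶠ j : ℕ in Filter.atTop,
    ∀ S : Finset (ℕ × ℕ × ℕ), lvl j ⊆ S →
    dens S {σ | FrameBd (gv σ) j ∧ ¬ DiagConc (gv σ) j} ≤ Real.exp (-(10 * j)) := by
  filter_upwards [Filter.eventually_ge_atTop 200, eventually_pow_le_exp 17 9 zero_lt_one,
    eventually_pow_le_two_pow 96 20] with j hj hexp hexp2 S hS
  have hj1 : 1 ≤ j := by omega
  have hjr : (200 : ℝ) ≤ j := by exact_mod_cast hj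
  set L := 2 ^ j * j ^ 4 with hL
  set H := 8 * (2 ^ j * 2 ^ j * L) * j ^ 5 with hH
  have key := dens_le_of_subset_exists (S := S) _ (not_diagConc_subset hj1 hL hH)
    (fun κ => dens_rademacher_le S (lvl j) hS
      (fun p => if κ.1 then p.2.2 else 2 ^ j - p.2.2)
      (diagIncr j κ.1 (extB _ κ.2.1) (fun l i => L * decM H _ _ κ.2.2 l i))
      (fun p _ q hq h τ v => diagIncr_update _ _ _ (mem_lvl.1 hq).2.2 h τ v)
      (by positivity) (by positivity))
  refine key.trans ?_
  simp only [Fintype.card_prod, Fintype.card_fun, Fintype.card_fin, Fintype.card_bool]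
  have h2j : (1 : ℝ) ≤ 2 ^ j := one_le_pow₀ (by norm_num)
  have hA : (numPts j : ℝ) = 2 ^ j * (j : ℝ) ^ cE := by unfold numPts; push_cast; ring
  obtain ⟨c', hc', hc3⟩ : ∃ c', cE = c' + 20 ∧ 3 ≤ c' := ⟨420, by rw [cE_eq], by norm_num⟩
  have hjpos : (0 : ℝ) < j := by linarith
  have hs : ((numPts j : ℝ) / (j : ℝ) ^ 5 / 4) ^ 2 / (2 * (j : ℝ) ^ (cE + 10)) =
      2 ^ j * 2 ^ j * (j : ℝ) ^ c' / 32 := by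
    rw [hA, hc']
    simp only [pow_add]
    field_simp; norm_num
  rw [hs]
  have hbase : ((2 * H + 1 : ℕ) : ℝ) ≤ Real.exp (5 * j) := by
    have e1 : ((2 * H + 1 : ℕ) : ℝ) ≤ 17 * (j : ℝ) ^ 9 * (2 ^ j * 2 ^ j * 2 ^ j) := by
      rw [hH, hL]; push_cast
      have : (1 : ℝ) ≤ (j : ℝ) ^ 9 * (2 ^ j * 2 ^ j * 2 ^ j) :=
        one_le_mul_of_one_le_of_one_le (one_le_pow₀ (by linarith))
          (one_le_mul_of_one_le_of_one_le (one_le_mul_of_one_le_of_one_le h2j h2j) h2j)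
      nlinarith
    refine e1.trans ?_
    have e2 := two_pow_le_exp j
    calc 17 * (j : ℝ) ^ 9 * (2 ^ j * 2 ^ j * 2 ^ j) ≤
          Real.exp (1 * j) * (Real.exp j * Real.exp j * Real.exp j) := by gcongr
      _ = Real.exp (4 * j) := by rw [← Real.exp_add, ← Real.exp_add, ← Real.exp_add]; ring_nf
      _ ≤ Real.exp (5 * j) := Real.exp_le_exp.2 (by linarith)
  have hmain : 2 ^ j * (j : ℝ) ^ cE + 2 ^ j * 2 ^ j * (5 * j) + 11 * j ≤
      2 ^ j * 2 ^ j * (j : ℝ) ^ c' / 32 := by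
    have h3 : (j : ℝ) ^ 3 ≤ (j : ℝ) ^ c' := pow_le_pow_right₀ (by linarith) hc3
    have hj3 : 40000 * (j : ℝ) ≤ (j : ℝ) ^ 3 := by nlinarith [sq_nonneg ((j : ℝ) - 200)]
    have hnn : (1 : ℝ) ≤ 2 ^ j * 2 ^ j := one_le_mul_of_one_le_of_one_le h2j h2j
    have i1 : 2 ^ j * (j : ℝ) ^ cE ≤ 2 ^ j * 2 ^ j * (j : ℝ) ^ c' / 96 := by
      rw [hc', pow_add]
      have := mul_le_mul_of_nonneg_left hexp2 (by positivity : 0 ≤ 2 ^ j * (j : ℝ) ^ c')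
      nlinarith
    have i2 : 2 ^ j * 2 ^ j * (5 * j) ≤ 2 ^ j * 2 ^ j * (j : ℝ) ^ c' / 96 := by
      have : 5 * (j : ℝ) ≤ (j : ℝ) ^ c' / 96 := by linarith
      have := mul_le_mul_of_nonneg_left this (by positivity : 0 ≤ (2 : ℝ) ^ j * 2 ^ j)
      linarith
    have i3 : 11 * (j : ℝ) ≤ 2 ^ j * 2 ^ j * (j : ℝ) ^ c' / 96 := by
      have : 11 * (j : ℝ) ≤ (j : ℝ) ^ c' / 96 := by linarith
      have := mul_le_mul_of_nonneg_right hnn (by positivity : 0 ≤ (j : ℝ) ^ c' / 96)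
      linarith
    linarith
  have h2A : (2 : ℝ) * 2 ^ numPts j ≤ Real.exp (j + numPts j) := by
    rw [Real.exp_add]
    have := two_pow_le_exp (numPts j)
    have := two_pow_le_exp j
    have : (2 : ℝ) ≤ 2 ^ j := by
      calc (2 : ℝ) = 2 ^ 1 := by norm_num
        _ ≤ 2 ^ j := pow_le_pow_right₀ (by norm_num) hj1
    gcongr; linarith
  have hcnt : (((2 * H + 1 : ℕ) : ℝ) ^ 2 ^ j) ^ 2 ^ j ≤ Real.exp (2 ^ j * 2 ^ j * (5 * j)) := by
    calc (((2 * H + 1 : ℕ) : ℝ) ^ 2 ^ j) ^ 2 ^ j ≤ (Real.exp (5 * j) ^ 2 ^ j) ^ 2 ^ j := by gcongr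
      _ = _ := by
        rw [← Real.exp_nat_mul, ← Real.exp_nat_mul]; push_cast; ring_nf
  push_cast at hcnt ⊢
  calc (2 : ℝ) * (2 ^ numPts j * ((2 * (H : ℝ) + 1) ^ 2 ^ j) ^ 2 ^ j) *
        Real.exp (-(2 ^ j * 2 ^ j * (j : ℝ) ^ c' / 32))
      = (2 * 2 ^ numPts j) * ((2 * (H : ℝ) + 1) ^ 2 ^ j) ^ 2 ^ j *
        Real.exp (-(2 ^ j * 2 ^ j * (j : ℝ) ^ c' / 32)) := by ring
    _ ≤ Real.exp (j + numPts j) * Real.exp (2 ^ j * 2 ^ j * (5 * j)) *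
        Real.exp (-(2 ^ j * 2 ^ j * (j : ℝ) ^ c' / 32)) := by gcongr
    _ ≤ _ := by
        rw [← Real.exp_add, ← Real.exp_add]
        refine Real.exp_le_exp.2 ?_
        rw [hA]
        linarith

theorem ip_sum_right {ι : Type*} (n : ℕ) (x : ℕ → ℝ) (s : Finset ι) (c : ι → ℝ) (y : ι → ℕ → ℝ) :
    ip n x (fun i => ∑ a ∈ s, c a * y a i) = ∑ a ∈ s, c a * ip n x (y a) := by
  simp only [ip, Finset.mul_sum]
  rw [Finset.sum_comm]
  exact Finset.sum_congr rfl fun _ _ => Finset.sum_congr rfl fun _ _ => by ring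

/-- The entry `⟨g^k_b, T g^j_a⟩` of `T` with respect to the points of levels `k` and `j`. -/
def ment (g : ℕ → ℕ → ℕ → ℝ) (j k : ℕ) (T : ℕ → ℕ → ℝ) (b a : ℕ) : ℝ :=
  ip (2 ^ k) (g k b) (fun l => ip (2 ^ j) (T l) (g j a))

/-- The logarithmic threshold above which an entry counts as heavy. -/
def sep (j k : ℕ) : ℕ := min j k / 16

/-- Quadratic bound for the heavy entries of a matrix between levels `j` and `k`. -/
def CrossBd (g : ℕ → ℕ → ℕ → ℝ) (j k : ℕ) : Prop :=
  ∀ T : ℕ → ℕ → ℝ, (∀ l < 2 ^ k, ∀ i < 2 ^ j, |T l i| ≤ (j : ℝ) ^ 4) →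
    (∀ F ⊆ Finset.range (numPts j), F.card ≤ 2 ^ (j / 4) → ∀ c : ℕ → ℝ,
      ssq (2 ^ k) (fun l => ip (2 ^ j) (T l) (fun i => ∑ a ∈ F, c a * g j a i)) ≤
        (j : ℝ) ^ (2 * dE + 8) * ∑ a ∈ F, c a ^ 2) →
    ∀ E : Finset (ℕ × ℕ), (∀ p ∈ E, p.1 < numPts k ∧ p.2 < numPts j ∧ (k, p.1) ≠ (j, p.2) ∧
        ((2 : ℝ) ^ sep j k)⁻¹ ≤ |ment g j k T p.1 p.2|) →
      (∀ b, (E.filter fun p => p.1 = b).card ≤ 2 ^ (j / 4)) →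
      ∑ p ∈ E, ment g j k T p.1 p.2 ^ 2 ≤ 2 ^ j * (j : ℝ) ^ (2 * dE + 12)

/-- Orientation of a pair of points of levels `k` and `j`. -/
def orient (o : Bool) (j k b a : ℕ) : Prop := if o then k ≠ j ∨ a < b else k = j ∧ b < a

/-- The increments whose sum is the pairing of a matrix with the entries of `T`. -/
def crossIncr (j k : ℕ) (C : ℕ → ℕ → ℝ) (T : ℕ → ℕ → ℝ) (p : ℕ × ℕ × ℕ) (σ : Signs) : ℝ :=
  rt k * ip (2 ^ j) (T p.2.2) (fun i => ∑ a ∈ Finset.range (numPts j), C p.2.1 a * gv σ j a i)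

theorem crossIncr_update {j k : ℕ} {o : Bool} {C : ℕ → ℕ → ℝ}
    (hC : ∀ b a, C b a ≠ 0 → orient o j k b a) (T : ℕ → ℕ → ℝ)
    {d : DecidableEq (ℕ × ℕ × ℕ)} {p q : ℕ × ℕ × ℕ} (hp : p ∈ lvl k) (hq : q ∈ lvl k)
    (h : (if o then p.2.1 else numPts k - p.2.1) ≤ (if o then q.2.1 else numPts k - q.2.1))
    (τ : Signs) (v : Bool) :
    crossIncr j k C T p (@Function.update _ _ d τ q v) = crossIncr j k C T p τ := by
  unfold crossIncr ip
  congr 1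
  refine Finset.sum_congr rfl fun i _ => ?_
  congr 1
  refine Finset.sum_congr rfl fun a _ => ?_
  by_cases h0 : C p.2.1 a = 0
  · simp [h0]
  · have ho := hC _ _ h0
    rw [gv_update_of_ne]
    obtain ⟨q1, q2, q3⟩ := q
    have hp' := mem_lvl.1 hp
    have hq' := mem_lvl.1 hq
    simp only at hq' h
    rintro ⟨⟩
    cases o
    · simp [orient] at ho h; omega
    · simp [orient] at ho h; omega

theorem sum_crossIncr (j k : ℕ) (C : ℕ → ℕ → ℝ) (T : ℕ → ℕ → ℝ) (σ : Signs) :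
    ∑ p ∈ lvl k, sgn (σ p) * crossIncr j k C T p σ =
      ∑ b ∈ Finset.range (numPts k), ∑ a ∈ Finset.range (numPts j),
        C b a * ment (gv σ) j k T b a := by
  rw [sum_lvl]
  refine Finset.sum_congr rfl fun b _ => ?_
  simp only [crossIncr, ip_sum_right, Finset.mul_sum]
  rw [Finset.sum_comm]
  refine Finset.sum_congr rfl fun a _ => ?_
  rw [ment, ip, Finset.mul_sum]
  refine Finset.sum_congr rfl fun l _ => ?_
  rw [gv]; ring

theorem sum_crossIncr_sq (j k : ℕ) (C : ℕ → ℕ → ℝ) (T : ℕ → ℕ → ℝ) (σ : Signs) :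
    ∑ p ∈ lvl k, crossIncr j k C T p σ ^ 2 = ((2 : ℝ) ^ k)⁻¹ *
      ∑ b ∈ Finset.range (numPts k), ssq (2 ^ k) (fun l => ip (2 ^ j) (T l)
        (fun i => ∑ a ∈ Finset.range (numPts j), C b a * gv σ j a i)) := by
  rw [sum_lvl, Finset.mul_sum]
  refine Finset.sum_congr rfl fun b _ => ?_
  rw [ssq, Finset.mul_sum]
  refine Finset.sum_congr rfl fun l _ => ?_
  rw [crossIncr, mul_pow, rt_sq]

theorem ssq_sub_le (n : ℕ) (x y : ℕ → ℝ) :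
    ssq n (fun l => x l - y l) ≤ 2 * ssq n x + 2 * ssq n y := by
  simp only [ssq, Finset.mul_sum, ← Finset.sum_add_distrib]
  exact Finset.sum_le_sum fun i _ => by nlinarith [sq_nonneg (x i + y i)]

theorem ssq_comb_round {j k : ℕ} (σ : Signs) {T T' : ℕ → ℕ → ℝ} {h B : ℝ} {F : Finset ℕ}
    {c : ℕ → ℝ} (hh : 0 ≤ h) (hB : 1 ≤ B)
    (hTT : ∀ l < 2 ^ k, ∀ i < 2 ^ j, |T l i - T' l i| ≤ h)
    (hF : (F.card : ℝ) ≤ 2 ^ j)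
    (hsmall : (2 : ℝ) ^ k * 2 ^ j * 2 ^ j * h ≤ 1)
    (hT : ssq (2 ^ k) (fun l => ip (2 ^ j) (T l) (fun i => ∑ a ∈ F, c a * gv σ j a i)) ≤
      B * ∑ a ∈ F, c a ^ 2) :
    ssq (2 ^ k) (fun l => ip (2 ^ j) (T' l) (fun i => ∑ a ∈ F, c a * gv σ j a i)) ≤
      4 * B * ∑ a ∈ F, c a ^ 2 := by
  set w : ℕ → ℝ := fun i => ∑ a ∈ F, c a * gv σ j a i with hw
  have hS : 0 ≤ ∑ a ∈ F, c a ^ 2 := Finset.sum_nonneg fun _ _ => sq_nonneg _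
  have hwi : ∀ i, |w i| ≤ ∑ a ∈ F, |c a| := by
    intro i
    refine (Finset.abs_sum_le_sum_abs _ _).trans (Finset.sum_le_sum fun a _ => ?_)
    rw [abs_mul]
    exact mul_le_of_le_one_right (abs_nonneg _) (abs_gv_le_one _ _ _ _)
  have hCS : (∑ a ∈ F, |c a|) ^ 2 ≤ 2 ^ j * ∑ a ∈ F, c a ^ 2 := by
    have := sq_sum_le_card_mul_sum_sq (s := F) (f := fun a => |c a|)
    simp only [sq_abs] at this
    exact this.trans (mul_le_mul_of_nonneg_right hF hS)
  have hdiff : ∀ l < 2 ^ k, (ip (2 ^ j) (fun i => T l i - T' l i) w) ^ 2 ≤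
      (2 ^ j * h) ^ 2 * (2 ^ j * ∑ a ∈ F, c a ^ 2) := by
    intro l hl
    have h1 : |ip (2 ^ j) (fun i => T l i - T' l i) w| ≤ 2 ^ j * h * ∑ a ∈ F, |c a| := by
      refine (Finset.abs_sum_le_sum_abs _ _).trans ?_
      refine (Finset.sum_le_card_nsmul _ _ (h * ∑ a ∈ F, |c a|) fun i hi => ?_).trans
        (le_of_eq ?_)
      · rw [abs_mul]
        exact mul_le_mul (hTT l hl i (Finset.mem_range.1 hi)) (hwi i) (abs_nonneg _) hh
      · rw [Finset.card_range, nsmul_eq_mul]; push_cast; ring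
    rw [← sq_abs]
    refine (pow_le_pow_left₀ (abs_nonneg _) h1 2).trans ?_
    rw [mul_pow]
    exact mul_le_mul_of_nonneg_left hCS (sq_nonneg _)
  have hd : ssq (2 ^ k) (fun l => ip (2 ^ j) (fun i => T l i - T' l i) w) ≤
      ∑ a ∈ F, c a ^ 2 := by
    refine (Finset.sum_le_card_nsmul _ _ _ fun l hl => hdiff l (Finset.mem_range.1 hl)).trans ?_
    rw [Finset.card_range, nsmul_eq_mul]
    push_cast
    have k1 : (1 : ℝ) ≤ 2 ^ k := one_le_pow₀ (by norm_num)
    have j1 : (1 : ℝ) ≤ 2 ^ j := one_le_pow₀ (by norm_num)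
    have e : (2 : ℝ) ^ k * ((2 ^ j * h) ^ 2 * (2 ^ j * ∑ a ∈ F, c a ^ 2)) =
      (2 ^ k * 2 ^ j * 2 ^ j * h) * (2 ^ j * h) * ∑ a ∈ F, c a ^ 2 := by ring
    rw [e]
    refine mul_le_of_le_one_left hS ?_
    refine mul_le_one₀ hsmall (by positivity) (le_trans ?_ hsmall)
    have : (1 : ℝ) ≤ 2 ^ k * 2 ^ j := one_le_mul_of_one_le_of_one_le k1 j1
    have h0 : 0 ≤ 2 ^ j * h := by positivity
    nlinarith
  have hfun : (fun l => ip (2 ^ j) (T' l) w) =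
      fun l => ip (2 ^ j) (T l) w - ip (2 ^ j) (fun i => T l i - T' l i) w := by
    funext l
    simp only [ip, ← Finset.sum_sub_distrib]
    exact Finset.sum_congr rfl fun i _ => by ring
  rw [hfun]
  refine (ssq_sub_le _ _ _).trans ?_
  nlinarith

theorem ment_round {j k : ℕ} (σ : Signs) {T T' : ℕ → ℕ → ℝ} {h : ℝ}
    (hTT : ∀ l < 2 ^ k, ∀ i < 2 ^ j, |T l i - T' l i| ≤ h) (b a : ℕ) :
    |ment (gv σ) j k T b a - ment (gv σ) j k T' b a| ≤ 2 ^ k * 2 ^ j * h := by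
  simp only [ment, ip, ← Finset.sum_sub_distrib, ← mul_sub]
  refine (Finset.abs_sum_le_sum_abs _ _).trans ?_
  refine (Finset.sum_le_card_nsmul _ _ (2 ^ j * h) fun l hl => ?_).trans (le_of_eq ?_)
  · rw [abs_mul]
    have h1 : |∑ i ∈ Finset.range (2 ^ j), (T l i * gv σ j a i - T' l i * gv σ j a i)| ≤
        2 ^ j * h := by
      refine (Finset.abs_sum_le_sum_abs _ _).trans ?_
      refine (Finset.sum_le_card_nsmul _ _ h fun i hi => ?_).trans (le_of_eq ?_)
      · rw [← sub_mul, abs_mul]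
        exact (mul_le_of_le_one_right (abs_nonneg _) (abs_gv_le_one _ _ _ _)).trans
          (hTT l (Finset.mem_range.1 hl) i (Finset.mem_range.1 hi))
      · rw [Finset.card_range, nsmul_eq_mul]; push_cast; ring
    exact (mul_le_of_le_one_left (abs_nonneg _) (abs_gv_le_one _ _ _ _)).trans h1
  · rw [Finset.card_range, nsmul_eq_mul]; push_cast; ring

/-- The coefficient matrix coded by `κ`. -/
def crossCoef (o : Bool) (j k L H m : ℕ)
    (κ : Fin m → Fin (numPts k) × Fin (numPts j) × Fin (2 * H + 1)) (b a : ℕ) : ℝ :=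
  if orient o j k b a then
    ∑ p ∈ (Finset.univ.image κ).filter (fun p => (p.1 : ℕ) = b ∧ (p.2.1 : ℕ) = a), L * dec H p.2.2
  else 0

theorem exists_crossCoef {o : Bool} {j k L H m : ℕ} (hL : 0 < L) (hH : 0 < H)
    {E : Finset (ℕ × ℕ)} (hE : E.Nonempty) (hm : E.card ≤ m)
    (hr : ∀ p ∈ E, p.1 < numPts k ∧ p.2 < numPts j ∧ orient o j k p.1 p.2)
    {M : ℕ → ℕ → ℝ} (hM : ∀ p ∈ E, |M p.1 p.2| ≤ L ∧ 2 * (L / H : ℝ) ≤ |M p.1 p.2|) :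
    ∃ κ, ∀ b a, ((b, a) ∉ E → crossCoef o j k L H m κ b a = 0) ∧
      ((b, a) ∈ E → |crossCoef o j k L H m κ b a| ≤ |M b a| ∧
        |M b a - crossCoef o j k L H m κ b a| ≤ |M b a| / 2) := by
  have hL' : (0 : ℝ) < L := by exact_mod_cast hL
  have hd : ∀ p : E, ∃ v, |dec H v| ≤ |M p.1.1 p.1.2 / L| ∧ |M p.1.1 p.1.2 / L - dec H v| ≤ 1 / H := by
    intro p
    apply exists_dec hH
    rw [abs_div, abs_of_pos hL', div_le_one hL']
    exact (hM p p.2).1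
  choose v hv using hd
  obtain ⟨s, hs⟩ : ∃ s : Fin m → E, Function.Surjective s := by
    have : Nonempty E := hE.to_subtype
    have hc : Fintype.card E ≤ Fintype.card (Fin m) := by simpa using hm
    obtain ⟨f⟩ := Function.Embedding.nonempty_of_card_le hc
    exact ⟨Function.invFun f, Function.invFun_surjective f.injective⟩
  refine ⟨fun i => (⟨(s i).1.1, (hr _ (s i).2).1⟩, ⟨(s i).1.2, (hr _ (s i).2).2.1⟩, v (s i)),
    fun b a => ⟨fun h => ?_, fun h => ?_⟩⟩
  · unfold crossCoef
    split_ifs with ho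
    · rw [Finset.filter_false_of_mem, Finset.sum_empty]
      intro p hp
      obtain ⟨i, _, rfl⟩ := Finset.mem_image.1 hp
      rintro ⟨h1, h2⟩
      apply h
      have := (s i).2
      simp only at h1 h2
      rw [← h1, ← h2]; exact this
    · rfl
  · have hval : crossCoef o j k L H m (fun i => (⟨(s i).1.1, (hr _ (s i).2).1⟩,
        ⟨(s i).1.2, (hr _ (s i).2).2.1⟩, v (s i))) b a = L * dec H (v ⟨(b, a), h⟩) := by
      unfold crossCoef
      rw [if_pos (hr _ h).2.2]
      have : (Finset.univ.image fun i : Fin m => ((⟨(s i).1.1, (hr _ (s i).2).1⟩,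
          ⟨(s i).1.2, (hr _ (s i).2).2.1⟩, v (s i)) :
            Fin (numPts k) × Fin (numPts j) × Fin (2 * H + 1))).filter
          (fun p => (p.1 : ℕ) = b ∧ (p.2.1 : ℕ) = a) =
          {(⟨b, (hr _ h).1⟩, ⟨a, (hr _ h).2.1⟩, v ⟨(b, a), h⟩)} := by
        ext p
        simp only [Finset.mem_filter, Finset.mem_image, Finset.mem_univ, true_and,
          Finset.mem_singleton]
        constructor
        · rintro ⟨⟨i, rfl⟩, h1, h2⟩
          simp only at h1 h2
          have : s i = ⟨(b, a), h⟩ := Subtype.ext (Prod.ext h1 h2)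
          simp [this]
        · rintro rfl
          obtain ⟨i, hi⟩ := hs ⟨(b, a), h⟩
          exact ⟨⟨i, by simp [hi]⟩, rfl, rfl⟩
      rw [this, Finset.sum_singleton]
    rw [hval]
    have h1 := hv ⟨(b, a), h⟩
    have h2 := hM _ h
    simp only at h1 h2
    constructor
    · rw [abs_mul, abs_of_pos hL']
      have := h1.1
      rw [abs_div, abs_of_pos hL', le_div_iff₀ hL'] at this
      linarith
    · have e : M b a - L * dec H (v ⟨(b, a), h⟩) = L * (M b a / L - dec H (v ⟨(b, a), h⟩)) := by
        field_simp
      rw [e, abs_mul, abs_of_pos hL']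
      have := mul_le_mul_of_nonneg_left h1.2 hL'.le
      have e2 : (L : ℝ) * (1 / H) = L / H := by ring
      linarith

/-- A product bound used to compare a pairing with a sum of squares. -/
theorem mul_ge_of_round {M M' C t : ℝ} (ht : 0 < t) (hM : t ≤ |M|) (hC : |C| ≤ |M|)
    (hMC : |M - C| ≤ |M| / 2) (hMM : |M - M'| ≤ t / 16) : C ^ 2 / 4 ≤ C * M' ∧ M ^ 2 / 4 ≤ C ^ 2 := by
  wlog h0 : 0 ≤ M generalizing M M' C
  · have := @this (-M) (-M') (-C) (by simpa using hM) (by simpa using hC)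
      (by rw [abs_neg]; rw [← abs_neg]; convert hMC using 2; ring)
      (by rw [← abs_neg]; convert hMM using 2; ring) (by linarith)
    simpa using this
  rw [abs_of_nonneg h0] at *
  rw [abs_le] at hC hMC hMM
  have h1 : M / 2 ≤ C := by linarith [hMC.2]
  constructor
  · have : C / 4 ≤ M' := by linarith [hMM.2, hC.2]
    nlinarith
  · nlinarith

/-- The sum of the squares of the coefficients coded by `κ`. -/
def crossW (j k : ℕ) (C : ℕ → ℕ → ℝ) : ℝ :=
  ∑ b ∈ Finset.range (numPts k), ∑ a ∈ Finset.range (numPts j), C b a ^ 2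

theorem not_crossBd_subset {j k : ℕ} (hj : 2 ≤ j) {L H H' m : ℕ} (hL : L = j ^ (dE + 4))
    (hH' : H' = 2 * L * 2 ^ sep j k) (hH : H = 16 * 2 ^ sep j k * j ^ 4 * 2 ^ k * 2 ^ j * 2 ^ j)
    (hm : m = 2 ^ j * j ^ (2 * dE + 10) * 4 ^ sep j k + 1) :
    {σ | ¬ CrossBd (gv σ) j k} ⊆
      {σ | ∃ κ : Bool × (Fin m → Fin (numPts k) × Fin (numPts j) × Fin (2 * H' + 1)) ×
          (Fin (2 ^ k) → Fin (2 ^ j) → Fin (2 * H + 1)),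
        σ ∈ {σ : Signs | 2 ^ j * (j : ℝ) ^ (2 * dE + 10) / 4 ≤
            crossW j k (crossCoef κ.1 j k L H' m κ.2.1) ∧
          (crossW j k (crossCoef κ.1 j k L H' m κ.2.1) / 4 ≤
            ∑ p ∈ lvl k, sgn (σ p) * crossIncr j k (crossCoef κ.1 j k L H' m κ.2.1)
              (fun l i => (j : ℝ) ^ 4 * decM H _ _ κ.2.2 l i) p σ ∧
          ∑ p ∈ lvl k, crossIncr j k (crossCoef κ.1 j k L H' m κ.2.1)
              (fun l i => (j : ℝ) ^ 4 * decM H _ _ κ.2.2 l i) p σ ^ 2 ≤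
            4 * (j : ℝ) ^ (2 * dE + 8) / 2 ^ k * crossW j k (crossCoef κ.1 j k L H' m κ.2.1))}} := by
  rintro σ hσ
  simp only [Set.mem_ofPred_eq, CrossBd, not_forall, not_le] at hσ
  obtain ⟨T, hT, hTF, E, hE, hEb, hlt⟩ := hσ
  set M := ment (gv σ) j k T with hM
  set s := sep j k with hs
  set t : ℝ := ((2 : ℝ) ^ s)⁻¹ with ht
  have htpos : 0 < t := by rw [ht]; positivity
  set B : ℝ := (j : ℝ) ^ (2 * dE + 8) with hB
  have hj2 : (2 : ℝ) ≤ j := by exact_mod_cast hj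
  have hj0 : (0 : ℝ) < j := by linarith
  have hB1 : 1 ≤ B := one_le_pow₀ (by linarith)
  set Q : ℝ := 2 ^ j * (j : ℝ) ^ (2 * dE + 10) with hQ
  -- one orientation carries half of the sum
  obtain ⟨o, ho⟩ : ∃ o, Q < ∑ p ∈ E.filter (fun p => orient o j k p.1 p.2), M p.1 p.2 ^ 2 := by
    by_contra hcon
    push Not at hcon
    have h1 := hcon true
    have h2 := hcon false
    have hcov : E ⊆ (E.filter (fun p => orient true j k p.1 p.2)) ∪
        (E.filter (fun p => orient false j k p.1 p.2)) := by
      intro p hp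
      have := (hE p hp).2.2.1
      rw [← Finset.filter_or, Finset.mem_filter]
      refine ⟨hp, ?_⟩
      simp only [orient, if_true, Bool.false_eq_true, if_false]
      by_contra hcon
      push Not at hcon
      exact this (Prod.ext hcon.1.1 (by have := hcon.2 hcon.1.1; omega))
    have h3 := Finset.sum_le_sum_of_subset_of_nonneg hcov
      (f := fun p : ℕ × ℕ => M p.1 p.2 ^ 2) (fun _ _ _ => sq_nonneg _)
    have h4 := Finset.sum_union_inter (s₁ := E.filter (fun p => orient true j k p.1 p.2))
      (s₂ := E.filter (fun p => orient false j k p.1 p.2)) (f := fun p : ℕ × ℕ => M p.1 p.2 ^ 2)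
    have h5 : 0 ≤ ∑ p ∈ E.filter (fun p => orient true j k p.1 p.2) ∩
        E.filter (fun p => orient false j k p.1 p.2), M p.1 p.2 ^ 2 :=
      Finset.sum_nonneg fun _ _ => sq_nonneg _
    have h6 : (2 : ℝ) ^ j * (j : ℝ) ^ (2 * dE + 12) = Q * j ^ 2 := by rw [hQ]; ring
    have hQ0 : 0 ≤ Q := by rw [hQ]; positivity
    have h7 : Q * 2 ≤ Q * (j : ℝ) ^ 2 := mul_le_mul_of_nonneg_left (by nlinarith) hQ0
    rw [h6] at hlt
    linarith
  obtain ⟨E', hE'E, hE'm, hE'Q⟩ : ∃ E' ⊆ E.filter (fun p => orient o j k p.1 p.2),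
      E'.card ≤ m ∧ Q < ∑ p ∈ E', M p.1 p.2 ^ 2 := by
    by_cases hc : (E.filter (fun p => orient o j k p.1 p.2)).card ≤ m
    · exact ⟨_, subset_rfl, hc, ho⟩
    · push Not at hc
      obtain ⟨E', h1, h2⟩ := Finset.exists_subset_card_eq hc.le
      refine ⟨E', h1, h2.le, ?_⟩
      have h3 : E'.card • t ^ 2 ≤ ∑ p ∈ E', M p.1 p.2 ^ 2 := by
        refine Finset.card_nsmul_le_sum _ _ _ fun p hp => ?_
        have := (hE p (Finset.mem_filter.1 (h1 hp)).1).2.2.2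
        rw [← sq_abs (M p.1 p.2)]
        exact pow_le_pow_left₀ htpos.le this 2
      refine lt_of_lt_of_le ?_ h3
      rw [h2, nsmul_eq_mul, hm]
      push_cast
      have e4 : (4 : ℝ) ^ s * t ^ 2 = 1 := by
        rw [ht, inv_pow, ← pow_mul, mul_comm s 2, pow_mul]; norm_num
      rw [add_mul, one_mul, mul_assoc _ _ (t ^ 2), e4, mul_one]
      have : 0 < t ^ 2 := by positivity
      linarith
  have hE'1 : ∀ p ∈ E', p ∈ E ∧ orient o j k p.1 p.2 := fun p hp =>
    Finset.mem_filter.1 (hE'E hp)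
  have hLr : (L : ℝ) = (j : ℝ) ^ (dE + 4) := by rw [hL]; push_cast; rfl
  have hL0 : 0 < L := by rw [hL]; positivity
  have hH'0 : 0 < H' := by rw [hH']; positivity
  have hH0 : 0 < H := by rw [hH]; positivity
  have hMle : ∀ p ∈ E', |M p.1 p.2| ≤ L := by
    intro p hp
    have h1 := hTF {p.2} (by simpa using (hE p (hE'1 p hp).1).2.1)
      (by simpa using Nat.one_le_two_pow) (fun _ => 1)
    simp only [Finset.sum_singleton, one_mul, one_pow, mul_one] at h1
    refine abs_le_of_sq_le_sq ?_ (by positivity)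
    refine (ip_sq_le _ _ _).trans ?_
    rw [ssq_gv, one_mul]
    refine h1.trans (le_of_eq ?_)
    rw [hLr, hB]; ring
  have hne : E'.Nonempty := by
    rw [Finset.nonempty_iff_ne_empty]
    rintro rfl
    rw [Finset.sum_empty] at hE'Q
    have : 0 ≤ Q := by rw [hQ]; positivity
    linarith
  obtain ⟨κ, hκ⟩ := exists_crossCoef (j := j) (k := k) (o := o) (m := m) hL0 hH'0 hne hE'm
    (M := M) (fun p hp => ⟨(hE p (hE'1 p hp).1).1, (hE p (hE'1 p hp).1).2.1, (hE'1 p hp).2⟩)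
    (fun p hp => ⟨hMle p hp, by
      refine le_trans (le_of_eq ?_) (hE p (hE'1 p hp).1).2.2.2
      rw [hH', ht]; push_cast
      have : (L : ℝ) ≠ 0 := by positivity
      field_simp⟩)
  set C := crossCoef o j k L H' m κ with hC
  obtain ⟨τ, hτ⟩ := exists_decM hH0 (2 ^ k) (2 ^ j) (u := fun l i => T l i / (j : ℝ) ^ 4) (by
    intro l hl i hi
    rw [abs_div, abs_of_pos (by positivity : (0 : ℝ) < (j : ℝ) ^ 4), div_le_one (by positivity)]
    exact hT l hl i hi)
  set T' : ℕ → ℕ → ℝ := fun l i => (j : ℝ) ^ 4 * decM H _ _ τ l i with hT'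
  set h : ℝ := (j : ℝ) ^ 4 * (1 / H) with hh
  have hTT : ∀ l < 2 ^ k, ∀ i < 2 ^ j, |T l i - T' l i| ≤ h := by
    intro l hl i hi
    have e : T l i - T' l i = (j : ℝ) ^ 4 * (T l i / (j : ℝ) ^ 4 - decM H _ _ τ l i) := by
      rw [hT']; field_simp
    rw [e, abs_mul, abs_of_pos (by positivity : (0 : ℝ) < (j : ℝ) ^ 4), hh]
    exact mul_le_mul_of_nonneg_left (hτ l hl i hi).2 (by positivity)
  have hsm : (2 : ℝ) ^ k * 2 ^ j * 2 ^ j * h = t / 16 := by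
    rw [hh, hH, ht]; push_cast; field_simp
  have hsz : t ≤ 1 := by
    rw [ht]; exact inv_le_one_of_one_le₀ (one_le_pow₀ (by norm_num))
  have hMM : ∀ b a, |M b a - ment (gv σ) j k T' b a| ≤ t / 16 := by
    intro b a
    refine (ment_round σ hTT b a).trans ?_
    rw [← hsm]
    have : (1 : ℝ) ≤ 2 ^ j := one_le_pow₀ (by norm_num)
    have h0 : 0 ≤ (2 : ℝ) ^ k * 2 ^ j * h := by positivity
    nlinarith
  have hpt : ∀ p ∈ E', C p.1 p.2 ^ 2 / 4 ≤ C p.1 p.2 * ment (gv σ) j k T' p.1 p.2 ∧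
      M p.1 p.2 ^ 2 / 4 ≤ C p.1 p.2 ^ 2 := fun p hp =>
    mul_ge_of_round htpos (hE p (hE'1 p hp).1).2.2.2 ((hκ p.1 p.2).2 hp).1 ((hκ p.1 p.2).2 hp).2
      (hMM _ _)
  have hsubp : E' ⊆ Finset.range (numPts k) ×ˢ Finset.range (numPts j) := fun p hp =>
    Finset.mem_product.2 ⟨Finset.mem_range.2 (hE p (hE'1 p hp).1).1,
      Finset.mem_range.2 (hE p (hE'1 p hp).1).2.1⟩
  refine ⟨(o, κ, τ), ?_, ?_, ?_⟩
  · change Q / 4 ≤ crossW j k C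
    rw [crossW, ← Finset.sum_product']
    refine le_trans ?_ (Finset.sum_le_sum_of_subset_of_nonneg hsubp fun _ _ _ => sq_nonneg _)
    refine le_trans ?_ (Finset.sum_le_sum fun p hp => (hpt p hp).2)
    rw [← Finset.sum_div]
    linarith
  · change crossW j k C / 4 ≤ ∑ p ∈ lvl k, sgn (σ p) * crossIncr j k C T' p σ
    rw [sum_crossIncr, crossW, Finset.sum_div]
    refine Finset.sum_le_sum fun b _ => ?_
    rw [Finset.sum_div]
    refine Finset.sum_le_sum fun a _ => ?_
    by_cases hba : (b, a) ∈ E'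
    · exact (hpt _ hba).1
    · rw [(hκ b a).1 hba]; simp
  · change ∑ p ∈ lvl k, crossIncr j k C T' p σ ^ 2 ≤ 4 * B / 2 ^ k * crossW j k C
    rw [sum_crossIncr_sq, crossW, div_eq_inv_mul, mul_assoc]
    refine mul_le_mul_of_nonneg_left ?_ (by positivity)
    rw [Finset.mul_sum]
    refine Finset.sum_le_sum fun b _ => ?_
    set F := (E'.filter fun p => p.1 = b).image Prod.snd with hF
    have hFr : F ⊆ Finset.range (numPts j) := by
      intro a ha
      obtain ⟨p, hp, rfl⟩ := Finset.mem_image.1 ha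
      exact (Finset.mem_product.1 (hsubp (Finset.mem_filter.1 hp).1)).2
    have hFc : F.card ≤ 2 ^ (j / 4) := by
      refine Finset.card_image_le.trans (le_trans (Finset.card_le_card ?_) (hEb b))
      exact Finset.filter_subset_filter _ fun p hp => (hE'1 p hp).1
    have hF0 : ∀ a, a ∉ F → C b a = 0 := by
      intro a ha
      refine (hκ b a).1 fun hba => ha ?_
      exact Finset.mem_image.2 ⟨(b, a), Finset.mem_filter.2 ⟨hba, rfl⟩, rfl⟩
    have e1 : (fun i => ∑ a ∈ Finset.range (numPts j), C b a * gv σ j a i) =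
        fun i => ∑ a ∈ F, C b a * gv σ j a i := by
      funext i
      exact (Finset.sum_subset hFr fun a _ ha => by rw [hF0 a ha, zero_mul]).symm
    have e2 : ∑ a ∈ Finset.range (numPts j), C b a ^ 2 = ∑ a ∈ F, C b a ^ 2 :=
      (Finset.sum_subset hFr fun a _ ha => by rw [hF0 a ha]; norm_num).symm
    rw [e1, e2]
    refine ssq_comb_round σ (by positivity) hB1 hTT ?_ (by rw [hsm]; linarith) (hTF F hFr hFc _)
    have : F.card ≤ 2 ^ j := hFc.trans (Nat.pow_le_pow_right (by norm_num) (Nat.div_le_self _ _))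
    exact_mod_cast this

theorem dens_not_crossBd_le {j k : ℕ} (hj : 2 ≤ j) {L H H' m : ℕ} (hL : L = j ^ (dE + 4))
    (hH' : H' = 2 * L * 2 ^ sep j k) (hH : H = 16 * 2 ^ sep j k * j ^ 4 * 2 ^ k * 2 ^ j * 2 ^ j)
    (hm : m = 2 ^ j * j ^ (2 * dE + 10) * 4 ^ sep j k + 1) {S : Finset (ℕ × ℕ × ℕ)}
    (hS : lvl k ⊆ S) :
    dens S {σ | ¬ CrossBd (gv σ) j k} ≤
      (2 * ((numPts k * (numPts j * (2 * H' + 1))) ^ m * ((2 * H + 1) ^ 2 ^ j) ^ 2 ^ k) : ℕ) *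
        Real.exp (-(2 ^ j * 2 ^ k * (j : ℝ) ^ 2 / 512)) := by
  have hj0 : (0 : ℝ) < j := by exact_mod_cast (by omega : 0 < j)
  have key := dens_le_of_subset_exists (S := S) (ε := Real.exp (-(2 ^ j * 2 ^ k * (j : ℝ) ^ 2 / 512)))
    _ (not_crossBd_subset hj hL hH' hH hm) ?_
  · simpa only [Fintype.card_prod, Fintype.card_fun, Fintype.card_fin, Fintype.card_bool] using key
  intro κ
  set C := crossCoef κ.1 j k L H' m κ.2.1 with hC
  set W := crossW j k C with hW
  by_cases hQ : 2 ^ j * (j : ℝ) ^ (2 * dE + 10) / 4 ≤ W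
  · have hWpos : 0 < W := lt_of_lt_of_le (by positivity) hQ
    refine (dens_mono S (fun σ hσ => hσ.2)).trans ?_
    refine (dens_rademacher_le S (lvl k) hS
      (fun p => if κ.1 then p.2.1 else numPts k - p.2.1) _ ?_ (by positivity) (by positivity)).trans ?_
    · intro p hp q hq h τ v
      refine crossIncr_update (o := κ.1) ?_ _ hp hq h τ v
      intro b a hba
      by_contra ho
      exact hba (if_neg ho)
    · refine Real.exp_le_exp.2 (neg_le_neg ?_)
      have e : (W / 4) ^ 2 / (2 * (4 * (j : ℝ) ^ (2 * dE + 8) / 2 ^ k * W)) =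
          W * (2 ^ k / (128 * (j : ℝ) ^ (2 * dE + 8))) := by
        field_simp; norm_num
      rw [e]
      refine le_trans (le_of_eq ?_) (mul_le_mul_of_nonneg_right hQ (by positivity))
      rw [show 2 * dE + 10 = (2 * dE + 8) + 2 by ring, pow_add (j : ℝ) (2 * dE + 8)]
      field_simp; norm_num
  · have : {σ : Signs | 2 ^ j * (j : ℝ) ^ (2 * dE + 10) / 4 ≤ W ∧
          (W / 4 ≤ ∑ p ∈ lvl k, sgn (σ p) * crossIncr j k C
              (fun l i => (j : ℝ) ^ 4 * decM H _ _ κ.2.2 l i) p σ ∧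
          ∑ p ∈ lvl k, crossIncr j k C
              (fun l i => (j : ℝ) ^ 4 * decM H _ _ κ.2.2 l i) p σ ^ 2 ≤
            4 * (j : ℝ) ^ (2 * dE + 8) / 2 ^ k * W)} = ∅ :=
      Set.eq_empty_of_forall_notMem fun σ hσ => hQ hσ.1
    rw [this]
    refine le_trans (le_of_eq ?_) (Real.exp_pos _).le
    simp [dens]

theorem eventually_pow_le_two_pow_half (K : ℝ) (m : ℕ) :
    ∀ᶠ k : ℕ in Filter.atTop, K * (k : ℝ) ^ m ≤ 2 ^ (k / 2) := by
  have h := eventually_pow_le_two_pow (K * 3 ^ m) m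
  have ht : Filter.Tendsto (fun k : ℕ => k / 2) Filter.atTop Filter.atTop :=
    Filter.tendsto_atTop.2 fun b => by
      filter_upwards [Filter.eventually_ge_atTop (2 * b)] with k hk; omega
  filter_upwards [ht.eventually h, Filter.eventually_ge_atTop 2] with k hk hk2
  rcases le_total 0 K with hK | hK
  · refine le_trans ?_ hk
    rw [mul_assoc, ← mul_pow]
    have : (k : ℝ) ≤ 3 * ((k / 2 : ℕ) : ℝ) := by exact_mod_cast (by omega : k ≤ 3 * (k / 2))
    gcongr
  · exact (mul_nonpos_of_nonpos_of_nonneg hK (by positivity)).trans (by positivity)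

/-- Levels `j` and `k` interact directly. -/
def Near (j k : ℕ) : Prop := j ≤ k ^ 5 ∧ k ≤ 600 * j

theorem exists_dens_not_crossBd_le : ∃ N : ℕ, ∀ j k, N ≤ j → N ≤ k → Near j k →
    ∀ S : Finset (ℕ × ℕ × ℕ), lvl k ⊆ S →
    dens S {σ | ¬ CrossBd (gv σ) j k} ≤ Real.exp (-(4 * (j + k))) := by
  obtain ⟨N₁, h₁⟩ := Filter.eventually_atTop.1 (eventually_pow_le_exp 1 cE zero_lt_one)
  obtain ⟨N₂, h₂⟩ := Filter.eventually_atTop.1 (eventually_pow_le_exp 5 (dE + 4) zero_lt_one)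
  obtain ⟨N₃, h₃⟩ := Filter.eventually_atTop.1 (eventually_pow_le_exp 33 4 zero_lt_one)
  obtain ⟨N₄, h₄⟩ := Filter.eventually_atTop.1
    (eventually_pow_le_two_pow_half 4808 (5 * (2 * dE + 11)))
  refine ⟨max 3000000 (max (max N₁ N₂) (max N₃ N₄)), fun j k hj hk hn S hS => ?_⟩
  simp only [max_le_iff] at hj hk
  obtain ⟨hj0, ⟨hj1, hj2⟩, hj3, hj4⟩ := hj
  obtain ⟨hk0, ⟨hk1, hk2⟩, hk3, hk4⟩ := hk
  have hjr : (3000000 : ℝ) ≤ j := by exact_mod_cast hj0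
  have hkr : (3000000 : ℝ) ≤ k := by exact_mod_cast hk0
  refine (dens_not_crossBd_le (by omega) rfl rfl rfl rfl hS).trans ?_
  set s := sep j k with hs
  set L := j ^ (dE + 4)
  have hsj : (s : ℝ) ≤ j := by
    have : s ≤ j := by rw [hs, sep]; omega
    exact_mod_cast this
  have hpt : ∀ i, N₁ ≤ i → (numPts i : ℝ) ≤ Real.exp (2 * i) := by
    intro i hi
    have := h₁ i hi
    rw [numPts]; push_cast
    have := two_pow_le_exp i
    calc (2 : ℝ) ^ i * (i : ℝ) ^ cE ≤ Real.exp i * Real.exp (1 * i) := by gcongr; linarith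
      _ = _ := by rw [← Real.exp_add]; ring_nf
  have hs2 : (2 : ℝ) ^ s ≤ Real.exp j := (two_pow_le_exp s).trans (Real.exp_le_exp.2 hsj)
  have hH' : (2 * (2 * L * 2 ^ s : ℕ) + 1 : ℝ) ≤ Real.exp (2 * j) := by
    have h := h₂ j hj2
    push_cast
    have hL1 : (1 : ℝ) ≤ (L : ℝ) := by
      have : 1 ≤ L := Nat.one_le_pow _ _ (by omega)
      exact_mod_cast this
    have hs1 : (1 : ℝ) ≤ 2 ^ s := one_le_pow₀ (by norm_num)
    have : (1 : ℝ) ≤ L * 2 ^ s := one_le_mul_of_one_le_of_one_le hL1 hs1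
    calc 2 * (2 * (L : ℝ) * 2 ^ s) + 1 ≤ (5 * (j : ℝ) ^ (dE + 4)) * 2 ^ s := by
          have e : (L : ℝ) = (j : ℝ) ^ (dE + 4) := by simp [L]
          rw [← e]; nlinarith
      _ ≤ Real.exp (1 * j) * Real.exp j := by gcongr
      _ = _ := by rw [← Real.exp_add]; ring_nf
  have hH : (2 * (16 * 2 ^ s * j ^ 4 * 2 ^ k * 2 ^ j * 2 ^ j : ℕ) + 1 : ℝ) ≤
      Real.exp (4 * (j + k)) := by
    have h := h₃ j hj3
    push_cast
    have h1 : (1 : ℝ) ≤ (j : ℝ) ^ 4 * (2 ^ s * 2 ^ k * 2 ^ j * 2 ^ j) := by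
      refine one_le_mul_of_one_le_of_one_le (one_le_pow₀ (by linarith)) ?_
      rw [← pow_add, ← pow_add, ← pow_add]
      exact one_le_pow₀ (by norm_num)
    calc 2 * (16 * 2 ^ s * (j : ℝ) ^ 4 * 2 ^ k * 2 ^ j * 2 ^ j) + 1 ≤
          (33 * (j : ℝ) ^ 4) * (2 ^ s * 2 ^ k * 2 ^ j * 2 ^ j) := by nlinarith
      _ ≤ Real.exp (1 * j) * (Real.exp j * Real.exp k * Real.exp j * Real.exp j) := by
          have := two_pow_le_exp k
          have := two_pow_le_exp j
          gcongr
      _ = Real.exp (4 * j + k) := by rw [← Real.exp_add, ← Real.exp_add, ← Real.exp_add, ← Real.exp_add]; ring_nf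
      _ ≤ _ := Real.exp_le_exp.2 (by linarith)
  have hk600 : (k : ℝ) ≤ 600 * j := by exact_mod_cast hn.2
  set m : ℕ := 2 ^ j * j ^ (2 * dE + 10) * 4 ^ s + 1 with hm
  have hmm : (m : ℝ) * (4 * (j + k)) ≤ 2 ^ j * 2 ^ k := by
    have hjk : (j : ℝ) ≤ (k : ℝ) ^ 5 := by exact_mod_cast hn.1
    have h := h₄ k hk4
    have h4s : (4 : ℝ) ^ s * 2 ^ (k / 2) ≤ 2 ^ k := by
      rw [show (4 : ℝ) = 2 ^ 2 by norm_num, ← pow_mul, ← pow_add]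
      exact pow_le_pow_right₀ (by norm_num) (by rw [hs, sep]; omega)
    have hm2 : (m : ℝ) ≤ 2 * (2 ^ j * (j : ℝ) ^ (2 * dE + 10) * 4 ^ s) := by
      rw [hm]; push_cast
      have : (1 : ℝ) ≤ 2 ^ j * (j : ℝ) ^ (2 * dE + 10) * 4 ^ s :=
        one_le_mul_of_one_le_of_one_le (one_le_mul_of_one_le_of_one_le
          (one_le_pow₀ (by norm_num)) (one_le_pow₀ (by linarith))) (one_le_pow₀ (by norm_num))
      linarith
    calc (m : ℝ) * (4 * (j + k)) ≤ 2 * (2 ^ j * (j : ℝ) ^ (2 * dE + 10) * 4 ^ s) * (2404 * j) :=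
          mul_le_mul hm2 (by linarith) (by positivity) (by positivity)
      _ = 2 ^ j * 4 ^ s * (4808 * (j : ℝ) ^ (2 * dE + 11)) := by ring
      _ ≤ 2 ^ j * 4 ^ s * (4808 * ((k : ℝ) ^ 5) ^ (2 * dE + 11)) := by gcongr
      _ ≤ 2 ^ j * 4 ^ s * 2 ^ (k / 2) := by rw [← pow_mul]; gcongr
      _ = 2 ^ j * (4 ^ s * 2 ^ (k / 2)) := by ring
      _ ≤ _ := by gcongr
  have hexp1 : ((numPts k : ℝ) * (numPts j * (2 * (2 * L * 2 ^ s : ℕ) + 1))) ^ m ≤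
      Real.exp (2 ^ j * 2 ^ k) := by
    have hbase : (numPts k : ℝ) * (numPts j * (2 * (2 * L * 2 ^ s : ℕ) + 1)) ≤
        Real.exp (4 * (j + k)) := by
      calc _ ≤ Real.exp (2 * k) * (Real.exp (2 * j) * Real.exp (2 * j)) := by
            gcongr
            · exact hpt k hk1
            · exact hpt j hj1
        _ = Real.exp (2 * k + 4 * j) := by rw [← Real.exp_add, ← Real.exp_add]; ring_nf
        _ ≤ _ := Real.exp_le_exp.2 (by linarith)
    calc _ ≤ Real.exp (4 * (j + k)) ^ m := by gcongr
      _ = Real.exp (m * (4 * (j + k))) := by rw [← Real.exp_nat_mul]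
      _ ≤ _ := Real.exp_le_exp.2 hmm
  have hexp2 : ((2 * (16 * 2 ^ s * j ^ 4 * 2 ^ k * 2 ^ j * 2 ^ j : ℕ) + 1 : ℝ) ^ 2 ^ j) ^ 2 ^ k ≤
      Real.exp (2 ^ j * 2 ^ k * (4 * (j + k))) := by
    calc _ ≤ (Real.exp (4 * (j + k)) ^ 2 ^ j) ^ 2 ^ k := by gcongr
      _ = _ := by
        rw [← Real.exp_nat_mul, ← Real.exp_nat_mul]; push_cast; ring_nf
  have h2e : (2 : ℝ) ≤ Real.exp 1 := by have := Real.add_one_le_exp (1 : ℝ); linarith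
  set x : ℝ := 2 ^ j * 2 ^ k with hx
  have hx1 : 4 * (j + k) + 1 ≤ x := by
    have a1 : ((j : ℝ) + 1) ≤ 2 ^ j := by exact_mod_cast Nat.lt_two_pow_self
    have a2 : ((k : ℝ) + 1) ≤ 2 ^ k := by exact_mod_cast Nat.lt_two_pow_self
    have : ((j : ℝ) + 1) * (k + 1) ≤ x := mul_le_mul a1 a2 (by positivity) (by positivity)
    nlinarith
  push_cast at hexp1 hexp2 ⊢
  calc _ ≤ Real.exp 1 * (Real.exp x * Real.exp (x * (4 * (j + k)))) *
        Real.exp (-(x * (j : ℝ) ^ 2 / 512)) :=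
          mul_le_mul_of_nonneg_right (mul_le_mul h2e (mul_le_mul hexp1 hexp2 (by positivity)
            (by positivity)) (by positivity) (by positivity)) (Real.exp_pos _).le
    _ = Real.exp (1 + (x + x * (4 * (j + k))) + -(x * (j : ℝ) ^ 2 / 512)) := by
        rw [Real.exp_add, Real.exp_add, Real.exp_add]
    _ ≤ _ := Real.exp_le_exp.2 (by
        have e1 : x * (4 * (j + k)) ≤ x * (2404 * j) :=
          mul_le_mul_of_nonneg_left (by linarith) (by positivity)
        have e2 : x * (2406 * j) ≤ x * ((j : ℝ) ^ 2 / 512) :=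
          mul_le_mul_of_nonneg_left (by nlinarith) (by positivity)
        have e3 : x ≤ x * j := by nlinarith
        linarith)

theorem ip_congr {n : ℕ} {x x' y y' : ℕ → ℝ} (hx : ∀ i < n, x i = x' i) (hy : ∀ i < n, y i = y' i) :
    ip n x y = ip n x' y' :=
  Finset.sum_congr rfl fun i hi => by
    rw [hx i (Finset.mem_range.1 hi), hy i (Finset.mem_range.1 hi)]

theorem ssq_congr {n : ℕ} {x x' : ℕ → ℝ} (hx : ∀ i < n, x i = x' i) : ssq n x = ssq n x' :=
  Finset.sum_congr rfl fun i hi => by rw [hx i (Finset.mem_range.1 hi)]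

/-- Two systems of points coincide at level `j`. -/
def Agree (g g' : ℕ → ℕ → ℕ → ℝ) (j : ℕ) : Prop :=
  ∀ a < numPts j, ∀ i < 2 ^ j, g j a i = g' j a i

theorem FrameBd.congr {g g' : ℕ → ℕ → ℕ → ℝ} {j : ℕ} (h : Agree g g' j) (hg : FrameBd g j) :
    FrameBd g' j := fun x => by
  refine le_of_eq_of_le (Finset.sum_congr rfl fun a ha => ?_) (hg x)
  rw [ip_congr (fun i hi => (h a (Finset.mem_range.1 ha) i hi).symm) fun _ _ => rfl]

theorem Incoherent.congr {g g' : ℕ → ℕ → ℕ → ℝ} {j : ℕ} (h : Agree g g' j)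
    (hg : Incoherent g j) : Incoherent g' j := fun a ha b hb hab => by
  rw [← ip_congr (h a ha) (h b hb)]
  exact hg a ha b hb hab

theorem DiagConc.congr {g g' : ℕ → ℕ → ℕ → ℝ} {j : ℕ} (h : Agree g g' j)
    (hg : DiagConc g j) : DiagConc g' j := fun T hT => by
  refine le_of_eq_of_le (Finset.sum_congr rfl fun a ha => ?_) (hg T hT)
  have ha' := Finset.mem_range.1 ha
  congr 2
  refine Finset.sum_congr rfl fun l hl => ?_
  rw [h a ha' l (Finset.mem_range.1 hl), ip_congr (fun _ _ => rfl) (h a ha')]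

theorem Agree.ment_eq {g g' : ℕ → ℕ → ℕ → ℝ} {j k : ℕ} (hj : Agree g g' j) (hk : Agree g g' k)
    (T : ℕ → ℕ → ℝ) {b a : ℕ} (hb : b < numPts k) (ha : a < numPts j) :
    ment g j k T b a = ment g' j k T b a :=
  ip_congr (hk b hb) fun _ _ => ip_congr (fun _ _ => rfl) (hj a ha)

theorem Agree.symm {g g' : ℕ → ℕ → ℕ → ℝ} {j : ℕ} (h : Agree g g' j) : Agree g' g j :=
  fun a ha i hi => (h a ha i hi).symm

theorem CrossBd.congr {g g' : ℕ → ℕ → ℕ → ℝ} {j k : ℕ} (hj : Agree g g' j) (hk : Agree g g' k)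
    (hg : CrossBd g j k) : CrossBd g' j k := fun T hT hF E hE hcard => by
  have hm : ∀ p ∈ E, ment g j k T p.1 p.2 = ment g' j k T p.1 p.2 := fun p hp =>
    hj.ment_eq hk T (hE p hp).1 (hE p hp).2.1
  refine le_of_eq_of_le (Finset.sum_congr rfl fun p hp => by rw [← hm p hp]) (hg T hT (fun F hFs hFc c => ?_) E (fun p hp => ?_) hcard)
  · refine le_of_eq_of_le (ssq_congr fun l _ => ip_congr (fun _ _ => rfl) fun i hi => ?_)
      (hF F hFs hFc c)
    exact Finset.sum_congr rfl fun a ha => by rw [hj a (Finset.mem_range.1 (hFs ha)) i hi]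
  · rw [hm p hp]
    exact hE p hp

/-- The properties of the random points used in the construction. -/
structure Typical (g : ℕ → ℕ → ℕ → ℝ) (J : ℕ) : Prop where
  frame : ∀ j, J ≤ j → FrameBd g j
  incoherent : ∀ j, J ≤ j → Incoherent g j
  diag : ∀ j, J ≤ j → DiagConc g j
  cross : ∀ j k, J ≤ j → J ≤ k → Near j k → CrossBd g j k

/-- The sign patterns violating one of the requirements at the levels `x.1` and `x.2`. -/
def badSigns (J : ℕ) (x : ℕ × ℕ) : Set Signs :=
  {σ | J ≤ x.1 ∧ J ≤ x.2 ∧ ((Near x.1 x.2 ∧ ¬ CrossBd (gv σ) x.1 x.2) ∨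
    (x.1 = x.2 ∧ (¬ FrameBd (gv σ) x.1 ∨ ¬ Incoherent (gv σ) x.1 ∨
      (FrameBd (gv σ) x.1 ∧ ¬ DiagConc (gv σ) x.1))))}

theorem agree_of_eq {σ σ' : Signs} {j : ℕ} (h : ∀ i ∈ lvl j, σ i = σ' i) :
    Agree (gv σ) (gv σ') j := fun a ha i hi => by
  unfold gv
  rw [h (j, a, i) (mem_lvl.2 ⟨rfl, ha, hi⟩)]

theorem sum_half_pow_le (F : Finset ℕ) : ∑ i ∈ F, (1 / 2 : ℝ) ^ i ≤ 2 := by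
  exact (summable_geometric_two.sum_le_tsum F fun _ _ => by positivity).trans_eq
    tsum_geometric_two

theorem exists_typical : ∃ σ : Signs, ∃ J : ℕ, Typical (gv σ) J := by
  obtain ⟨N₁, h₁⟩ := Filter.eventually_atTop.1 eventually_dens_frameBd
  obtain ⟨N₂, h₂⟩ := Filter.eventually_atTop.1 eventually_dens_incoherent
  obtain ⟨N₃, h₃⟩ := Filter.eventually_atTop.1 eventually_dens_diagConc
  obtain ⟨N₄, h₄⟩ := exists_dens_not_crossBd_le
  set J := max 2 (max (max N₁ N₂) (max N₃ N₄)) with hJ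
  have hbad : ∀ (x : ℕ × ℕ) (S : Finset (ℕ × ℕ × ℕ)), lvl x.1 ⊆ S → lvl x.2 ⊆ S →
      dens S (badSigns J x) ≤ (1 / 8) * ((1 / 2) ^ x.1 * (1 / 2) ^ x.2) := by
    rintro ⟨j, k⟩ S hj hk
    simp only at hj hk ⊢
    by_cases hc : J ≤ j ∧ J ≤ k
    swap
    · have he : badSigns J (j, k) = ∅ := by
        ext σ
        simp only [badSigns, Set.mem_ofPred_eq, Set.mem_empty_iff_false, iff_false]
        tauto
      rw [he]
      have : dens S (∅ : Set Signs) = 0 := by simp [dens]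
      rw [this]; positivity
    obtain ⟨hJj, hJk⟩ := hc
    have hJj' := hJj
    have hJk' := hJk
    simp only [hJ, max_le_iff] at hJj' hJk'
    obtain ⟨a0, ⟨a1, a2⟩, a3, a4⟩ := hJj'
    obtain ⟨b0, ⟨b1, b2⟩, b3, b4⟩ := hJk'
    have e2 : Real.exp (-1) ≤ 1 / 2 := by
      rw [Real.exp_neg, one_div]
      have := Real.add_one_le_exp (1 : ℝ)
      exact inv_anti₀ (by norm_num) (by linarith)
    have hexp : Real.exp (-(4 * ((j : ℝ) + k))) ≤ (1 / 32) * ((1 / 2) ^ j * (1 / 2) ^ k) := by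
      have ej : ∀ i : ℕ, Real.exp (-(i : ℝ)) ≤ (1 / 2) ^ i := fun i => by
        calc Real.exp (-(i : ℝ)) = Real.exp (-1) ^ i := by rw [← Real.exp_nat_mul]; ring_nf
          _ ≤ _ := by gcongr
      have h32 : Real.exp (-(5 : ℕ)) ≤ 1 / 32 := (ej 5).trans (by norm_num)
      have hjr : (2 : ℝ) ≤ j := by exact_mod_cast a0
      have hkr : (2 : ℝ) ≤ k := by exact_mod_cast b0
      calc Real.exp (-(4 * ((j : ℝ) + k))) ≤ Real.exp (-(5 : ℕ) + (-j + -k)) :=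
            Real.exp_le_exp.2 (by push_cast; linarith)
        _ = Real.exp (-(5 : ℕ)) * (Real.exp (-j) * Real.exp (-k)) := by rw [Real.exp_add, Real.exp_add]
        _ ≤ _ := by
          gcongr
          · exact ej j
          · exact ej k
    set q : ℝ := (1 / 32) * ((1 / 2) ^ j * (1 / 2) ^ k) with hq
    have hq0 : 0 ≤ q := by positivity
    have c1 : dens S {σ | Near j k ∧ ¬ CrossBd (gv σ) j k} ≤ q := by
      by_cases hn : Near j k
      · refine le_trans (dens_mono S fun σ h => h.2) ((h₄ j k a4 b4 hn S hk).trans hexp)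
      · have he : {σ : Signs | Near j k ∧ ¬ CrossBd (gv σ) j k} = ∅ := by
          ext σ
          simp only [Set.mem_ofPred_eq, Set.mem_empty_iff_false, iff_false]
          tauto
        rw [he]
        have : dens S (∅ : Set Signs) = 0 := by simp [dens]
        rw [this]; exact hq0
    have c2 : dens S {σ | j = k ∧ (¬ FrameBd (gv σ) j ∨ ¬ Incoherent (gv σ) j ∨
        (FrameBd (gv σ) j ∧ ¬ DiagConc (gv σ) j))} ≤ q + (q + q) := by
      by_cases hjk : j = k
      · have h10 : Real.exp (-(10 * (j : ℝ))) ≤ q := by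
          refine le_trans (Real.exp_le_exp.2 ?_) hexp
          have : (0 : ℝ) ≤ j := by positivity
          rw [← hjk]; linarith
        refine le_trans (dens_mono S (B' := {σ | ¬ FrameBd (gv σ) j} ∪
          ({σ | ¬ Incoherent (gv σ) j} ∪ {σ | FrameBd (gv σ) j ∧ ¬ DiagConc (gv σ) j}))
          fun σ h => h.2) ?_
        refine (dens_union_le _ _ _).trans (add_le_add ((h₁ j a1 S hj).trans h10) ?_)
        exact (dens_union_le _ _ _).trans
          (add_le_add ((h₂ j a2 S hj).trans h10) ((h₃ j a3 S hj).trans h10))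
      · have he : {σ : Signs | j = k ∧ (¬ FrameBd (gv σ) j ∨ ¬ Incoherent (gv σ) j ∨
            (FrameBd (gv σ) j ∧ ¬ DiagConc (gv σ) j))} = ∅ := by
          ext σ
          simp only [Set.mem_ofPred_eq, Set.mem_empty_iff_false, iff_false]
          tauto
        rw [he]
        have : dens S (∅ : Set Signs) = 0 := by simp [dens]
        rw [this]; linarith
    have := (dens_mono S (B := badSigns J (j, k)) (B' :=
      {σ | Near j k ∧ ¬ CrossBd (gv σ) j k} ∪ {σ | j = k ∧ (¬ FrameBd (gv σ) j ∨
        ¬ Incoherent (gv σ) j ∨ (FrameBd (gv σ) j ∧ ¬ DiagConc (gv σ) j))})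
      fun σ h => h.2.2).trans (dens_union_le _ _ _)
    rw [hq] at c1 c2
    linarith
  obtain ⟨σ, hσ⟩ := exists_avoiding (badSigns J) (fun x => lvl x.1 ∪ lvl x.2)
    (fun x σ σ' h hσ => by
      have g1 : Agree (gv σ) (gv σ') x.1 := agree_of_eq fun i hi => h i (Finset.mem_union_left _ hi)
      have g2 : Agree (gv σ) (gv σ') x.2 := agree_of_eq fun i hi => h i (Finset.mem_union_right _ hi)
      refine ⟨hσ.1, hσ.2.1, ?_⟩
      rcases hσ.2.2 with ⟨hn, hc⟩ | ⟨he, hc⟩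
      · exact Or.inl ⟨hn, fun hc' => hc (hc'.congr g1.symm g2.symm)⟩
      · refine Or.inr ⟨he, ?_⟩
        rcases hc with hc | hc | ⟨hf, hc⟩
        · exact Or.inl fun hc' => hc (hc'.congr g1.symm)
        · exact Or.inr (Or.inl fun hc' => hc (hc'.congr g1.symm))
        · exact Or.inr (Or.inr ⟨hf.congr g1, fun hc' => hc (hc'.congr g1.symm)⟩))
    (fun F => by
      refine ⟨F.biUnion fun x => lvl x.1 ∪ lvl x.2, ?_⟩
      calc _ ≤ ∑ x ∈ F, (1 / 8) * ((1 / 2 : ℝ) ^ x.1 * (1 / 2) ^ x.2) :=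
            Finset.sum_le_sum fun x hx => hbad x _
              (Finset.subset_union_left.trans
                (Finset.subset_biUnion_of_mem (fun x : ℕ × ℕ => lvl x.1 ∪ lvl x.2) hx))
              (Finset.subset_union_right.trans
                (Finset.subset_biUnion_of_mem (fun x : ℕ × ℕ => lvl x.1 ∪ lvl x.2) hx))
        _ ≤ ∑ x ∈ F.image Prod.fst ×ˢ F.image Prod.snd, (1 / 8) * ((1 / 2 : ℝ) ^ x.1 * (1 / 2) ^ x.2) :=
            Finset.sum_le_sum_of_subset_of_nonneg Finset.subset_product fun _ _ _ => by positivity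
        _ = (1 / 8) * ((∑ i ∈ F.image Prod.fst, (1 / 2 : ℝ) ^ i) *
              ∑ i ∈ F.image Prod.snd, (1 / 2 : ℝ) ^ i) := by
            rw [← Finset.mul_sum, Finset.sum_mul_sum, Finset.sum_product]
        _ ≤ (1 / 8) * (2 * 2) := by
            gcongr
            · exact sum_half_pow_le _
            · exact sum_half_pow_le _
        _ < 1 := by norm_num)
  refine ⟨σ, J, fun j hj => ?_, fun j hj => ?_, fun j hj => ?_, fun j k hj hk hn => ?_⟩
  · by_contra h
    exact hσ (j, j) ⟨hj, hj, Or.inr ⟨rfl, Or.inl h⟩⟩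
  · by_contra h
    exact hσ (j, j) ⟨hj, hj, Or.inr ⟨rfl, Or.inr (Or.inl h)⟩⟩
  · by_contra h
    by_cases hf : FrameBd (gv σ) j
    · exact hσ (j, j) ⟨hj, hj, Or.inr ⟨rfl, Or.inr (Or.inr ⟨hf, h⟩)⟩⟩
    · exact hσ (j, j) ⟨hj, hj, Or.inr ⟨rfl, Or.inl hf⟩⟩
  · by_contra h
    exact hσ (j, k) ⟨hj, hk, Or.inl ⟨hn, h⟩⟩

/-- The excess of the exponent at level `k` over `2`. -/
def et (k : ℕ) : ℝ := 240000 * Real.log k / (Real.log 2 * k)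

theorem et_nonneg (k : ℕ) : 0 ≤ et k := by
  unfold et
  have := Real.log_natCast_nonneg k
  have := Real.log_nonneg (show (1 : ℝ) ≤ 2 by norm_num)
  positivity

theorem two_pow_rpow_et (m : ℝ) {k : ℕ} (hk : 1 ≤ k) :
    ((2 : ℝ) ^ m) ^ et k = (k : ℝ) ^ (240000 * m / k) := by
  have hk' : (0 : ℝ) < k := by exact_mod_cast hk
  rw [← Real.rpow_mul (by norm_num), Real.rpow_def_of_pos (by norm_num), Real.rpow_def_of_pos hk', et]
  congr 1
  have := Real.log_pos (show (1 : ℝ) < 2 by norm_num)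
  field_simp

theorem rpow_et_le {x : ℝ} {m N k : ℕ} (hk : 1 ≤ k) (hx0 : 0 ≤ x) (hx : x ≤ ((2 : ℝ) ^ m)⁻¹)
    (h : N * k ≤ 240000 * m) : x ^ et k ≤ ((k : ℝ) ^ N)⁻¹ := by
  have hk' : (1 : ℝ) ≤ k := by exact_mod_cast hk
  have e : ((2 : ℝ) ^ m)⁻¹ = 2 ^ (-(m : ℝ)) := by rw [Real.rpow_neg (by norm_num), Real.rpow_natCast]
  calc x ^ et k ≤ (((2 : ℝ) ^ m)⁻¹) ^ et k := Real.rpow_le_rpow hx0 hx (et_nonneg k)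
    _ = (k : ℝ) ^ (240000 * (-(m : ℝ)) / k) := by rw [e, two_pow_rpow_et _ hk]
    _ ≤ (k : ℝ) ^ (-(N : ℝ)) := by
        apply Real.rpow_le_rpow_of_exponent_le hk'
        rw [div_le_iff₀ (by linarith)]
        have : (N : ℝ) * k ≤ 240000 * m := by exact_mod_cast h
        linarith
    _ = _ := by rw [Real.rpow_neg (by linarith), Real.rpow_natCast]

theorem sum_rpow_le {ι : Type*} {S : Finset ι} {u : ι → ℝ} {m η : ℝ} (hη : 0 ≤ η)
    (h : ∀ i ∈ S, |u i| ≤ m) : ∑ i ∈ S, |u i| ^ (2 + η) ≤ m ^ η * ∑ i ∈ S, u i ^ 2 := by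
  rw [Finset.mul_sum]
  refine Finset.sum_le_sum fun i hi => ?_
  rw [Real.rpow_add_of_nonneg (abs_nonneg _) (by norm_num) hη, mul_comm]
  have : |u i| ^ (2 : ℝ) = u i ^ 2 := by rw [Real.rpow_two, sq_abs]
  rw [this]
  exact mul_le_mul_of_nonneg_right (Real.rpow_le_rpow (abs_nonneg _) (h i hi) hη) (sq_nonneg _)

theorem ip_sum_left {ι : Type*} (n : ℕ) (x : ℕ → ℝ) (s : Finset ι) (c : ι → ℝ) (y : ι → ℕ → ℝ) :
    ip n (fun i => ∑ a ∈ s, c a * y a i) x = ∑ a ∈ s, c a * ip n (y a) x := by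
  rw [ip_comm, ip_sum_right]
  exact Finset.sum_congr rfl fun a _ => by rw [ip_comm]

/-- Few incoherent points are almost orthonormal. -/
theorem ssq_comb_le {g : ℕ → ℕ → ℕ → ℝ} {k : ℕ} (hg : Incoherent g k)
    (h1 : ∀ b, ssq (2 ^ k) (g k b) = 1) {F : Finset ℕ} (hF : F ⊆ Finset.range (numPts k))
    (hc : F.card * (k * rt k) ≤ 1) (c : ℕ → ℝ) :
    ssq (2 ^ k) (fun i => ∑ b ∈ F, c b * g k b i) ≤ 2 * ∑ b ∈ F, c b ^ 2 := by
  have hε : 0 ≤ k * rt k := by have := (rt_pos k).le; positivity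
  rw [← ip_self, ip_sum_left]
  have hb : ∀ b ∈ F, c b * ip (2 ^ k) (g k b) (fun i => ∑ b ∈ F, c b * g k b i) ≤
      c b ^ 2 + |c b| * ((k * rt k) * ∑ b ∈ F, |c b|) := by
    intro b hb
    rw [ip_sum_right, Finset.mul_sum, Finset.mul_sum, Finset.mul_sum]
    have hsplit : ∀ b' ∈ F, c b * (c b' * ip (2 ^ k) (g k b) (g k b')) ≤
        (if b' = b then c b ^ 2 else 0) + |c b| * (k * rt k * |c b'|) := by
      intro b' hb'
      by_cases h : b' = b
      · subst h
        rw [if_pos rfl, ip_self, h1]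
        have : 0 ≤ |c b'| * (k * rt k * |c b'|) := by positivity
        nlinarith
      · rw [if_neg h, zero_add]
        calc c b * (c b' * ip (2 ^ k) (g k b) (g k b')) ≤
              |c b * (c b' * ip (2 ^ k) (g k b) (g k b'))| := le_abs_self _
          _ = |c b| * (|ip (2 ^ k) (g k b) (g k b')| * |c b'|) := by
              rw [abs_mul, abs_mul]; ring
          _ ≤ _ := by
              gcongr
              exact hg b (Finset.mem_range.1 (hF hb)) b' (Finset.mem_range.1 (hF hb')) (Ne.symm h)
    refine (Finset.sum_le_sum hsplit).trans ?_
    rw [Finset.sum_add_distrib, Finset.sum_ite_eq' F b, if_pos hb]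
  refine (Finset.sum_le_sum hb).trans ?_
  rw [Finset.sum_add_distrib, ← Finset.sum_mul]
  have hcs : (∑ b ∈ F, |c b|) ^ 2 ≤ F.card * ∑ b ∈ F, c b ^ 2 := by
    have := sq_sum_le_card_mul_sum_sq (s := F) (f := fun b => |c b|)
    simpa only [sq_abs] using this
  have hs : 0 ≤ ∑ b ∈ F, c b ^ 2 := Finset.sum_nonneg fun _ _ => sq_nonneg _
  nlinarith [mul_le_mul_of_nonneg_left hcs hε, mul_le_mul_of_nonneg_right hc hs]

theorem sum_ip_sq_le_two {g : ℕ → ℕ → ℕ → ℝ} {k : ℕ} (hg : Incoherent g k)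
    (h1 : ∀ b, ssq (2 ^ k) (g k b) = 1) {F : Finset ℕ} (hF : F ⊆ Finset.range (numPts k))
    (hc : F.card * (k * rt k) ≤ 1) (x : ℕ → ℝ) :
    ∑ b ∈ F, ip (2 ^ k) (g k b) x ^ 2 ≤ 2 * ssq (2 ^ k) x := by
  set S := ∑ b ∈ F, ip (2 ^ k) (g k b) x ^ 2 with hS
  have hS0 : 0 ≤ S := Finset.sum_nonneg fun _ _ => sq_nonneg _
  have e : ip (2 ^ k) (fun i => ∑ b ∈ F, ip (2 ^ k) (g k b) x * g k b i) x = S := by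
    rw [ip_sum_left]
    exact Finset.sum_congr rfl fun b _ => by ring
  have h := ip_sq_le (2 ^ k) (fun i => ∑ b ∈ F, ip (2 ^ k) (g k b) x * g k b i) x
  rw [e] at h
  have h2 := ssq_comb_le hg h1 hF hc fun b => ip (2 ^ k) (g k b) x
  have hx := ssq_nonneg (2 ^ k) x
  rcases hS0.eq_or_lt with h0 | h0
  · rw [← h0]; positivity
  · have : S * S ≤ S * (2 * ssq (2 ^ k) x) := by
      nlinarith [mul_le_mul_of_nonneg_right h2 hx]
    exact le_of_mul_le_mul_left this h0

/-- Testing `ment` against few columns. -/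
theorem sum_ment_sq_le {g : ℕ → ℕ → ℕ → ℝ} {j k : ℕ} (h1 : ∀ b, ssq (2 ^ k) (g k b) = 1)
    {T : ℕ → ℕ → ℝ} {B : ℝ} (hB : 0 ≤ B) {F : Finset ℕ}
    (hF : ∀ c : ℕ → ℝ, ssq (2 ^ k) (fun l => ip (2 ^ j) (T l) (fun i => ∑ a ∈ F, c a * g j a i)) ≤
      B * ∑ a ∈ F, c a ^ 2) (b : ℕ) : ∑ a ∈ F, ment g j k T b a ^ 2 ≤ B := by
  set S := ∑ a ∈ F, ment g j k T b a ^ 2 with hS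
  have hS0 : 0 ≤ S := Finset.sum_nonneg fun _ _ => sq_nonneg _
  have h2 := hF fun a => ment g j k T b a
  have e : ip (2 ^ k) (g k b) (fun l => ip (2 ^ j) (T l)
      (fun i => ∑ a ∈ F, ment g j k T b a * g j a i)) = S := by
    have : (fun l => ip (2 ^ j) (T l) (fun i => ∑ a ∈ F, ment g j k T b a * g j a i)) =
        fun l => ∑ a ∈ F, ment g j k T b a * ip (2 ^ j) (T l) (g j a) := by
      funext l
      rw [ip_sum_right]
    rw [this, ip_sum_right]
    refine Finset.sum_congr rfl fun a _ => ?_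
    rw [pow_two]; rfl
  have h := ip_sq_le (2 ^ k) (g k b) (fun l => ip (2 ^ j) (T l)
      (fun i => ∑ a ∈ F, ment g j k T b a * g j a i))
  rw [e, h1, one_mul] at h
  rcases hS0.eq_or_lt with h0 | h0
  · rwa [← h0]
  · have : S * S ≤ S * B := by nlinarith [h.trans h2]
    exact le_of_mul_le_mul_left this h0

theorem eventually_et_le_one : ∀ᶠ k : ℕ in Filter.atTop, et k ≤ 1 := by
  filter_upwards [Filter.eventually_ge_atTop 1, eventually_pow_le_two_pow 1 240000] with k hk h
  have hk' : (0 : ℝ) < k := by exact_mod_cast hk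
  have h2 := Real.log_pos (show (1 : ℝ) < 2 by norm_num)
  have := Real.log_le_log (by positivity) h
  rw [one_mul, Real.log_pow, Real.log_pow] at this
  unfold et
  rw [div_le_one (by positivity)]
  push_cast at this
  linarith

/-- The `b`-th row of `T` in terms of the points of level `k`. -/
def rowv (g : ℕ → ℕ → ℕ → ℝ) (k : ℕ) (T : ℕ → ℕ → ℝ) (b i : ℕ) : ℝ :=
  ip (2 ^ k) (g k b) (fun l => T l i)

theorem ment_eq_rowv (g : ℕ → ℕ → ℕ → ℝ) (j k : ℕ) (T : ℕ → ℕ → ℝ) (b a : ℕ) :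
    ment g j k T b a = ip (2 ^ j) (g j a) (rowv g k T b) := by
  simp only [ment, rowv, ip, Finset.mul_sum]
  rw [Finset.sum_comm]
  exact Finset.sum_congr rfl fun _ _ => Finset.sum_congr rfl fun _ _ => by ring

theorem sum_ssq_comm (m n : ℕ) (T : ℕ → ℕ → ℝ) :
    ∑ i ∈ Finset.range n, ssq m (fun l => T l i) = ∑ l ∈ Finset.range m, ssq n (T l) :=
  Finset.sum_comm

theorem sum_ssq_rowv_le {g : ℕ → ℕ → ℕ → ℝ} {k : ℕ} {F : Finset ℕ} {L : ℝ}
    (hF : ∀ x, ∑ b ∈ F, ip (2 ^ k) (g k b) x ^ 2 ≤ L * ssq (2 ^ k) x) (j : ℕ) (T : ℕ → ℕ → ℝ) :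
    ∑ b ∈ F, ssq (2 ^ j) (rowv g k T b) ≤ L * ∑ l ∈ Finset.range (2 ^ k), ssq (2 ^ j) (T l) := by
  rw [← sum_ssq_comm, Finset.mul_sum]
  unfold ssq
  rw [Finset.sum_comm]
  exact Finset.sum_le_sum fun i _ => hF fun l => T l i

theorem sum_ment_sq_le_frame {g : ℕ → ℕ → ℕ → ℝ} {j k : ℕ} {F : Finset ℕ} {L H : ℝ} (hL : 0 ≤ L)
    (hF : ∀ x, ∑ b ∈ F, ip (2 ^ k) (g k b) x ^ 2 ≤ L * ssq (2 ^ k) x) (hj : FrameBd g j)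
    {T : ℕ → ℕ → ℝ} (hT : ∑ l ∈ Finset.range (2 ^ k), ssq (2 ^ j) (T l) ≤ H)
    {S : Finset (ℕ × ℕ)} (hS : S ⊆ F ×ˢ Finset.range (numPts j)) :
    ∑ p ∈ S, ment g j k T p.1 p.2 ^ 2 ≤ L * (j : ℝ) ^ (cE + 2) * H := by
  calc _ ≤ ∑ p ∈ F ×ˢ Finset.range (numPts j), ment g j k T p.1 p.2 ^ 2 :=
        Finset.sum_le_sum_of_subset_of_nonneg hS fun _ _ _ => sq_nonneg _
    _ = ∑ b ∈ F, ∑ a ∈ Finset.range (numPts j), ip (2 ^ j) (g j a) (rowv g k T b) ^ 2 := by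
        rw [Finset.sum_product]
        simp only [ment_eq_rowv]
    _ ≤ ∑ b ∈ F, (j : ℝ) ^ (cE + 2) * ssq (2 ^ j) (rowv g k T b) := Finset.sum_le_sum fun b _ => hj _
    _ ≤ (j : ℝ) ^ (cE + 2) * (L * H) := by
        rw [← Finset.mul_sum]
        exact mul_le_mul_of_nonneg_left ((sum_ssq_rowv_le hF j T).trans
          (mul_le_mul_of_nonneg_left hT hL)) (by positivity)
    _ = _ := by ring

theorem abs_ment_le {g : ℕ → ℕ → ℕ → ℝ} {j k : ℕ} {a : ℕ} (h1 : ssq (2 ^ j) (g j a) = 1)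
    {T : ℕ → ℕ → ℝ} {b : ℕ} {s : ℝ} (hs : 0 ≤ s) (h : ssq (2 ^ j) (rowv g k T b) ≤ s ^ 2) :
    |ment g j k T b a| ≤ s := by
  rw [ment_eq_rowv]
  refine abs_le_of_sq_le_sq ?_ hs
  have := ip_sq_le (2 ^ j) (g j a) (rowv g k T b)
  rw [h1, one_mul] at this
  exact this.trans h

/-- The conditions on a matrix between the levels `j` and `k` used in the estimates. -/
structure Moderate (g : ℕ → ℕ → ℕ → ℝ) (j k : ℕ) (T : ℕ → ℕ → ℝ) : Prop where
  entry : ∀ l < 2 ^ k, ∀ i < 2 ^ j, |T l i| ≤ (j : ℝ) ^ 4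
  comb : ∀ F ⊆ Finset.range (numPts j), F.card ≤ 2 ^ (j / 4) → ∀ c : ℕ → ℝ,
    ssq (2 ^ k) (fun l => ip (2 ^ j) (T l) (fun i => ∑ a ∈ F, c a * g j a i)) ≤
      (j : ℝ) ^ (2 * dE + 8) * ∑ a ∈ F, c a ^ 2
  hs : ∑ l ∈ Finset.range (2 ^ k), ssq (2 ^ j) (T l) ≤ 2 ^ j * (4 * (j : ℝ) ^ 6)

/-- The index pairs between the levels `j` and `k` outside the diagonal. -/
def offPairs (j k : ℕ) : Finset (ℕ × ℕ) :=
  (Finset.range (numPts k) ×ˢ Finset.range (numPts j)).filter fun p => (k, p.1) ≠ (j, p.2)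

theorem heavy_sum_le {σ : Signs} {j k : ℕ} (hj : 1 ≤ j) (hc : CrossBd (gv σ) j k)
    (het : et k ≤ 1) (hbig : (j : ℝ) ^ (2 * dE + 8) * 2 ^ (2 * sep j k) < 2 ^ (j / 4))
    {T : ℕ → ℕ → ℝ} (hT : Moderate (gv σ) j k T) :
    ∑ p ∈ (offPairs j k).filter (fun p => ((2 : ℝ) ^ sep j k)⁻¹ ≤ |ment (gv σ) j k T p.1 p.2|),
      |ment (gv σ) j k T p.1 p.2| ^ (2 + et k) ≤ 2 ^ j * (j : ℝ) ^ (3 * dE + 16) := by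
  have hj' : (1 : ℝ) ≤ j := by exact_mod_cast hj
  set E := (offPairs j k).filter (fun p => ((2 : ℝ) ^ sep j k)⁻¹ ≤ |ment (gv σ) j k T p.1 p.2|) with hE
  have hmem : ∀ p ∈ E, p.1 < numPts k ∧ p.2 < numPts j ∧ (k, p.1) ≠ (j, p.2) ∧
      ((2 : ℝ) ^ sep j k)⁻¹ ≤ |ment (gv σ) j k T p.1 p.2| := by
    intro p hp
    rw [hE, Finset.mem_filter, offPairs, Finset.mem_filter, Finset.mem_product, Finset.mem_range,
      Finset.mem_range] at hp
    exact ⟨hp.1.1.1, hp.1.1.2, hp.1.2, hp.2⟩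
  have hsq : ∀ F ⊆ Finset.range (numPts j), F.card ≤ 2 ^ (j / 4) → ∀ b,
      ∑ a ∈ F, ment (gv σ) j k T b a ^ 2 ≤ (j : ℝ) ^ (2 * dE + 8) := fun F hF hFc b =>
    sum_ment_sq_le (ssq_gv σ k) (by positivity) (hT.comb F hF hFc) b
  have hmax : ∀ p ∈ E, |ment (gv σ) j k T p.1 p.2| ≤ (j : ℝ) ^ (dE + 4) := by
    intro p hp
    refine abs_le_of_sq_le_sq ?_ (by positivity)
    have := hsq {p.2} (by simpa using (hmem p hp).2.1) (by simpa using Nat.one_le_two_pow) p.1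
    rw [Finset.sum_singleton] at this
    rw [← pow_mul]
    exact this.trans_eq (by ring)
  have hfib : ∀ b, (E.filter fun p => p.1 = b).card ≤ 2 ^ (j / 4) := by
    intro b
    by_contra hlt
    push Not at hlt
    have hcard : (E.filter fun p => p.1 = b).card = ((E.filter fun p => p.1 = b).image Prod.snd).card := by
      refine (Finset.card_image_of_injOn ?_).symm
      intro p hp q hq h
      have hp' := (Finset.mem_filter.1 hp).2
      have hq' := (Finset.mem_filter.1 hq).2
      exact Prod.ext (hp'.trans hq'.symm) h
    rw [hcard] at hlt
    obtain ⟨F, hF, hFc⟩ := Finset.exists_subset_card_eq hlt.le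
    have hFE : ∀ a ∈ F, (b, a) ∈ E := by
      intro a ha
      obtain ⟨p, hp, rfl⟩ := Finset.mem_image.1 (hF ha)
      obtain ⟨hp1, hp2⟩ := Finset.mem_filter.1 hp
      rw [← hp2]; exact hp1
    have h := hsq F (fun a ha => Finset.mem_range.2 (hmem _ (hFE a ha)).2.1) hFc.le b
    have hlow : (2 : ℝ) ^ (j / 4) * (((2 : ℝ) ^ sep j k)⁻¹) ^ 2 ≤ ∑ a ∈ F, ment (gv σ) j k T b a ^ 2 := by
      have : ∑ _a ∈ F, (((2 : ℝ) ^ sep j k)⁻¹) ^ 2 ≤ ∑ a ∈ F, ment (gv σ) j k T b a ^ 2 := by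
        refine Finset.sum_le_sum fun a ha => ?_
        rw [← sq_abs (ment (gv σ) j k T b a)]
        exact pow_le_pow_left₀ (by positivity) (hmem _ (hFE a ha)).2.2.2 2
      rw [Finset.sum_const, hFc, nsmul_eq_mul] at this
      push_cast at this
      exact this
    have := hlow.trans h
    rw [inv_pow, ← pow_mul, mul_comm (sep j k), ← div_eq_mul_inv, div_le_iff₀ (by positivity)] at this
    linarith
  have hQ := hc T hT.entry hT.comb E hmem hfib
  calc _ ≤ ((j : ℝ) ^ (dE + 4)) ^ et k * ∑ p ∈ E, ment (gv σ) j k T p.1 p.2 ^ 2 :=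
        sum_rpow_le (et_nonneg k) hmax
    _ ≤ (j : ℝ) ^ (dE + 4) * (2 ^ j * (j : ℝ) ^ (2 * dE + 12)) := by
        refine mul_le_mul ?_ hQ (Finset.sum_nonneg fun _ _ => sq_nonneg _) (by positivity)
        calc _ ≤ ((j : ℝ) ^ (dE + 4)) ^ (1 : ℝ) :=
              Real.rpow_le_rpow_of_exponent_le (one_le_pow₀ hj') het
          _ = _ := Real.rpow_one _
    _ = _ := by ring

theorem light_sum_le {g : ℕ → ℕ → ℕ → ℝ} {j k : ℕ} (hj : 12 ≤ j) (hjk : j ≤ k ^ 5)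
    (hgj : FrameBd g j) (hgk : FrameBd g k) {T : ℕ → ℕ → ℝ} (hT : Moderate g j k T)
    {S : Finset (ℕ × ℕ)} (hS : S ⊆ offPairs j k) {m : ℝ} (hSm : ∀ p ∈ S, |ment g j k T p.1 p.2| ≤ m)
    (hm : m ^ et k ≤ ((k : ℝ) ^ (cE + 122))⁻¹) :
    ∑ p ∈ S, |ment g j k T p.1 p.2| ^ (2 + et k) ≤ 2 ^ j * (j : ℝ) ^ (cE - 15) / 3 := by
  obtain ⟨c', hc'⟩ : ∃ c', cE = c' + 20 := ⟨420, by rw [cE_eq]⟩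
  have hj' : (12 : ℝ) ≤ j := by exact_mod_cast hj
  have hk : (0 : ℝ) < k := by
    rcases Nat.eq_zero_or_pos k with h | h
    · subst h; omega
    · exact_mod_cast h
  have hjk' : (j : ℝ) ≤ (k : ℝ) ^ 5 := by exact_mod_cast hjk
  calc _ ≤ m ^ et k * ∑ p ∈ S, ment g j k T p.1 p.2 ^ 2 := sum_rpow_le (et_nonneg k) hSm
    _ ≤ ((k : ℝ) ^ (cE + 122))⁻¹ * ((k : ℝ) ^ (cE + 2) * (j : ℝ) ^ (cE + 2) * (2 ^ j * (4 * (j : ℝ) ^ 6))) :=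
        mul_le_mul hm (sum_ment_sq_le_frame (by positivity) hgk hgj hT.hs
          (hS.trans (Finset.filter_subset _ _))) (Finset.sum_nonneg fun _ _ => sq_nonneg _)
          (by positivity)
    _ = ((k : ℝ) ^ 120)⁻¹ * (2 ^ j * (4 * (j : ℝ) ^ (cE + 8))) := by
        rw [show cE + 122 = (cE + 2) + 120 by ring, pow_add (k : ℝ) (cE + 2) 120]
        field_simp
        ring
    _ ≤ ((j : ℝ) ^ 24)⁻¹ * (2 ^ j * (4 * (j : ℝ) ^ (cE + 8))) := by
        refine mul_le_mul_of_nonneg_right (inv_anti₀ (by positivity) ?_) (by positivity)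
        calc (j : ℝ) ^ 24 ≤ ((k : ℝ) ^ 5) ^ 24 := by gcongr
          _ = _ := by rw [← pow_mul]
    _ = 2 ^ j * (4 * (j : ℝ) ^ (c' + 4)) := by
        rw [hc']
        have : (j : ℝ) ≠ 0 := by linarith
        field_simp
        ring
    _ ≤ _ := by
        rw [show cE - 15 = c' + 4 + 1 by omega, pow_succ (j : ℝ) (c' + 4)]
        have : 0 ≤ (2 : ℝ) ^ j * (j : ℝ) ^ (c' + 4) := by positivity
        nlinarith

theorem le_mul_mul_div_three {x y z : ℝ} (h : 0 ≤ x * y) (hz : 3 ≤ z) :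
    x * y ≤ x * (y * z) / 3 := by nlinarith

theorem offdiag_sum_le : ∃ N : ℕ, ∀ (σ : Signs) (J : ℕ), Typical (gv σ) J → ∀ j k, N ≤ j → N ≤ k →
    J ≤ j → J ≤ k → Near j k → ∀ T : ℕ → ℕ → ℝ, Moderate (gv σ) j k T →
    ∑ p ∈ offPairs j k, |ment (gv σ) j k T p.1 p.2| ^ (2 + et k) ≤ numPts j / (j : ℝ) ^ 15 := by
  obtain ⟨N₁, h₁⟩ := Filter.eventually_atTop.1 eventually_et_le_one
  obtain ⟨N₂, h₂⟩ := Filter.eventually_atTop.1 (eventually_pow_le_two_pow (2 ^ 24) (8 * (2 * dE + 8)))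
  obtain ⟨N₃, h₃⟩ := Filter.eventually_atTop.1
    (eventually_pow_le_two_pow_half 16 (2 * cE + 18))
  refine ⟨max 3000 (max N₁ (max N₂ N₃)), fun σ J hJ j k hj hk hJj hJk hn T hT => ?_⟩
  simp only [max_le_iff] at hj hk
  obtain ⟨hj0, hj1, hj2, hj3⟩ := hj
  obtain ⟨hk0, hk1, hk2, hk3⟩ := hk
  obtain ⟨c', hc'⟩ : ∃ c', cE = c' + 20 := ⟨420, by rw [cE_eq]⟩
  have hjr : (3000 : ℝ) ≤ j := by exact_mod_cast hj0
  have hkr : (3000 : ℝ) ≤ k := by exact_mod_cast hk0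
  have hN : cE + 122 = 562 := by rw [cE_eq]
  have hk1' : 1 ≤ k := by omega
  obtain ⟨hn1, hn2⟩ := hn
  set M := ment (gv σ) j k T with hM
  set t : ℝ := ((2 : ℝ) ^ sep j k)⁻¹ with ht
  have ht0 : 0 ≤ t := by positivity
  have hheavy : ∑ p ∈ (offPairs j k).filter (fun p => t ≤ |M p.1 p.2|), |M p.1 p.2| ^ (2 + et k) ≤
      2 ^ j * (j : ℝ) ^ (cE - 15) / 3 := by
    refine (heavy_sum_le (by omega) (hJ.cross j k hJj hJk ⟨hn1, hn2⟩) (h₁ k hk1) ?_ hT).trans ?_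
    · have h := h₂ j hj2
      have e1 : (2 : ℝ) ^ (2 * sep j k) ≤ 2 ^ (j / 8) :=
        pow_le_pow_right₀ (by norm_num) (by rw [sep]; omega)
      have e2 : (j : ℝ) ^ (2 * dE + 8) * 2 ^ (j / 8) < 2 ^ (j / 4) := by
        have e3 : (j : ℝ) ^ (2 * dE + 8) * 2 ^ 2 ≤ 2 ^ (j / 8) := by
          refine le_of_pow_le_pow_left₀ (n := 8) (by norm_num) (by positivity) ?_
          have e4 : (2 : ℝ) ^ j ≤ (2 ^ (j / 8)) ^ 8 * 2 ^ 8 := by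
            rw [← pow_mul, ← pow_add]
            exact pow_le_pow_right₀ (by norm_num) (by omega)
          rw [mul_pow, ← pow_mul (j : ℝ), mul_comm (2 * dE + 8)]
          refine le_of_mul_le_mul_right ((le_of_eq ?_).trans (h.trans e4)) (by norm_num)
          ring
        have e5 : (2 : ℝ) ^ (j / 8) * 2 ^ (j / 8) ≤ 2 ^ (j / 4) := by
          rw [← pow_add]
          exact pow_le_pow_right₀ (by norm_num) (by omega)
        have : (0 : ℝ) < 2 ^ (j / 8) := by positivity
        calc (j : ℝ) ^ (2 * dE + 8) * 2 ^ (j / 8) < (j : ℝ) ^ (2 * dE + 8) * 2 ^ 2 * 2 ^ (j / 8) := by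
              refine mul_lt_mul_of_pos_right ?_ this
              exact lt_mul_of_one_lt_right (by positivity) (by norm_num)
          _ ≤ 2 ^ (j / 8) * 2 ^ (j / 8) := mul_le_mul_of_nonneg_right e3 this.le
          _ ≤ _ := e5
      exact lt_of_le_of_lt (mul_le_mul_of_nonneg_left e1 (by positivity)) e2
    · have : 3 * dE + 16 + 79 = cE - 15 := by rw [dE_eq, cE_eq]
      rw [← this, pow_add (j : ℝ) (3 * dE + 16) 79]
      have h3 : (3 : ℝ) ≤ (j : ℝ) ^ 79 := (by linarith : (3 : ℝ) ≤ j).trans (le_self_pow₀ (by linarith) (by norm_num))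
      have : 0 ≤ (2 : ℝ) ^ j * (j : ℝ) ^ (3 * dE + 16) := by positivity
      exact le_mul_mul_div_three this h3
  set Lt := (offPairs j k).filter (fun p => ¬ t ≤ |M p.1 p.2|) with hLt
  have hLtm : ∀ p ∈ Lt, |M p.1 p.2| ≤ t := fun p hp => (not_le.1 (Finset.mem_filter.1 hp).2).le
  have hlight : ∑ p ∈ Lt, |M p.1 p.2| ^ (2 + et k) ≤ 2 * (2 ^ j * (j : ℝ) ^ (cE - 15) / 3) := by
    have hX : 0 ≤ 2 ^ j * (j : ℝ) ^ (cE - 15) / 3 := by positivity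
    by_cases hcase : k ≤ 6 * j
    · refine (light_sum_le (by omega) hn1 (hJ.frame j hJj) (hJ.frame k hJk) hT
        (Finset.filter_subset _ _) hLtm (rpow_et_le hk1' ht0 le_rfl ?_)).trans (by linarith)
      rw [hN, sep]; omega
    push Not at hcase
    set s : ℝ := ((2 : ℝ) ^ (k / 32))⁻¹ with hs
    have hs0 : 0 < s := by positivity
    set G := (Finset.range (numPts k)).filter (fun b => s ^ 2 < ssq (2 ^ j) (rowv (gv σ) k T b)) with hG
    have hGr : G ⊆ Finset.range (numPts k) := Finset.filter_subset _ _
    rw [← Finset.sum_filter_add_sum_filter_not Lt (fun p => p.1 ∈ G), two_mul]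
    refine add_le_add ?_ ?_
    · have hGc : G.card * (k * rt k) ≤ 1 := by
        have hb : G.card * s ^ 2 ≤ (k : ℝ) ^ (cE + 2) * (2 ^ j * (4 * (j : ℝ) ^ 6)) := by
          calc (G.card : ℝ) * s ^ 2 = ∑ _b ∈ G, s ^ 2 := by rw [Finset.sum_const, nsmul_eq_mul]
            _ ≤ ∑ b ∈ G, ssq (2 ^ j) (rowv (gv σ) k T b) :=
                Finset.sum_le_sum fun b hb => (Finset.mem_filter.1 hb).2.le
            _ ≤ ∑ b ∈ Finset.range (numPts k), ssq (2 ^ j) (rowv (gv σ) k T b) :=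
                Finset.sum_le_sum_of_subset_of_nonneg hGr fun _ _ _ => ssq_nonneg _ _
            _ ≤ (k : ℝ) ^ (cE + 2) * ∑ l ∈ Finset.range (2 ^ k), ssq (2 ^ j) (T l) :=
                sum_ssq_rowv_le (hJ.frame k hJk) j T
            _ ≤ _ := mul_le_mul_of_nonneg_left hT.hs (by positivity)
        have hjk : (j : ℝ) ≤ k := by exact_mod_cast (by omega : j ≤ k)
        have hb2 : (G.card : ℝ) * k ≤ 4 * (k : ℝ) ^ (cE + 9) * (2 ^ j * 2 ^ (2 * (k / 32))) := by
          have : (G.card : ℝ) = G.card * s ^ 2 * 2 ^ (2 * (k / 32)) := by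
            rw [hs, inv_pow, ← pow_mul, mul_comm (k / 32)]
            field_simp
          rw [this]
          calc _ ≤ (k : ℝ) ^ (cE + 2) * (2 ^ j * (4 * (k : ℝ) ^ 6)) * 2 ^ (2 * (k / 32)) * k := by
                refine mul_le_mul_of_nonneg_right (mul_le_mul_of_nonneg_right (hb.trans ?_)
                  (by positivity)) (by positivity)
                gcongr
            _ = _ := by ring
        refine abs_le_one_iff_mul_self_le_one.2 ?_ |> (le_abs_self _).trans
        have hb3 : ((G.card : ℝ) * k) ^ 2 ≤ 2 ^ k := by
          calc ((G.card : ℝ) * k) ^ 2 ≤ (4 * (k : ℝ) ^ (cE + 9) * (2 ^ j * 2 ^ (2 * (k / 32)))) ^ 2 := by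
                gcongr
            _ = (16 * (k : ℝ) ^ (2 * cE + 18)) * 2 ^ (2 * j + 4 * (k / 32)) := by ring
            _ ≤ 2 ^ (k / 2) * 2 ^ (2 * j + 4 * (k / 32)) :=
                mul_le_mul_of_nonneg_right (h₃ k hk3) (by positivity)
            _ ≤ 2 ^ k := by
                rw [← pow_add]
                exact pow_le_pow_right₀ (by norm_num) (by omega)
        have : 0 ≤ rt k ^ 2 := sq_nonneg _
        calc (G.card : ℝ) * (k * rt k) * (G.card * (k * rt k)) = (G.card * k) ^ 2 * rt k ^ 2 := by ring
          _ ≤ 2 ^ k * rt k ^ 2 := mul_le_mul_of_nonneg_right hb3 this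
          _ = 1 := two_pow_mul_rt_sq k
      have hsum := sum_ment_sq_le_frame (L := 2) (by norm_num)
        (sum_ip_sq_le_two (hJ.incoherent k hJk) (ssq_gv σ k) hGr hGc) (hJ.frame j hJj) hT.hs
        (S := Lt.filter fun p => p.1 ∈ G) (fun p hp => by
          obtain ⟨hp1, hp2⟩ := Finset.mem_filter.1 hp
          have := (Finset.mem_filter.1 (Finset.mem_filter.1 hp1).1).1
          exact Finset.mem_product.2 ⟨hp2, (Finset.mem_product.1 this).2⟩)
      have ht24 : t ^ et k ≤ ((k : ℝ) ^ 24)⁻¹ :=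
        rpow_et_le hk1' ht0 le_rfl (by rw [sep]; omega)
      have ht24' : t ^ et k ≤ ((j : ℝ) ^ 24)⁻¹ := by
        refine ht24.trans (inv_anti₀ (by positivity) ?_)
        have : (j : ℝ) ≤ k := by exact_mod_cast (by omega : j ≤ k)
        gcongr
      calc _ ≤ t ^ et k * ∑ p ∈ Lt.filter (fun p => p.1 ∈ G), M p.1 p.2 ^ 2 :=
            sum_rpow_le (et_nonneg k) fun p hp => hLtm p (Finset.mem_filter.1 hp).1
        _ ≤ ((j : ℝ) ^ 24)⁻¹ * (2 * (j : ℝ) ^ (cE + 2) * (2 ^ j * (4 * (j : ℝ) ^ 6))) :=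
            mul_le_mul ht24' hsum (Finset.sum_nonneg fun _ _ => sq_nonneg _) (by positivity)
        _ = 2 ^ j * (8 * (j : ℝ) ^ (c' + 4)) := by
            rw [hc']
            have : (j : ℝ) ≠ 0 := by linarith
            field_simp
            ring
        _ ≤ _ := by
            rw [show cE - 15 = c' + 4 + 1 by omega, pow_succ (j : ℝ) (c' + 4)]
            have : 0 ≤ (2 : ℝ) ^ j * (j : ℝ) ^ (c' + 4) := by positivity
            calc (2 : ℝ) ^ j * (8 * (j : ℝ) ^ (c' + 4)) = 2 ^ j * (j : ℝ) ^ (c' + 4) * 8 := by ring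
              _ ≤ 2 ^ j * (j : ℝ) ^ (c' + 4) * (j / 3) :=
                mul_le_mul_of_nonneg_left (by linarith) this
              _ = _ := by ring
    · refine light_sum_le (by omega) hn1 (hJ.frame j hJj) (hJ.frame k hJk) hT
        ((Finset.filter_subset _ _).trans (Finset.filter_subset _ _)) (m := s) (fun p hp => ?_)
        (rpow_et_le hk1' hs0.le le_rfl (by rw [hN]; omega))
      obtain ⟨hp1, hp2⟩ := Finset.mem_filter.1 hp
      have hp3 := (Finset.mem_filter.1 (Finset.mem_filter.1 hp1).1).1
      refine abs_ment_le (ssq_gv σ j _) hs0.le ?_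
      by_contra hlt
      exact hp2 (Finset.mem_filter.2 ⟨(Finset.mem_product.1 hp3).1, not_le.1 hlt⟩)
  rw [← Finset.sum_filter_add_sum_filter_not (offPairs j k) (fun p => t ≤ |M p.1 p.2|)]
  refine (add_le_add hheavy hlight).trans_eq ?_
  rw [numPts, hc', show c' + 20 - 15 = c' + 5 by omega]
  push_cast
  have : (j : ℝ) ≠ 0 := by linarith
  field_simp
  ring

/-! ### Finite `ℓ_p` norms -/

/-- The `ℓ_p` norm of the first `n` terms of a sequence. -/
def lpn (p : ℝ) (n : ℕ) (u : ℕ → ℝ) : ℝ := (∑ i ∈ Finset.range n, |u i| ^ p) ^ (1 / p)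

theorem lpn_sum_nonneg (p : ℝ) (n : ℕ) (u : ℕ → ℝ) : 0 ≤ ∑ i ∈ Finset.range n, |u i| ^ p :=
  Finset.sum_nonneg fun i _ => Real.rpow_nonneg (abs_nonneg (u i)) p

theorem lpn_nonneg (p : ℝ) (n : ℕ) (u : ℕ → ℝ) : 0 ≤ lpn p n u :=
  Real.rpow_nonneg (lpn_sum_nonneg p n u) _

theorem lpn_rpow {p : ℝ} (hp : 0 < p) (n : ℕ) (u : ℕ → ℝ) :
    lpn p n u ^ p = ∑ i ∈ Finset.range n, |u i| ^ p := by
  rw [lpn, ← Real.rpow_mul (lpn_sum_nonneg p n u), one_div, inv_mul_cancel₀ hp.ne', Real.rpow_one]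

theorem lpn_congr {p : ℝ} {n : ℕ} {u v : ℕ → ℝ} (h : ∀ i < n, u i = v i) : lpn p n u = lpn p n v := by
  unfold lpn
  rw [Finset.sum_congr rfl fun i hi => by rw [h i (Finset.mem_range.1 hi)]]

theorem lpn_add_le {p : ℝ} (hp : 1 ≤ p) (n : ℕ) (u v : ℕ → ℝ) :
    lpn p n (fun i => u i + v i) ≤ lpn p n u + lpn p n v :=
  Real.Lp_add_le _ _ _ hp

theorem lpn_smul {p : ℝ} (hp : 0 < p) (n : ℕ) (c : ℝ) (u : ℕ → ℝ) :
    lpn p n (fun i => c * u i) = |c| * lpn p n u := by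
  unfold lpn
  simp_rw [abs_mul, Real.mul_rpow (abs_nonneg _) (abs_nonneg _)]
  rw [← Finset.mul_sum, Real.mul_rpow (by positivity) (lpn_sum_nonneg p n u),
    ← Real.rpow_mul (abs_nonneg _), mul_one_div_cancel hp.ne', Real.rpow_one]

theorem lpn_neg (p : ℝ) (n : ℕ) (u : ℕ → ℝ) : lpn p n (fun i => -u i) = lpn p n u := by
  simp [lpn]

theorem lpn_sub_le {p : ℝ} (hp : 1 ≤ p) (n : ℕ) (u v : ℕ → ℝ) :
    lpn p n (fun i => u i - v i) ≤ lpn p n u + lpn p n v := by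
  have := lpn_add_le hp n u (fun i => -v i)
  rw [lpn_neg] at this
  simpa only [sub_eq_add_neg] using this

theorem lpn_zero {p : ℝ} (hp : 0 < p) (n : ℕ) {u : ℕ → ℝ} (h : ∀ i < n, u i = 0) : lpn p n u = 0 := by
  rw [lpn_congr h, show (fun _ : ℕ => (0 : ℝ)) = fun i => 0 * (0 : ℝ) by simp,
    lpn_smul hp n 0 (fun _ => 0)]
  simp

theorem abs_le_lpn {p : ℝ} (hp : 0 < p) {n i : ℕ} (hi : i < n) (u : ℕ → ℝ) : |u i| ≤ lpn p n u := by
  rw [← Real.rpow_le_rpow_iff (abs_nonneg _) (lpn_nonneg _ _ _) hp, lpn_rpow hp]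
  exact Finset.single_le_sum (f := fun i => |u i| ^ p)
    (fun i _ => Real.rpow_nonneg (abs_nonneg (u i)) p) (Finset.mem_range.2 hi)

theorem lpn_antitone {p q : ℝ} (hp : 0 < p) (hpq : p ≤ q) (n : ℕ) (u : ℕ → ℝ) :
    lpn q n u ≤ lpn p n u := by
  have hq := hp.trans_le hpq
  rw [← Real.rpow_le_rpow_iff (lpn_nonneg _ _ _) (lpn_nonneg _ _ _) hq, lpn_rpow hq]
  rcases (lpn_nonneg p n u).eq_or_lt with h | h
  · rw [← h, Real.zero_rpow hq.ne']
    refine (Finset.sum_eq_zero fun i hi => ?_).le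
    have := abs_le_lpn hp (Finset.mem_range.1 hi) u
    rw [← h] at this
    rw [le_antisymm this (abs_nonneg _), Real.zero_rpow hq.ne']
  · calc ∑ i ∈ Finset.range n, |u i| ^ q
        ≤ ∑ i ∈ Finset.range n, |u i| ^ p * lpn p n u ^ (q - p) := by
          refine Finset.sum_le_sum fun i hi => ?_
          calc |u i| ^ q = |u i| ^ (p + (q - p)) := by congr 1; ring
            _ = |u i| ^ p * |u i| ^ (q - p) :=
              Real.rpow_add_of_nonneg (abs_nonneg _) hp.le (by linarith)
            _ ≤ _ := mul_le_mul_of_nonneg_left (Real.rpow_le_rpow (abs_nonneg _)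
                (abs_le_lpn hp (Finset.mem_range.1 hi) u) (by linarith))
                (Real.rpow_nonneg (abs_nonneg _) _)
      _ = _ := by
          rw [← Finset.sum_mul, ← lpn_rpow hp, ← Real.rpow_add h]
          congr 1; ring

theorem lpn_comp_le {p : ℝ} (hp : 0 < p) {m n : ℕ} {f : ℕ → ℕ} (hf : Function.Injective f)
    (h : ∀ i < m, f i < n) (u : ℕ → ℝ) : lpn p m (fun i => u (f i)) ≤ lpn p n u := by
  rw [← Real.rpow_le_rpow_iff (lpn_nonneg _ _ _) (lpn_nonneg _ _ _) hp, lpn_rpow hp, lpn_rpow hp,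
    ← Finset.sum_image (f := fun i => |u i| ^ p) (s := Finset.range m) (g := f) hf.injOn]
  refine Finset.sum_le_sum_of_subset_of_nonneg (fun i hi => ?_)
    fun i _ _ => Real.rpow_nonneg (abs_nonneg (u i)) p
  obtain ⟨a, ha, rfl⟩ := Finset.mem_image.1 hi
  exact Finset.mem_range.2 (h a (Finset.mem_range.1 ha))

theorem lpn_two_sq (n : ℕ) (u : ℕ → ℝ) : lpn 2 n u ^ 2 = ssq n u := by
  have := lpn_rpow (p := 2) two_pos n u
  rw [show (2 : ℝ) = ((2 : ℕ) : ℝ) by norm_num] at this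
  simp only [Real.rpow_natCast, sq_abs] at this
  exact_mod_cast this

theorem lpn_le_of_sum_le {p : ℝ} (hp : 0 < p) {n : ℕ} {u : ℕ → ℝ} {B : ℝ} (hB : 0 ≤ B)
    (h : ∑ i ∈ Finset.range n, |u i| ^ p ≤ B ^ p) : lpn p n u ≤ B := by
  rwa [← Real.rpow_le_rpow_iff (lpn_nonneg _ _ _) hB hp, lpn_rpow hp]

/-- The Euclidean combination of three nonnegative numbers is subadditive. -/
theorem sqrt_sq_add_le {a b c a' b' c' x y z : ℝ} (hx : 0 ≤ x) (hy : 0 ≤ y) (hz : 0 ≤ z)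
    (hxa : x ≤ a + a') (hyb : y ≤ b + b') (hzc : z ≤ c + c') :
    √(x ^ 2 + y ^ 2 + z ^ 2) ≤ √(a ^ 2 + b ^ 2 + c ^ 2) + √(a' ^ 2 + b' ^ 2 + c' ^ 2) := by
  have h := norm_add_le (!₂[a, b, c] : EuclideanSpace ℝ (Fin 3)) !₂[a', b', c']
  simp only [EuclideanSpace.norm_eq, Fin.sum_univ_three, Real.norm_eq_abs, sq_abs] at h
  simp at h
  refine le_trans (Real.sqrt_le_sqrt ?_) h
  gcongr

/-! ### Coordinates -/

/-- The coordinate functional at the index `m`. -/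
def cf (m : ℕ) : Vb →ₗ[ℝ] ℝ := if h : aIdx 6 < m then Finsupp.lapply ⟨m, h⟩ else 0

/-- The basis vector at the index `m`. -/
def eb (m : ℕ) : Vb := if h : aIdx 6 < m then Finsupp.single ⟨m, h⟩ 1 else 0

theorem cf_of_lt {m : ℕ} (h : aIdx 6 < m) (x : Vb) : cf m x = x ⟨m, h⟩ := by
  simp [cf, h]

theorem cf_projTo (m : ℕ) (s : Set ℕ) (x : Vb) : cf m (projTo s x) = if m ∈ s then cf m x else 0 := by
  unfold cf
  split_ifs with h h1 h2 <;> simp [projTo, *]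

theorem cf_eb (m m' : ℕ) : cf m (eb m') = if m = m' ∧ aIdx 6 < m then 1 else 0 := by
  unfold cf eb
  split_ifs with h h1 h2 h2 <;> simp_all <;> grind

theorem projTo_eq_zero {x : Vb} {s : Set ℕ} (h : ∀ i, x i ≠ 0 → (i : ℕ) ∉ s) : projTo s x = 0 := by
  ext i
  have : projTo s x i = if (i : ℕ) ∈ s then x i else 0 := rfl
  rw [this]
  split_ifs with h1
  · by_contra h0
    exact h i h0 h1
  · rfl

/-- The index of the `i`-th distinguished coordinate of level `j`. -/
def posn (j i : ℕ) : ℕ := aIdx (j + 1) + 1 + i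

theorem posn_injective (j : ℕ) : Function.Injective (posn j) := fun a b h => by
  unfold posn at h; omega

theorem aIdx_mono {r s : ℕ} (h : r ≤ s) : aIdx r ≤ aIdx s := by
  unfold aIdx
  have : 10 ^ (r - 2) ≤ 10 ^ (s - 2) := Nat.pow_le_pow_right (by norm_num) (by omega)
  omega

theorem bIdx_le_aIdx {r s : ℕ} (h : r + 2 ≤ s) : bIdx r ≤ aIdx s := by
  unfold aIdx bIdx
  have : 10 ^ r ≤ 10 ^ (s - 2) := Nat.pow_le_pow_right (by norm_num) (by omega)
  omega

theorem posn_mem_WIdx {j i : ℕ} (hj : 1 ≤ j) (hi : i < 2 ^ j) : posn j i ∈ WIdx j := by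
  obtain ⟨k, rfl⟩ := Nat.exists_eq_add_of_le' hj
  have : 2 ^ (k + 1) ≤ 5 * 10 ^ k := by
    rw [pow_succ]
    have : 2 ^ k ≤ 10 ^ k := Nat.pow_le_pow_left (by norm_num) k
    omega
  simp only [WIdx, Set.mem_ofPred_eq, posn, aIdx, bIdx,
    show k + 1 + 1 - 2 = k by omega] at *
  rw [pow_succ 10 k]
  omega

theorem WIdx_subset_VIdx {r s : ℕ} (h : r ≤ s) (h' : s ≤ r + 1) : WIdx r ⊆ VIdx s := by
  rintro m ⟨h1, h2⟩
  refine ⟨(aIdx_mono h').trans_lt h1, h2.trans (Nat.pow_le_pow_right (by norm_num) h)⟩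

theorem notMem_VIdx_of_mem_WIdx {k r m : ℕ} (hm : m ∈ WIdx k) (h1 : r ≠ k) (h2 : r ≠ k + 1) :
    m ∉ VIdx r := by
  rintro ⟨h3, h4⟩
  rcases lt_or_gt_of_ne h1 with h | h
  · have := (bIdx_le_aIdx (show r + 2 ≤ k + 1 + 1 by omega))
    have h5 := hm.1
    have : bIdx r ≤ aIdx (k + 1) := bIdx_le_aIdx (by omega)
    omega
  · have : bIdx k ≤ aIdx r := bIdx_le_aIdx (by omega)
    have := hm.2
    omega

theorem notMem_WIdx_of_mem_WIdx {k r m : ℕ} (hm : m ∈ WIdx k) (h1 : r ≠ k) : m ∉ WIdx r := by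
  rintro ⟨h3, h4⟩
  have h5 := hm.1
  have h6 := hm.2
  rcases lt_or_gt_of_ne h1 with h | h
  · have : bIdx r ≤ aIdx (k + 1) := bIdx_le_aIdx (by omega)
    omega
  · have : bIdx k ≤ aIdx (r + 1) := bIdx_le_aIdx (by omega)
    omega

theorem lt_posn {j i : ℕ} (hj : 5 ≤ j) : aIdx 6 < posn j i := by
  have := aIdx_mono (show 6 ≤ j + 1 by omega)
  unfold posn; omega

/-! ### The norms -/

/-- The scale of level `k`; levels below `J` are inactive. -/
def Dc (J k : ℕ) : ℝ := if J ≤ k then (k : ℝ) ^ dE else 0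

/-- The exponent of level `k`. -/
def px (J k : ℕ) : ℝ := 2 + et (max k J)

/-- The evaluation functionals at the points of level `k`. -/
def Gc (σ : Signs) (J k a : ℕ) : Vb →ₗ[ℝ] ℝ :=
  ∑ i ∈ Finset.range (2 ^ k), (Dc J k * gv σ k a i) • cf (posn k i)

theorem Gc_apply (σ : Signs) (J k a : ℕ) (x : Vb) :
    Gc σ J k a x = Dc J k * ip (2 ^ k) (gv σ k a) (fun i => cf (posn k i) x) := by
  simp [Gc, ip, Finset.mul_sum, mul_assoc]

/-- The differences tying together the evaluations at two consecutive levels. -/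
def Tie (σ : Signs) (J r a : ℕ) : Vb →ₗ[ℝ] ℝ := Gc σ J (r - 1) (2 * a) - Gc σ J r (2 * a + 1)

/-- The `ℓ_p` norm of the evaluations of level `k`. -/
def Psi (σ : Signs) (J k : ℕ) (x : Vb) : ℝ := lpn (px J k) (numPts k) fun a => Gc σ J k a x

/-- The `ℓ_p` norm of the tying differences. -/
def TieN (σ : Signs) (J r : ℕ) (x : Vb) : ℝ :=
  lpn (px J (r - 1)) (numPts (r - 1) / 2) fun a => Tie σ J r a x

/-- The Euclidean norm of the coordinates up to `b_r`. -/
def EucN (r : ℕ) (x : Vb) : ℝ := lpn 2 (bIdx r + 1) fun m => cf m x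

/-- The norm `‖·‖_(r)`. -/
def Nr (σ : Signs) (J r : ℕ) (x : Vb) : ℝ :=
  √(EucN r x ^ 2 + Psi σ J r x ^ 2 + (√(Real.log r) * TieN σ J r x) ^ 2)

theorem two_le_px (J k : ℕ) : 2 ≤ px J k := by
  have := et_nonneg (max k J)
  unfold px; linarith

theorem px_pos (J k : ℕ) : 0 < px J k := by linarith [two_le_px J k]

theorem one_le_px (J k : ℕ) : 1 ≤ px J k := by linarith [two_le_px J k]

theorem Psi_nonneg (σ : Signs) (J k : ℕ) (x : Vb) : 0 ≤ Psi σ J k x := lpn_nonneg _ _ _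

theorem TieN_nonneg (σ : Signs) (J k : ℕ) (x : Vb) : 0 ≤ TieN σ J k x := lpn_nonneg _ _ _

theorem EucN_nonneg (r : ℕ) (x : Vb) : 0 ≤ EucN r x := lpn_nonneg _ _ _

theorem Nr_sq (σ : Signs) (J r : ℕ) (x : Vb) :
    Nr σ J r x ^ 2 = EucN r x ^ 2 + Psi σ J r x ^ 2 + Real.log r * TieN σ J r x ^ 2 := by
  rw [Nr, Real.sq_sqrt (by positivity), mul_pow, Real.sq_sqrt (Real.log_natCast_nonneg r)]

theorem EucN_zero (r : ℕ) : EucN r 0 = 0 := lpn_zero two_pos _ (by simp)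
theorem Psi_zero (σ : Signs) (J k : ℕ) : Psi σ J k 0 = 0 := lpn_zero (px_pos _ _) _ (by simp)
theorem TieN_zero (σ : Signs) (J k : ℕ) : TieN σ J k 0 = 0 := lpn_zero (px_pos _ _) _ (by simp)
theorem Nr_zero (σ : Signs) (J k : ℕ) : Nr σ J k 0 = 0 := by
  simp [Nr, EucN_zero, Psi_zero, TieN_zero]

theorem normFamily_Nr (σ : Signs) (J : ℕ) : NormFamily (Nr σ J) := by
  intro r hr
  refine ⟨fun x _ => Real.sqrt_nonneg _, fun x hx h => ?_, fun x y _ _ => ?_, fun c x _ => ?_⟩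
  · have h2 := Nr_sq σ J r x
    rw [h] at h2
    have hE : EucN r x ^ 2 = 0 := by
      have := Real.log_natCast_nonneg r
      have : 0 ≤ Real.log r * TieN σ J r x ^ 2 := by positivity
      nlinarith [sq_nonneg (EucN r x), sq_nonneg (Psi σ J r x)]
    ext i
    by_contra h0
    have hi := hx i h0
    have := abs_le_lpn (p := 2) two_pos (n := bIdx r + 1) (i := i) (by have := hi.2; omega)
      (fun m => cf m x)
    rw [show lpn 2 (bIdx r + 1) (fun m => cf m x) = 0 from pow_eq_zero_iff two_ne_zero |>.1 hE,
      cf_of_lt i.2] at this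
    exact h0 (abs_nonpos_iff.1 this)
  · refine sqrt_sq_add_le (EucN_nonneg _ _) (Psi_nonneg _ _ _ _)
      (mul_nonneg (Real.sqrt_nonneg _) (TieN_nonneg _ _ _ _)) ?_ ?_ ?_
    · simpa [EucN] using lpn_add_le one_le_two (bIdx r + 1) (fun m => cf m x) fun m => cf m y
    · simpa [Psi] using lpn_add_le (one_le_px J r) (numPts r) (fun a => Gc σ J r a x)
        fun a => Gc σ J r a y
    · rw [← mul_add]
      refine mul_le_mul_of_nonneg_left ?_ (Real.sqrt_nonneg _)
      simpa [TieN] using lpn_add_le (one_le_px J (r - 1)) (numPts (r - 1) / 2)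
        (fun a => Tie σ J r a x) fun a => Tie σ J r a y
  · have h1 : EucN r (c • x) = |c| * EucN r x := by
      simpa [EucN] using lpn_smul two_pos (bIdx r + 1) c fun m => cf m x
    have h2 : Psi σ J r (c • x) = |c| * Psi σ J r x := by
      simpa [Psi] using lpn_smul (px_pos J r) (numPts r) c fun a => Gc σ J r a x
    have h3 : TieN σ J r (c • x) = |c| * TieN σ J r x := by
      simpa [TieN] using lpn_smul (px_pos J (r - 1)) (numPts (r - 1) / 2) c fun a => Tie σ J r a x
    rw [Nr, Nr, h1, h2, h3, ← Real.sqrt_sq (abs_nonneg c), ← Real.sqrt_mul (sq_nonneg _),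
      Real.sqrt_sq (abs_nonneg c)]
    congr 1; ring

/-! ### Estimates for the summands of the norm -/

theorem lpn_mono {p : ℝ} (hp : 0 < p) {n : ℕ} {u v : ℕ → ℝ} (h : ∀ i < n, |u i| ≤ |v i|) :
    lpn p n u ≤ lpn p n v := by
  unfold lpn
  refine Real.rpow_le_rpow (lpn_sum_nonneg p n u) (Finset.sum_le_sum fun i hi => ?_) (by positivity)
  exact Real.rpow_le_rpow (abs_nonneg _) (h i (Finset.mem_range.1 hi)) hp.le

theorem numPts_mono {r s : ℕ} (h : r ≤ s) : numPts r ≤ numPts s := by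
  unfold numPts
  exact Nat.mul_le_mul (Nat.pow_le_pow_right (by norm_num) h) (Nat.pow_le_pow_left h _)

theorem et_antitone {k l : ℕ} (hk : 3 ≤ k) (hkl : k ≤ l) : et l ≤ et k := by
  have h3 : Real.exp 1 ≤ k := by
    have : (3 : ℝ) ≤ k := by exact_mod_cast hk
    linarith [Real.exp_one_lt_d9]
  have hkl' : (k : ℝ) ≤ l := by exact_mod_cast hkl
  have h := Real.log_div_self_antitoneOn (Set.mem_ofPred_eq ▸ h3 : (k : ℝ) ∈ {x | Real.exp 1 ≤ x})
    (Set.mem_ofPred_eq ▸ h3.trans hkl') hkl'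
  have h2 := Real.log_pos (show (1 : ℝ) < 2 by norm_num)
  have e : ∀ m : ℕ, et m = 240000 / Real.log 2 * (Real.log m / m) := fun m => by
    unfold et; ring
  rw [e, e]
  exact mul_le_mul_of_nonneg_left h (by positivity)

theorem px_antitone {J k l : ℕ} (hJ : 3 ≤ J) (hkl : k ≤ l) : px J l ≤ px J k := by
  have := et_antitone (k := max k J) (l := max l J) (by omega) (by omega)
  unfold px; linarith

theorem Gc_projTo_of_mem (σ : Signs) (J k a : ℕ) {s : Set ℕ} (h : ∀ i < 2 ^ k, posn k i ∈ s) (x : Vb) :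
    Gc σ J k a (projTo s x) = Gc σ J k a x := by
  rw [Gc_apply, Gc_apply]
  congr 1
  exact ip_congr (fun _ _ => rfl) fun i hi => by rw [cf_projTo, if_pos (h i hi)]

theorem Gc_eq_zero (σ : Signs) (J k a : ℕ) {x : Vb} (h : ∀ i < 2 ^ k, cf (posn k i) x = 0) :
    Gc σ J k a x = 0 := by
  rw [Gc_apply, ip_congr (fun _ _ => rfl) h]
  simp [ip]

theorem Gc_projTo_of_notMem (σ : Signs) (J k a : ℕ) {s : Set ℕ} (h : ∀ i < 2 ^ k, posn k i ∉ s)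
    (x : Vb) : Gc σ J k a (projTo s x) = 0 :=
  Gc_eq_zero σ J k a fun i hi => by rw [cf_projTo, if_neg (h i hi)]

/-- The Euclidean norm of the projection to `V_r`. -/
def QV (r : ℕ) (x : Vb) : ℝ := EucN r (projTo (VIdx r) x)

theorem QV_nonneg (r : ℕ) (x : Vb) : 0 ≤ QV r x := EucN_nonneg _ _

theorem Psi_projTo (σ : Signs) (J : ℕ) {k : ℕ} {s : Set ℕ} (h : ∀ i < 2 ^ k, posn k i ∈ s) (x : Vb) :
    Psi σ J k (projTo s x) = Psi σ J k x :=
  lpn_congr fun a _ => Gc_projTo_of_mem σ J k a h x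

theorem Nr_VIdx_sq (σ : Signs) (J : ℕ) {r : ℕ} (hr : 2 ≤ r) (x : Vb) :
    Nr σ J r (projTo (VIdx r) x) ^ 2 = QV r x ^ 2 + Psi σ J r x ^ 2 + Real.log r * TieN σ J r x ^ 2 := by
  have h1 : ∀ i < 2 ^ r, posn r i ∈ VIdx r := fun i hi =>
    WIdx_subset_VIdx le_rfl (by omega) (posn_mem_WIdx (by omega) hi)
  have h2 : ∀ i < 2 ^ (r - 1), posn (r - 1) i ∈ VIdx r := fun i hi =>
    WIdx_subset_VIdx (by omega) (by omega) (posn_mem_WIdx (by omega) hi)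
  rw [Nr_sq, Psi_projTo σ J h1, QV]
  congr 3
  refine lpn_congr fun a _ => ?_
  simp only [Tie, LinearMap.sub_apply]
  rw [Gc_projTo_of_mem σ J _ _ h1, Gc_projTo_of_mem σ J _ _ h2]

theorem lpn_even_le (σ : Signs) (J : ℕ) {k : ℕ} (x : Vb) :
    lpn (px J k) (numPts k / 2) (fun a => Gc σ J k (2 * a) x) ≤ Psi σ J k x :=
  lpn_comp_le (px_pos J k) (f := fun a => 2 * a) (fun a b h => by simpa using h)
    (fun i hi => by show 2 * i < _; omega) fun a => Gc σ J k a x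

theorem lpn_odd_le (σ : Signs) {J : ℕ} (hJ : 3 ≤ J) {r : ℕ} (x : Vb) :
    lpn (px J (r - 1)) (numPts (r - 1) / 2) (fun a => Gc σ J r (2 * a + 1) x) ≤ Psi σ J r x :=
  (lpn_antitone (px_pos _ _) (px_antitone hJ (Nat.sub_le r 1)) _ _).trans <|
    lpn_comp_le (px_pos J r) (f := fun a => 2 * a + 1) (fun a b h => by simpa using h)
    (fun i hi => by
      have := numPts_mono (Nat.sub_le r 1)
      show 2 * i + 1 < _; omega) fun a => Gc σ J r a x

theorem TieN_le (σ : Signs) {J : ℕ} (hJ : 3 ≤ J) (r : ℕ) (x : Vb) :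
    TieN σ J r x ≤ Psi σ J (r - 1) x + Psi σ J r x :=
  (lpn_sub_le (one_le_px _ _) _ (fun a => Gc σ J (r - 1) (2 * a) x)
    fun a => Gc σ J r (2 * a + 1) x).trans
    (add_le_add (lpn_even_le σ J x) (lpn_odd_le σ hJ x))

theorem EucN_WIdx_le (r : ℕ) (x : Vb) : EucN r (projTo (WIdx r) x) ≤ QV r x := by
  refine lpn_mono two_pos fun m _ => ?_
  rw [cf_projTo, cf_projTo]
  split_ifs with h1 h2 h2
  · rfl
  · exact absurd (WIdx_subset_VIdx le_rfl (by omega) h1) h2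
  · simp
  · simp

theorem EucN_succ_WIdx (r : ℕ) (x : Vb) :
    EucN (r + 1) (projTo (WIdx r) x) = EucN r (projTo (WIdx r) x) := by
  have : ssq (bIdx (r + 1) + 1) (fun m => cf m (projTo (WIdx r) x)) =
      ssq (bIdx r + 1) (fun m => cf m (projTo (WIdx r) x)) := by
    symm
    refine Finset.sum_subset (Finset.range_mono ?_) fun m _ hm => ?_
    · have : bIdx r ≤ bIdx (r + 1) := Nat.pow_le_pow_right (by norm_num) (by omega)
      omega
    · show cf m _ ^ 2 = 0
      rw [cf_projTo, if_neg, sq, zero_mul]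
      intro h
      have := h.2
      rw [Finset.mem_range] at hm
      omega
  unfold EucN
  rw [← Real.sqrt_sq (lpn_nonneg 2 _ _), lpn_two_sq, this, ← lpn_two_sq,
    Real.sqrt_sq (lpn_nonneg 2 _ _)]

theorem Nr_WIdx_sq_le (σ : Signs) {J : ℕ} (hJ : 3 ≤ J) {r : ℕ} (hr : 2 ≤ r) (x : Vb) :
    Nr σ J r (projTo (WIdx r) x) ^ 2 ≤ QV r x ^ 2 + (1 + Real.log r) * Psi σ J r x ^ 2 := by
  have h1 : ∀ i < 2 ^ r, posn r i ∈ WIdx r := fun i hi => posn_mem_WIdx (by omega) hi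
  have h2 : ∀ i < 2 ^ (r - 1), posn (r - 1) i ∉ WIdx r := fun i hi =>
    notMem_WIdx_of_mem_WIdx (posn_mem_WIdx (by omega) hi) (by omega)
  have h3 : TieN σ J r (projTo (WIdx r) x) ≤ Psi σ J r x := by
    have : TieN σ J r (projTo (WIdx r) x) =
        lpn (px J (r - 1)) (numPts (r - 1) / 2) (fun a => -Gc σ J r (2 * a + 1) x) := by
      refine lpn_congr fun a _ => ?_
      simp only [Tie, LinearMap.sub_apply]
      rw [Gc_projTo_of_mem σ J _ _ h1, Gc_projTo_of_notMem σ J _ _ h2, zero_sub]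
    rw [this, lpn_neg]
    exact lpn_odd_le σ hJ x
  rw [Nr_sq, Psi_projTo σ J h1]
  have h4 := pow_le_pow_left₀ (EucN_nonneg _ _) (EucN_WIdx_le r x) 2
  have h5 := mul_le_mul_of_nonneg_left (pow_le_pow_left₀ (TieN_nonneg _ _ _ _) h3 2)
    (Real.log_natCast_nonneg r)
  linarith

theorem Nr_succ_WIdx_sq_le (σ : Signs) (J : ℕ) {r : ℕ} (hr : 2 ≤ r) (x : Vb) :
    Nr σ J (r + 1) (projTo (WIdx r) x) ^ 2 ≤ QV r x ^ 2 + Real.log (r + 1 : ℕ) * Psi σ J r x ^ 2 := by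
  have h1 : ∀ i < 2 ^ r, posn r i ∈ WIdx r := fun i hi => posn_mem_WIdx (by omega) hi
  have h2 : ∀ i < 2 ^ (r + 1), posn (r + 1) i ∉ WIdx r := fun i hi =>
    notMem_WIdx_of_mem_WIdx (posn_mem_WIdx (by omega) hi) (by omega)
  have h3 : TieN σ J (r + 1) (projTo (WIdx r) x) ≤ Psi σ J r x := by
    refine le_trans (le_of_eq ?_) (lpn_even_le σ J x)
    refine lpn_congr fun a _ => ?_
    simp only [Tie, LinearMap.sub_apply, Nat.add_sub_cancel]
    rw [Gc_projTo_of_mem σ J _ _ h1, Gc_projTo_of_notMem σ J _ _ h2, sub_zero]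
  have h6 : Psi σ J (r + 1) (projTo (WIdx r) x) = 0 :=
    lpn_zero (px_pos _ _) _ fun a _ => Gc_projTo_of_notMem σ J _ _ h2 x
  rw [Nr_sq, h6, EucN_succ_WIdx]
  have h4 := pow_le_pow_left₀ (EucN_nonneg _ _) (EucN_WIdx_le r x) 2
  have h5 := mul_le_mul_of_nonneg_left (pow_le_pow_left₀ (TieN_nonneg _ _ _ _) h3 2)
    (Real.log_natCast_nonneg (r + 1))
  linarith

/-- The `r`-th summand of the square of the norm. -/
def Sm (σ : Signs) (J r : ℕ) (x : Vb) : ℝ :=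
  if 6 ≤ r then
    Nr σ J r (projTo (VIdx r) x) ^ 2 + (1 / Real.log r) *
      (Nr σ J r (projTo (WIdx r) x) ^ 2 + Nr σ J (r + 1) (projTo (WIdx r) x) ^ 2)
  else 0

theorem one_le_log {r : ℕ} (hr : 3 ≤ r) : 1 ≤ Real.log r := by
  rw [Real.le_log_iff_exp_le (by positivity)]
  have : (3 : ℝ) ≤ r := by exact_mod_cast hr
  linarith [Real.exp_one_lt_d9]

theorem log_succ_le {r : ℕ} (hr : 3 ≤ r) : Real.log (r + 1 : ℕ) ≤ 2 * Real.log r := by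
  rw [show (2 : ℝ) * Real.log r = Real.log ((r : ℝ) ^ 2) by rw [Real.log_pow]; norm_num]
  refine Real.log_le_log (by positivity) ?_
  have : (3 : ℝ) ≤ r := by exact_mod_cast hr
  push_cast
  nlinarith

theorem Sm_nonneg (σ : Signs) (J r : ℕ) (x : Vb) : 0 ≤ Sm σ J r x := by
  unfold Sm
  split_ifs with h
  · have := one_le_log (show 3 ≤ r by omega)
    positivity
  · rfl

theorem le_Sm (σ : Signs) (J : ℕ) {r : ℕ} (hr : 6 ≤ r) (x : Vb) :
    QV r x ^ 2 + Psi σ J r x ^ 2 + Real.log r * TieN σ J r x ^ 2 ≤ Sm σ J r x := by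
  have := one_le_log (show 3 ≤ r by omega)
  rw [Sm, if_pos hr, ← Nr_VIdx_sq σ J (by omega) x]
  refine le_add_of_nonneg_right (by positivity)

theorem Sm_le (σ : Signs) {J : ℕ} (hJ : 3 ≤ J) {r : ℕ} (hr : 6 ≤ r) (x : Vb) :
    Sm σ J r x ≤ 3 * QV r x ^ 2 + 5 * Psi σ J r x ^ 2 + Real.log r * TieN σ J r x ^ 2 := by
  have h1 := one_le_log (show 3 ≤ r by omega)
  have h2 := log_succ_le (show 3 ≤ r by omega)
  have h3 := Nr_WIdx_sq_le σ hJ (show 2 ≤ r by omega) x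
  have h4 := Nr_succ_WIdx_sq_le σ J (show 2 ≤ r by omega) x
  rw [Sm, if_pos hr, Nr_VIdx_sq σ J (by omega) x]
  have h5 : (1 / Real.log r) *
      (Nr σ J r (projTo (WIdx r) x) ^ 2 + Nr σ J (r + 1) (projTo (WIdx r) x) ^ 2) ≤
      2 * QV r x ^ 2 + 4 * Psi σ J r x ^ 2 := by
    rw [one_div, inv_mul_le_iff₀ (by linarith)]
    have a1 := mul_le_mul_of_nonneg_right h1 (sq_nonneg (QV r x))
    have a2 := mul_le_mul_of_nonneg_right h2 (sq_nonneg (Psi σ J r x))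
    have a3 := mul_le_mul_of_nonneg_right h1 (sq_nonneg (Psi σ J r x))
    linarith
  linarith

theorem Sm_le_log (σ : Signs) {J : ℕ} (hJ : 3 ≤ J) {r : ℕ} (hr : 6 ≤ r) (x : Vb) :
    Sm σ J r x ≤ 7 * Real.log r * (QV r x ^ 2 + Psi σ J (r - 1) x ^ 2 + Psi σ J r x ^ 2) := by
  have h1 := one_le_log (show 3 ≤ r by omega)
  have h2 := Sm_le σ hJ hr x
  have h3 := pow_le_pow_left₀ (TieN_nonneg _ _ _ _) (TieN_le σ hJ r x) 2
  have h4 : TieN σ J r x ^ 2 ≤ 2 * Psi σ J (r - 1) x ^ 2 + 2 * Psi σ J r x ^ 2 := by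
    nlinarith [sq_nonneg (Psi σ J (r - 1) x - Psi σ J r x)]
  have h5 := mul_le_mul_of_nonneg_left h4 (show 0 ≤ Real.log r by linarith)
  have a1 := mul_le_mul_of_nonneg_right h1 (sq_nonneg (QV r x))
  have a2 := mul_le_mul_of_nonneg_right h1 (sq_nonneg (Psi σ J (r - 1) x))
  have a3 := mul_le_mul_of_nonneg_right h1 (sq_nonneg (Psi σ J r x))
  have b1 := mul_nonneg (show 0 ≤ Real.log r by linarith) (sq_nonneg (QV r x))
  have b2 := mul_nonneg (show 0 ≤ Real.log r by linarith) (sq_nonneg (Psi σ J (r - 1) x))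
  nlinarith

theorem exists_Sm_eq_zero (σ : Signs) (J : ℕ) (x : Vb) : ∃ R, ∀ r ≥ R, Sm σ J r x = 0 := by
  obtain ⟨B, hB⟩ : ∃ B : ℕ, ∀ i, x i ≠ 0 → (i : ℕ) ≤ B := by
    refine ⟨x.support.sup fun i => (i : ℕ), fun i hi => ?_⟩
    exact Finset.le_sup (f := fun i : {i : ℕ // aIdx 6 < i} => (i : ℕ)) (Finsupp.mem_support_iff.2 hi)
  refine ⟨B + 2, fun r hr => ?_⟩
  have h1 : B ≤ aIdx r := by
    have : r - 2 < 10 ^ (r - 2) := Nat.lt_pow_self (by norm_num)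
    unfold aIdx; omega
  have h2 := aIdx_mono (show r ≤ r + 1 by omega)
  have e1 : projTo (VIdx r) x = 0 := projTo_eq_zero fun i hi h => by
    have := h.1; have := hB i hi; omega
  have e2 : projTo (WIdx r) x = 0 := projTo_eq_zero fun i hi h => by
    have := h.1; have := hB i hi; omega
  simp [Sm, e1, e2, Nr_zero]

theorem VNorm_sq_eq (σ : Signs) (J : ℕ) (x : Vb) : ∃ R₀, ∀ R ≥ R₀,
    VNorm (Nr σ J) x ^ 2 = ∑ r ∈ Finset.range R, Sm σ J r x := by
  obtain ⟨R₀, h⟩ := exists_Sm_eq_zero σ J x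
  refine ⟨R₀, fun R hR => ?_⟩
  rw [VNorm, Real.sq_sqrt]
  · refine tsum_eq_sum (f := fun r => Sm σ J r x) fun r hr => h r ?_
    rw [Finset.mem_range] at hr
    omega
  · exact tsum_nonneg fun r => Sm_nonneg σ J r x

theorem VNorm_nonneg (N : ℕ → Vb → ℝ) (x : Vb) : 0 ≤ VNorm N x := Real.sqrt_nonneg _

theorem sum_Sm_le (σ : Signs) (J : ℕ) (x : Vb) (F : Finset ℕ) :
    ∑ r ∈ F, Sm σ J r x ≤ VNorm (Nr σ J) x ^ 2 := by
  obtain ⟨R₀, h⟩ := VNorm_sq_eq σ J x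
  obtain ⟨M, hM⟩ := F.exists_nat_subset_range
  rw [h (max R₀ M) (le_max_left _ _)]
  refine Finset.sum_le_sum_of_subset_of_nonneg (hM.trans (Finset.range_mono (le_max_right _ _)))
    fun _ _ _ => Sm_nonneg _ _ _ _

theorem Sm_le_VNorm_sq (σ : Signs) (J r : ℕ) (x : Vb) : Sm σ J r x ≤ VNorm (Nr σ J) x ^ 2 := by
  simpa using sum_Sm_le σ J x {r}

/-! ### Consequences for the norm -/

theorem ssq_cf_le_QV {k : ℕ} (hk : 1 ≤ k) (x : Vb) :
    ssq (2 ^ k) (fun i => cf (posn k i) x) ≤ QV k x ^ 2 := by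
  have h := lpn_comp_le two_pos (posn_injective k) (m := 2 ^ k) (n := bIdx k + 1)
    (fun i hi => by have := (posn_mem_WIdx hk hi).2; omega) fun m => cf m (projTo (VIdx k) x)
  rw [lpn_congr (v := fun i => cf (posn k i) x) fun i hi => by
    rw [cf_projTo, if_pos (WIdx_subset_VIdx le_rfl (by omega) (posn_mem_WIdx hk hi))]] at h
  rw [← lpn_two_sq]
  exact pow_le_pow_left₀ (lpn_nonneg _ _ _) h 2

theorem QV_sq_le (σ : Signs) (J : ℕ) {k : ℕ} (hk : 6 ≤ k) (x : Vb) : QV k x ^ 2 ≤ Sm σ J k x := by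
  have h1 := le_Sm σ J hk x
  have h2 := one_le_log (show 3 ≤ k by omega)
  have h3 := mul_nonneg (show 0 ≤ Real.log k by linarith) (sq_nonneg (TieN σ J k x))
  nlinarith [sq_nonneg (Psi σ J k x)]

theorem ssq_cf_le (σ : Signs) (J : ℕ) {k : ℕ} (hk : 6 ≤ k) (x : Vb) :
    ssq (2 ^ k) (fun i => cf (posn k i) x) ≤ VNorm (Nr σ J) x ^ 2 :=
  (ssq_cf_le_QV (by omega) x).trans ((QV_sq_le σ J hk x).trans (Sm_le_VNorm_sq σ J k x))

theorem abs_cf_le (σ : Signs) (J : ℕ) {k i : ℕ} (hk : 6 ≤ k) (hi : i < 2 ^ k) (x : Vb) :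
    |cf (posn k i) x| ≤ VNorm (Nr σ J) x := by
  refine abs_le_of_sq_le_sq ?_ (VNorm_nonneg _ _)
  exact (Finset.single_le_sum (f := fun i => cf (posn k i) x ^ 2) (fun _ _ => sq_nonneg _)
    (Finset.mem_range.2 hi)).trans (ssq_cf_le σ J hk x)

theorem Psi_le_VNorm (σ : Signs) (J : ℕ) {k : ℕ} (hk : 6 ≤ k) (x : Vb) :
    Psi σ J k x ≤ VNorm (Nr σ J) x := by
  refine le_of_sq_le_sq ?_ (VNorm_nonneg _ _)
  refine le_trans ?_ ((le_Sm σ J hk x).trans (Sm_le_VNorm_sq σ J k x))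
  have h2 := one_le_log (show 3 ≤ k by omega)
  have h3 := mul_nonneg (show 0 ≤ Real.log k by linarith) (sq_nonneg (TieN σ J k x))
  nlinarith [sq_nonneg (QV k x)]

theorem log_mul_TieN_sq_le (σ : Signs) (J : ℕ) {k : ℕ} (hk : 6 ≤ k) (x : Vb) :
    Real.log k * TieN σ J k x ^ 2 ≤ VNorm (Nr σ J) x ^ 2 := by
  refine le_trans ?_ ((le_Sm σ J hk x).trans (Sm_le_VNorm_sq σ J k x))
  nlinarith [sq_nonneg (QV k x), sq_nonneg (Psi σ J k x)]

/-- The vector with coefficients `u` at the distinguished coordinates of level `j`. -/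
def zv (j : ℕ) (u : ℕ → ℝ) : Vb := ∑ i ∈ Finset.range (2 ^ j), u i • eb (posn j i)

theorem cf_zv_posn {j i : ℕ} (hj : 5 ≤ j) (hi : i < 2 ^ j) (u : ℕ → ℝ) : cf (posn j i) (zv j u) = u i := by
  rw [zv, map_sum, Finset.sum_eq_single i]
  · rw [map_smul, cf_eb, if_pos ⟨rfl, lt_posn hj⟩]; simp
  · intro b _ hb
    rw [map_smul, cf_eb, if_neg fun h => hb (posn_injective j h.1).symm]; simp
  · intro h
    exact absurd (Finset.mem_range.2 hi) h

theorem cf_zv_of_notMem {j m : ℕ} (hj : 1 ≤ j) (hm : m ∉ WIdx j) (u : ℕ → ℝ) : cf m (zv j u) = 0 := by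
  rw [zv, map_sum]
  refine Finset.sum_eq_zero fun i hi => ?_
  rw [map_smul, cf_eb, if_neg, smul_zero]
  exact fun h => hm (h.1 ▸ posn_mem_WIdx hj (Finset.mem_range.1 hi))

/-- The `ℓ_p` norm of the evaluations of `zv j u`. -/
def phi (σ : Signs) (J j : ℕ) (u : ℕ → ℝ) : ℝ :=
  lpn (px J j) (numPts j) fun a => Dc J j * ip (2 ^ j) (gv σ j a) u

theorem phi_nonneg (σ : Signs) (J j : ℕ) (u : ℕ → ℝ) : 0 ≤ phi σ J j u := lpn_nonneg _ _ _

theorem Gc_zv (σ : Signs) (J : ℕ) {j : ℕ} (hj : 5 ≤ j) (a : ℕ) (u : ℕ → ℝ) :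
    Gc σ J j a (zv j u) = Dc J j * ip (2 ^ j) (gv σ j a) u := by
  rw [Gc_apply, ip_congr (fun _ _ => rfl) fun i hi => cf_zv_posn hj hi u]

theorem Psi_zv (σ : Signs) (J : ℕ) {j : ℕ} (hj : 5 ≤ j) (u : ℕ → ℝ) :
    Psi σ J j (zv j u) = phi σ J j u :=
  lpn_congr fun a _ => Gc_zv σ J hj a u

theorem Gc_zv_of_ne (σ : Signs) (J : ℕ) {j k : ℕ} (hj : 1 ≤ j) (hk : 1 ≤ k) (h : k ≠ j) (a : ℕ)
    (u : ℕ → ℝ) : Gc σ J k a (zv j u) = 0 :=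
  Gc_eq_zero σ J k a fun _ hi =>
    cf_zv_of_notMem hj (notMem_WIdx_of_mem_WIdx (posn_mem_WIdx hk hi) h.symm) u

theorem Psi_zv_of_ne (σ : Signs) (J : ℕ) {j k : ℕ} (hj : 1 ≤ j) (hk : 1 ≤ k) (h : k ≠ j)
    (u : ℕ → ℝ) : Psi σ J k (zv j u) = 0 :=
  lpn_zero (px_pos _ _) _ fun a _ => Gc_zv_of_ne σ J hj hk h a u

theorem ssq_cf_zv_le {j : ℕ} (hj : 5 ≤ j) (n : ℕ) (u : ℕ → ℝ) :
    ssq n (fun m => cf m (zv j u)) ≤ ssq (2 ^ j) u := by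
  have h1 : ssq n (fun m => cf m (zv j u)) ≤
      ∑ m ∈ (Finset.range (2 ^ j)).image (posn j), cf m (zv j u) ^ 2 := by
    unfold ssq
    rw [← Finset.sum_filter_add_sum_filter_not (Finset.range n)
      (fun m => m ∈ (Finset.range (2 ^ j)).image (posn j))]
    rw [Finset.sum_eq_zero (s := {m ∈ Finset.range n | m ∉ (Finset.range (2 ^ j)).image (posn j)}),
      add_zero]
    · exact Finset.sum_le_sum_of_subset_of_nonneg (fun m hm => (Finset.mem_filter.1 hm).2)
        fun _ _ _ => sq_nonneg _
    · intro m hm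
      have : cf m (zv j u) = 0 := by
        rw [zv, map_sum]
        refine Finset.sum_eq_zero fun i hi => ?_
        rw [map_smul, cf_eb, if_neg, smul_zero]
        intro h
        exact (Finset.mem_filter.1 hm).2 (Finset.mem_image.2 ⟨i, hi, h.1.symm⟩)
      show cf m (zv j u) ^ 2 = 0
      rw [this, sq, zero_mul]
  refine h1.trans (le_of_eq ?_)
  rw [Finset.sum_image (posn_injective j).injOn]
  exact ssq_congr fun i hi => cf_zv_posn hj hi u

theorem QV_sq_le_ssq (r n : ℕ) (x : Vb) (hn : bIdx r + 1 ≤ n) :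
    QV r x ^ 2 ≤ ssq n (fun m => cf m x) := by
  rw [QV, EucN, lpn_two_sq]
  unfold ssq
  refine (Finset.sum_le_sum fun m _ => ?_).trans (Finset.sum_le_sum_of_subset_of_nonneg
    (Finset.range_mono hn) fun _ _ _ => sq_nonneg _)
  show cf m _ ^ 2 ≤ cf m x ^ 2
  rw [cf_projTo]
  split_ifs
  · rfl
  · rw [zero_pow two_ne_zero]
    positivity

theorem QV_zv_sq_le {j : ℕ} (hj : 5 ≤ j) (r : ℕ) (u : ℕ → ℝ) : QV r (zv j u) ^ 2 ≤ ssq (2 ^ j) u :=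
  (QV_sq_le_ssq r _ _ le_rfl).trans (ssq_cf_zv_le hj _ u)

theorem QV_zv_of_ne {j r : ℕ} (hj : 1 ≤ j) (h1 : r ≠ j) (h2 : r ≠ j + 1) (u : ℕ → ℝ) :
    QV r (zv j u) = 0 :=
  lpn_zero two_pos _ fun m _ => by
    rw [cf_projTo]
    split_ifs with h
    · exact cf_zv_of_notMem hj (fun hm => notMem_VIdx_of_mem_WIdx hm h1 h2 h) u
    · rfl

theorem VNorm_zv_sq_le (σ : Signs) {J : ℕ} (hJ : 3 ≤ J) {j : ℕ} (hj : 6 ≤ j) (u : ℕ → ℝ) :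
    VNorm (Nr σ J) (zv j u) ^ 2 ≤ 14 * Real.log (j + 1 : ℕ) * (ssq (2 ^ j) u + phi σ J j u ^ 2) := by
  obtain ⟨R₀, h⟩ := VNorm_sq_eq σ J (zv j u)
  have hR : ({j, j + 1} : Finset ℕ) ⊆ Finset.range (max R₀ (j + 2)) := by
    intro r hr
    simp only [Finset.mem_insert, Finset.mem_singleton] at hr
    rw [Finset.mem_range]
    have := le_max_right R₀ (j + 2)
    omega
  rw [h (max R₀ (j + 2)) (le_max_left _ _), ← Finset.sum_subset hR, Finset.sum_pair (by omega)]
  · have h1 := Sm_le_log σ hJ hj (zv j u)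
    have h2 := Sm_le_log σ hJ (show 6 ≤ j + 1 by omega) (zv j u)
    rw [Psi_zv_of_ne σ J (by omega) (by omega) (by omega), Psi_zv σ J (by omega)] at h1
    rw [Nat.add_sub_cancel, Psi_zv_of_ne σ J (k := j + 1) (by omega) (by omega) (by omega),
      Psi_zv σ J (by omega)] at h2
    have h3 : Real.log j ≤ Real.log (j + 1 : ℕ) :=
      Real.log_le_log (by positivity) (by exact_mod_cast Nat.le_succ j)
    have h4 := one_le_log (show 3 ≤ j by omega)
    have h5 := QV_zv_sq_le (show 5 ≤ j by omega) j u
    have h6 := QV_zv_sq_le (show 5 ≤ j by omega) (j + 1) u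
    have h7 : 7 * Real.log j * (QV j (zv j u) ^ 2 + 0 ^ 2 + phi σ J j u ^ 2) ≤
        7 * Real.log (j + 1 : ℕ) * (ssq (2 ^ j) u + phi σ J j u ^ 2) :=
      mul_le_mul (by linarith) (by linarith) (by positivity) (by linarith)
    have h8 : 7 * Real.log (j + 1 : ℕ) * (QV (j + 1) (zv j u) ^ 2 + phi σ J j u ^ 2 + 0 ^ 2) ≤
        7 * Real.log (j + 1 : ℕ) * (ssq (2 ^ j) u + phi σ J j u ^ 2) :=
      mul_le_mul_of_nonneg_left (by linarith) (by linarith)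
    linarith
  · intro r _ hr
    simp only [Finset.mem_insert, Finset.mem_singleton, not_or] at hr
    by_cases h6 : 6 ≤ r
    · refine le_antisymm ?_ (Sm_nonneg _ _ _ _)
      have := Sm_le_log σ hJ h6 (zv j u)
      rwa [QV_zv_of_ne (by omega) hr.1 hr.2, Psi_zv_of_ne σ J (by omega) (by omega) (by omega),
        Psi_zv_of_ne σ J (by omega) (by omega) hr.1, show (0 : ℝ) ^ 2 + 0 ^ 2 + 0 ^ 2 = 0 by norm_num,
        mul_zero] at this
    · simp [Sm, h6]

theorem VNorm_zv_le (σ : Signs) {J : ℕ} (hJ : 3 ≤ J) {j : ℕ} (hj : 14 ≤ j) (u : ℕ → ℝ) :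
    VNorm (Nr σ J) (zv j u) ≤ j * (√(ssq (2 ^ j) u) + phi σ J j u) := by
  refine le_of_sq_le_sq ?_ (by have := phi_nonneg σ J j u; positivity)
  refine (VNorm_zv_sq_le σ hJ (by omega) u).trans ?_
  have h1 : Real.log (j + 1 : ℕ) ≤ j := by
    have := Real.log_le_sub_one_of_pos (show (0 : ℝ) < (j + 1 : ℕ) by positivity)
    push_cast at this ⊢
    linarith
  have h2 : (14 : ℝ) ≤ j := by exact_mod_cast hj
  have h3 := ssq_nonneg (2 ^ j) u
  have h4 := phi_nonneg σ J j u
  calc 14 * Real.log (j + 1 : ℕ) * (ssq (2 ^ j) u + phi σ J j u ^ 2)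
      ≤ (j * j) * (ssq (2 ^ j) u + phi σ J j u ^ 2) :=
        mul_le_mul_of_nonneg_right (mul_le_mul h2 h1 (Real.log_natCast_nonneg _) (by linarith))
          (by positivity)
    _ ≤ (j * j) * (√(ssq (2 ^ j) u) + phi σ J j u) ^ 2 := by
        refine mul_le_mul_of_nonneg_left ?_ (by positivity)
        nlinarith [Real.sq_sqrt h3, Real.sqrt_nonneg (ssq (2 ^ j) u),
          mul_nonneg (Real.sqrt_nonneg (ssq (2 ^ j) u)) h4]
    _ = _ := by ring

/-! ### Combinations of few points -/

theorem off_sum_le : ∃ N : ℕ, ∀ (σ : Signs) (J : ℕ), Typical (gv σ) J → ∀ j, N ≤ j → J ≤ j →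
    ∀ F ⊆ Finset.range (numPts j), F.card ≤ 2 ^ (j / 4) → ∀ c : ℕ → ℝ,
    ssq (2 ^ j) (fun i => ∑ a ∈ F, c a * gv σ j a i) ≤ 2 * ∑ a ∈ F, c a ^ 2 ∧
    ∑ b ∈ F, ip (2 ^ j) (gv σ j b) (fun i => ∑ a ∈ F, c a * gv σ j a i) ^ 2 ≤
      4 * ∑ a ∈ F, c a ^ 2 ∧
    ∑ b ∈ Finset.range (numPts j) \ F,
      |ip (2 ^ j) (gv σ j b) (fun i => ∑ a ∈ F, c a * gv σ j a i)| ^ (2 + et j) ≤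
      ((j : ℝ) ^ 3)⁻¹ * √(∑ a ∈ F, c a ^ 2) ^ (2 + et j) := by
  obtain ⟨N, hN⟩ := Filter.eventually_atTop.1 (eventually_pow_le_two_pow 64 2)
  refine ⟨4 * N + 4, fun σ J hT j hj hJ F hF hFc c => ?_⟩
  obtain ⟨q, hq⟩ : ∃ q, q = j / 4 := ⟨_, rfl⟩
  have hq1 : 4 * q ≤ j := by omega
  have hq2 : j ≤ 8 * q := by omega
  have hj1 : 1 ≤ j := by omega
  have hj1' : (1 : ℝ) ≤ j := by exact_mod_cast hj1
  rw [← hq] at hFc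
  have hsmall : (2 : ℝ) ^ q * (j * rt j) ^ 2 ≤ (((2 : ℝ) ^ q)⁻¹) ^ 2 := by
    have h1 := hN q (by omega)
    have h2 : (j : ℝ) ^ 2 ≤ 64 * (q : ℝ) ^ 2 := by
      have : (j : ℝ) ≤ 8 * q := by exact_mod_cast hq2
      nlinarith
    have h3 : (2 : ℝ) ^ (4 * q) ≤ 2 ^ j := pow_le_pow_right₀ (by norm_num) hq1
    rw [mul_pow, rt_sq, ← mul_assoc, ← div_eq_mul_inv, div_le_iff₀ (by positivity), inv_pow,
      inv_mul_eq_div, le_div_iff₀ (by positivity)]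
    calc (2 : ℝ) ^ q * (j : ℝ) ^ 2 * (2 ^ q) ^ 2 ≤ 2 ^ q * 2 ^ q * (2 ^ q) ^ 2 := by
          refine mul_le_mul_of_nonneg_right ?_ (by positivity)
          exact mul_le_mul_of_nonneg_left (h2.trans h1) (by positivity)
      _ = 2 ^ (4 * q) := by ring
      _ ≤ _ := h3
  have h2q : (1 : ℝ) ≤ 2 ^ q := one_le_pow₀ (by norm_num)
  have hFc' : (F.card : ℝ) ≤ 2 ^ q := by exact_mod_cast hFc
  have hrt := rt_pos j
  have hcard : (F.card : ℝ) * (j * rt j) ≤ 1 := by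
    refine (mul_le_mul_of_nonneg_right hFc' (by positivity)).trans ?_
    refine le_of_sq_le_sq ?_ zero_le_one
    calc ((2 : ℝ) ^ q * (j * rt j)) ^ 2 = 2 ^ q * (2 ^ q * (j * rt j) ^ 2) := by ring
      _ ≤ 2 ^ q * (((2 : ℝ) ^ q)⁻¹) ^ 2 := mul_le_mul_of_nonneg_left hsmall (by positivity)
      _ = (2 ^ q)⁻¹ := by field_simp
      _ ≤ 1 ^ 2 := by rw [one_pow]; exact inv_le_one_of_one_le₀ h2q
  have hinc := hT.incoherent j hJ
  have hs := ssq_comb_le hinc (fun b => ssq_gv σ j b) hF hcard c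
  refine ⟨hs, (sum_ip_sq_le_two hinc (fun b => ssq_gv σ j b) hF hcard _).trans (by linarith), ?_⟩
  set u : ℕ → ℝ := fun i => ∑ a ∈ F, c a * gv σ j a i with hu
  set C := √(∑ a ∈ F, c a ^ 2) with hC
  have hC0 : 0 ≤ C := Real.sqrt_nonneg _
  have hC2 : C ^ 2 = ∑ a ∈ F, c a ^ 2 := Real.sq_sqrt (Finset.sum_nonneg fun _ _ => sq_nonneg _)
  have hent : ∀ b ∈ Finset.range (numPts j) \ F, |ip (2 ^ j) (gv σ j b) u| ≤ ((2 : ℝ) ^ q)⁻¹ * C := by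
    intro b hb
    rw [Finset.mem_sdiff, Finset.mem_range] at hb
    refine abs_le_of_sq_le_sq ?_ (by positivity)
    have e : ip (2 ^ j) (gv σ j b) u = ∑ a ∈ F, c a * ip (2 ^ j) (gv σ j b) (gv σ j a) := by
      rw [ip_comm, hu, ip_sum_left]
      exact Finset.sum_congr rfl fun a _ => by rw [ip_comm]
    have e2 : ∑ a ∈ F, ip (2 ^ j) (gv σ j b) (gv σ j a) ^ 2 ≤ F.card * (j * rt j) ^ 2 := by
      rw [← nsmul_eq_mul]
      refine Finset.sum_le_card_nsmul _ _ _ fun a ha => ?_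
      refine sq_le_sq' ?_ ?_ <;>
      · have := abs_le.1 (hinc b hb.1 a (Finset.mem_range.1 (hF ha)) fun h => hb.2 (h ▸ ha))
        linarith [this.1, this.2]
    calc ip (2 ^ j) (gv σ j b) u ^ 2 ≤ (∑ a ∈ F, c a ^ 2) *
          ∑ a ∈ F, ip (2 ^ j) (gv σ j b) (gv σ j a) ^ 2 := by
          rw [e]; exact Finset.sum_mul_sq_le_sq_mul_sq _ _ _
      _ ≤ C ^ 2 * (2 ^ q * (j * rt j) ^ 2) := by
          rw [hC2]
          refine mul_le_mul_of_nonneg_left (e2.trans ?_) (Finset.sum_nonneg fun _ _ => sq_nonneg _)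
          exact mul_le_mul_of_nonneg_right hFc' (by positivity)
      _ ≤ C ^ 2 * (((2 : ℝ) ^ q)⁻¹) ^ 2 := mul_le_mul_of_nonneg_left hsmall (by positivity)
      _ = _ := by ring
  have hη := et_nonneg j
  have h1 := sum_rpow_le hη hent
  have h2 : ∑ b ∈ Finset.range (numPts j) \ F, ip (2 ^ j) (gv σ j b) u ^ 2 ≤
      (j : ℝ) ^ (cE + 2) * (2 * C ^ 2) := by
    rw [hC2]
    refine le_trans (Finset.sum_le_sum_of_subset_of_nonneg Finset.sdiff_subset
      fun _ _ _ => sq_nonneg _) ((hT.frame j hJ u).trans ?_)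
    exact mul_le_mul_of_nonneg_left hs (by positivity)
  have h3 : (((2 : ℝ) ^ q)⁻¹) ^ et j ≤ ((j : ℝ) ^ (cE + 6))⁻¹ :=
    rpow_et_le hj1 (by positivity) le_rfl (by rw [cE_eq]; omega)
  refine h1.trans ?_
  rcases hC0.eq_or_lt with h0 | h0
  · have hz : ∑ b ∈ Finset.range (numPts j) \ F, ip (2 ^ j) (gv σ j b) u ^ 2 ≤ 0 := by
      refine h2.trans (le_of_eq ?_)
      rw [← h0]; ring
    rw [le_antisymm hz (Finset.sum_nonneg fun _ _ => sq_nonneg _), mul_zero]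
    positivity
  · have hη' : (2 : ℝ) + et j ≠ 0 := by linarith
    calc (((2 : ℝ) ^ q)⁻¹ * C) ^ et j * ∑ b ∈ Finset.range (numPts j) \ F, ip (2 ^ j) (gv σ j b) u ^ 2
        ≤ (((j : ℝ) ^ (cE + 6))⁻¹ * C ^ et j) * ((j : ℝ) ^ (cE + 2) * (2 * C ^ 2)) := by
          refine mul_le_mul ?_ h2 (Finset.sum_nonneg fun _ _ => sq_nonneg _) (by positivity)
          rw [Real.mul_rpow (by positivity) hC0]
          exact mul_le_mul_of_nonneg_right h3 (by positivity)
      _ = 2 * ((j : ℝ) ^ 4)⁻¹ * (C ^ et j * C ^ 2) := by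
          rw [pow_add (j : ℝ) cE 6, pow_add (j : ℝ) cE 2]
          field_simp
      _ = 2 * ((j : ℝ) ^ 4)⁻¹ * C ^ (2 + et j) := by
          rw [Real.rpow_add h0, mul_comm (C ^ et j)]
          norm_num
      _ ≤ ((j : ℝ) ^ 3)⁻¹ * C ^ (2 + et j) := by
          refine mul_le_mul_of_nonneg_right ?_ (by positivity)
          rw [← div_eq_mul_inv, div_le_iff₀ (by positivity), pow_succ (j : ℝ) 3, ← mul_assoc,
            inv_mul_cancel₀ (by positivity), one_mul]
          have : (4 : ℝ) ≤ j := by exact_mod_cast (show 4 ≤ j by omega)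
          linarith

theorem rpow_add_rpow_le_rpow_add {a b p : ℝ} (ha : 0 ≤ a) (hb : 0 ≤ b) (hp : 1 ≤ p) :
    a ^ p + b ^ p ≤ (a + b) ^ p := by
  lift a to NNReal using ha
  lift b to NNReal using hb
  exact_mod_cast NNReal.add_rpow_le_rpow_add a b hp

theorem px_of_le {J j : ℕ} (h : J ≤ j) : px J j = 2 + et j := by rw [px, max_eq_left h]

theorem Dc_of_le {J j : ℕ} (h : J ≤ j) : Dc J j = (j : ℝ) ^ dE := by rw [Dc, if_pos h]

theorem Dc_nonneg (J j : ℕ) : 0 ≤ Dc J j := by unfold Dc; positivity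

theorem phi_eq (σ : Signs) (J j : ℕ) (u : ℕ → ℝ) :
    phi σ J j u = Dc J j * lpn (px J j) (numPts j) (fun a => ip (2 ^ j) (gv σ j a) u) := by
  rw [phi, lpn_smul (px_pos J j), abs_of_nonneg (Dc_nonneg J j)]

/-- The properties of the points of level `j` used in the estimates of the norm. -/
structure Spread (σ : Signs) (J j : ℕ) : Prop where
  comb : ∀ F ⊆ Finset.range (numPts j), F.card ≤ 2 ^ (j / 4) → ∀ c : ℕ → ℝ,
    √(ssq (2 ^ j) (fun i => ∑ a ∈ F, c a * gv σ j a i)) ≤ 2 * √(∑ a ∈ F, c a ^ 2) ∧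
    phi σ J j (fun i => ∑ a ∈ F, c a * gv σ j a i) ≤ 3 * Dc J j * √(∑ a ∈ F, c a ^ 2)
  off : ∀ a < numPts j, ∑ b ∈ (Finset.range (numPts j)).erase a,
    |ip (2 ^ j) (gv σ j b) (gv σ j a)| ^ px J j ≤ ((j : ℝ) ^ 3)⁻¹
  unit : ∀ i < 2 ^ j, phi σ J j (fun i' => if i' = i then 1 else 0) ≤ 1

theorem exists_spread : ∃ N : ℕ, ∀ (σ : Signs) (J : ℕ), Typical (gv σ) J → ∀ j, N ≤ j → J ≤ j →
    Spread σ J j := by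
  obtain ⟨N, hN⟩ := off_sum_le
  obtain ⟨N', hN'⟩ := Filter.eventually_atTop.1 eventually_et_le_one
  refine ⟨max (N + 4) N', fun σ J hT j hj hJ => ?_⟩
  simp only [max_le_iff] at hj
  have hj1 : 1 ≤ j := by omega
  have hj1' : (1 : ℝ) ≤ j := by exact_mod_cast hj1
  have hη := et_nonneg j
  have hη1 := hN' j hj.2
  refine ⟨fun F hF hFc c => ?_, fun a ha => ?_, fun i hi => ?_⟩
  · obtain ⟨h1, h2, h3⟩ := hN σ J hT j (by omega) hJ F hF hFc c
    set u : ℕ → ℝ := fun i => ∑ a ∈ F, c a * gv σ j a i with hu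
    set C := √(∑ a ∈ F, c a ^ 2) with hC
    have hC0 : 0 ≤ C := Real.sqrt_nonneg _
    have hC2 : C ^ 2 = ∑ a ∈ F, c a ^ 2 := Real.sq_sqrt (Finset.sum_nonneg fun _ _ => sq_nonneg _)
    rw [← hC2] at h1 h2
    refine ⟨Real.sqrt_le_iff.2 ⟨by positivity, by nlinarith⟩, ?_⟩
    rw [phi_eq, mul_right_comm, mul_comm]
    refine mul_le_mul_of_nonneg_right (lpn_le_of_sum_le (px_pos J j) (by positivity) ?_) (Dc_nonneg J j)
    rw [px_of_le hJ, ← Finset.sum_sdiff hF]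
    have h4 : ∑ b ∈ F, |ip (2 ^ j) (gv σ j b) u| ^ (2 + et j) ≤ (2 * C) ^ (2 + et j) := by
      have hm : ∀ b ∈ F, |ip (2 ^ j) (gv σ j b) u| ≤ 2 * C := fun b hb => by
        refine abs_le_of_sq_le_sq ?_ (by positivity)
        have := Finset.single_le_sum (f := fun b => ip (2 ^ j) (gv σ j b) u ^ 2)
          (fun _ _ => sq_nonneg _) hb
        linarith
      refine (sum_rpow_le hη hm).trans ?_
      refine (mul_le_mul_of_nonneg_left h2 (by positivity)).trans (le_of_eq ?_)
      rw [add_comm, Real.rpow_add_of_nonneg (by positivity) hη (by norm_num), Real.rpow_two]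
      ring
    have h5 : ((j : ℝ) ^ 3)⁻¹ * C ^ (2 + et j) ≤ C ^ (2 + et j) :=
      mul_le_of_le_one_left (by positivity) (inv_le_one_of_one_le₀ (one_le_pow₀ hj1'))
    have h6 := rpow_add_rpow_le_rpow_add hC0 (show 0 ≤ 2 * C by positivity)
      (show 1 ≤ 2 + et j by linarith)
    rw [show C + 2 * C = 3 * C by ring] at h6
    linarith
  · have h := (hN σ J hT j (by omega) hJ {a} (by simpa using ha) (by simpa using Nat.one_le_two_pow)
      fun _ => 1).2.2
    simp only [Finset.sum_singleton, one_mul, one_pow, Real.sqrt_one, Real.one_rpow, mul_one] at h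
    rwa [px_of_le hJ, ← Finset.sdiff_singleton_eq_erase]
  · have e : ∀ b, ip (2 ^ j) (gv σ j b) (fun i' => if i' = i then 1 else 0) = gv σ j b i := fun b => by
      simp [ip, hi]
    refine lpn_le_of_sum_le (px_pos J j) zero_le_one ?_
    have hg : ∀ b, |gv σ j b i| = rt j := fun b => by
      rw [← abs_of_pos (rt_pos j)]
      exact (sq_eq_sq_iff_abs_eq_abs _ _).1 (gv_sq σ j b i)
    have hrt : rt j ≤ ((2 : ℝ) ^ (j / 2))⁻¹ := by
      refine inv_anti₀ (by positivity) (Real.le_sqrt_of_sq_le ?_)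
      rw [← pow_mul]
      exact pow_le_pow_right₀ (by norm_num) (by omega)
    have h3 : rt j ^ et j ≤ ((j : ℝ) ^ (3 * dE + cE))⁻¹ :=
      rpow_et_le hj1 (rt_pos j).le hrt (by rw [cE_eq, dE_eq]; omega)
    simp_rw [e, abs_mul, hg, abs_of_nonneg (Dc_nonneg J j)]
    rw [Finset.sum_const, Finset.card_range, nsmul_eq_mul, Real.one_rpow, px_of_le hJ, Dc_of_le hJ,
      Real.mul_rpow (by positivity) (rt_pos j).le,
      Real.rpow_add_of_nonneg (x := rt j) (rt_pos j).le (by norm_num) hη]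
    have h4 : ((j : ℝ) ^ dE) ^ (2 + et j) ≤ ((j : ℝ) ^ dE) ^ 3 := by
      rw [← Real.rpow_natCast _ 3]
      refine Real.rpow_le_rpow_of_exponent_le (one_le_pow₀ hj1') ?_
      push_cast; linarith
    have hrt0 := rt_pos j
    calc (numPts j : ℝ) * (((j : ℝ) ^ dE) ^ (2 + et j) * (rt j ^ (2 : ℝ) * rt j ^ et j))
        ≤ (numPts j : ℝ) * (((j : ℝ) ^ dE) ^ 3 * (rt j ^ (2 : ℝ) * ((j : ℝ) ^ (3 * dE + cE))⁻¹)) := by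
          refine mul_le_mul_of_nonneg_left ?_ (by positivity)
          refine mul_le_mul h4 (mul_le_mul_of_nonneg_left h3 (by positivity)) (by positivity)
            (by positivity)
      _ = (2 ^ j * rt j ^ 2) * ((j : ℝ) ^ (3 * dE + cE) * ((j : ℝ) ^ (3 * dE + cE))⁻¹) := by
          rw [numPts, pow_add (j : ℝ) (3 * dE) cE, mul_comm 3 dE, pow_mul (j : ℝ) dE 3, Real.rpow_two]
          push_cast
          ring
      _ = 1 := by rw [two_pow_mul_rt_sq, mul_inv_cancel₀ (by positivity), one_mul]
      _ ≤ 1 := le_rfl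

/-! ### Averages of quadratic functionals -/

/-- The linear combination of the first `2 ^ j` vectors of `y` with coefficients `u`. -/
def lc (j : ℕ) (y : ℕ → Vb) (u : ℕ → ℝ) : Vb := ∑ i ∈ Finset.range (2 ^ j), u i • y i

theorem map_lc (j : ℕ) (y : ℕ → Vb) (u : ℕ → ℝ) (f : Vb →ₗ[ℝ] ℝ) :
    f (lc j y u) = ip (2 ^ j) u (fun i => f (y i)) := by
  simp [lc, ip]

/-- The averages of `f` over the points of level `j` are controlled by those over unit vectors. -/
def AvgBd (σ : Signs) (j : ℕ) (K : ℝ) (f : Vb → ℝ) : Prop :=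
  ∀ y : ℕ → Vb, ∑ a ∈ Finset.range (numPts j), f (lc j y (gv σ j a)) ≤
    K * ((j : ℝ) ^ cE * ∑ i ∈ Finset.range (2 ^ j), f (y i))

theorem AvgBd.add {σ : Signs} {j : ℕ} {K : ℝ} {f h : Vb → ℝ} (hf : AvgBd σ j K f)
    (hh : AvgBd σ j K h) : AvgBd σ j K (fun x => f x + h x) := fun y => by
  simp only [Finset.sum_add_distrib]
  have := hf y
  have := hh y
  linarith

theorem AvgBd.const_mul {σ : Signs} {j : ℕ} {K : ℝ} {f : Vb → ℝ} (hf : AvgBd σ j K f) {c : ℝ}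
    (hc : 0 ≤ c) : AvgBd σ j K (fun x => c * f x) := fun y => by
  simp only [← Finset.mul_sum]
  have := mul_le_mul_of_nonneg_left (hf y) hc
  linarith

theorem AvgBd.comp {σ : Signs} {j : ℕ} {K : ℝ} {f : Vb → ℝ} (hf : AvgBd σ j K f) (P : Vb →ₗ[ℝ] Vb) :
    AvgBd σ j K (fun x => f (P x)) := fun y => by
  have := hf fun i => P (y i)
  simpa [lc] using this

theorem AvgBd.mono {σ : Signs} {j : ℕ} {K K' : ℝ} {f : Vb → ℝ} (hf : AvgBd σ j K f) (h0 : ∀ x, 0 ≤ f x)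
    (hK : K ≤ K') : AvgBd σ j K' f := fun y =>
  (hf y).trans (mul_le_mul_of_nonneg_right hK
    (mul_nonneg (by positivity) (Finset.sum_nonneg fun _ _ => h0 _)))

theorem avgBd_sum {σ : Signs} {j : ℕ} {K : ℝ} {ι : Type*} {f : ι → Vb → ℝ} (F : Finset ι)
    (hf : ∀ i ∈ F, AvgBd σ j K (f i)) : AvgBd σ j K (fun x => ∑ i ∈ F, f i x) := fun y => by
  rw [Finset.sum_comm, Finset.sum_comm (s := Finset.range (2 ^ j)), Finset.mul_sum, Finset.mul_sum]
  exact Finset.sum_le_sum fun i hi => hf i hi y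

theorem lpn_sum_le {p : ℝ} (hp : 1 ≤ p) (n : ℕ) (s : Finset ℕ) (v : ℕ → ℕ → ℝ) :
    lpn p n (fun b => ∑ i ∈ s, v i b) ≤ ∑ i ∈ s, lpn p n (v i) := by
  induction s using Finset.induction_on with
  | empty => simp [lpn_zero (zero_lt_one.trans_le hp)]
  | insert i s hi ih =>
    simp only [Finset.sum_insert hi]
    exact (lpn_add_le hp n _ _).trans (by linarith)

theorem lpn_sq_eq {η : ℝ} (hη : 0 ≤ η) (n : ℕ) (u : ℕ → ℝ) :
    lpn (1 + η / 2) n (fun b => u b ^ 2) = lpn (2 + η) n u ^ 2 := by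
  unfold lpn
  rw [← Real.rpow_natCast, ← Real.rpow_mul (lpn_sum_nonneg _ n u)]
  congr 1
  · refine Finset.sum_congr rfl fun b _ => ?_
    rw [abs_pow, ← Real.rpow_natCast, ← Real.rpow_mul (abs_nonneg _)]
    congr 1; push_cast; ring
  · push_cast; field_simp

theorem sum_ssq_rpow_le {η : ℝ} (hη : 0 ≤ η) (n m : ℕ) (c : ℕ → ℕ → ℝ) :
    ∑ b ∈ Finset.range n, ssq m (c b) ^ (1 + η / 2) ≤
      (∑ i ∈ Finset.range m, lpn (2 + η) n (fun b => c b i) ^ 2) ^ (1 + η / 2) := by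
  have hp : 1 ≤ 1 + η / 2 := by linarith
  have h := lpn_sum_le hp n (Finset.range m) fun i b => c b i ^ 2
  simp only [lpn_sq_eq hη n] at h
  have h2 := Real.rpow_le_rpow (lpn_nonneg _ _ _) h (show 0 ≤ 1 + η / 2 by linarith)
  rw [lpn_rpow (by linarith)] at h2
  refine le_trans (le_of_eq (Finset.sum_congr rfl fun b _ => ?_)) h2
  rw [abs_of_nonneg (Finset.sum_nonneg fun _ _ => sq_nonneg _)]
  rfl

theorem avgBd_lpn {σ : Signs} {j : ℕ} (hj : 1 ≤ j) (hF : FrameBd (gv σ) j) {η : ℝ} (hη : 0 ≤ η) (n : ℕ)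
    (Λ : ℕ → Vb →ₗ[ℝ] ℝ) :
    AvgBd σ j ((j : ℝ) ^ 2 * ((2 : ℝ) ^ j) ^ (η / 2)) (fun x => lpn (2 + η) n (fun b => Λ b x) ^ 2) := by
  intro y
  dsimp only
  set c : ℕ → ℕ → ℝ := fun b i => Λ b (y i) with hc
  set S := ∑ i ∈ Finset.range (2 ^ j), lpn (2 + η) n (fun b => c b i) ^ 2 with hS
  have hS0 : 0 ≤ S := Finset.sum_nonneg fun _ _ => sq_nonneg _
  set L := ∑ a ∈ Finset.range (numPts j), lpn (2 + η) n (fun b => Λ b (lc j y (gv σ j a))) ^ 2 with hL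
  have hL0 : 0 ≤ L := Finset.sum_nonneg fun _ _ => sq_nonneg _
  have hj' : (1 : ℝ) ≤ j := by exact_mod_cast hj
  have hp : 1 ≤ 1 + η / 2 := by linarith
  have hp0 : 0 < 1 + η / 2 := by linarith
  have hA : (numPts j : ℝ) = 2 ^ j * (j : ℝ) ^ cE := by unfold numPts; push_cast; ring
  have hA0 : (0 : ℝ) < numPts j := by exact_mod_cast numPts_pos hj
  have e1 : ∀ a, (lpn (2 + η) n (fun b => Λ b (lc j y (gv σ j a))) ^ 2) ^ (1 + η / 2) =
      ∑ b ∈ Finset.range n, |ip (2 ^ j) (gv σ j a) (c b)| ^ (2 + η) := fun a => by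
    rw [← Real.rpow_natCast, ← Real.rpow_mul (lpn_nonneg _ _ _),
      show ((2 : ℕ) : ℝ) * (1 + η / 2) = 2 + η by push_cast; ring, lpn_rpow (by linarith)]
    simp only [map_lc, hc]
  have e2 : ∀ b, ∑ a ∈ Finset.range (numPts j), |ip (2 ^ j) (gv σ j a) (c b)| ^ (2 + η) ≤
      (j : ℝ) ^ (cE + 2) * ssq (2 ^ j) (c b) ^ (1 + η / 2) := fun b => by
    have hs := ssq_nonneg (2 ^ j) (c b)
    have hm : ∀ a ∈ Finset.range (numPts j), |ip (2 ^ j) (gv σ j a) (c b)| ≤ √(ssq (2 ^ j) (c b)) :=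
      fun a _ => by
        refine abs_le_of_sq_le_sq ?_ (Real.sqrt_nonneg _)
        have := ip_sq_le (2 ^ j) (gv σ j a) (c b)
        rwa [ssq_gv, one_mul, ← Real.sq_sqrt hs] at this
    refine (sum_rpow_le hη hm).trans ((mul_le_mul_of_nonneg_left (hF (c b)) (by positivity)).trans
      (le_of_eq ?_))
    rw [add_comm 1, Real.rpow_add_of_nonneg hs (by positivity) zero_le_one, Real.rpow_one,
      Real.sqrt_eq_rpow, ← Real.rpow_mul hs, one_div_mul_eq_div]
    ring
  have h1 : L ^ (1 + η / 2) ≤ (numPts j : ℝ) ^ (η / 2) * ((j : ℝ) ^ (cE + 2) * S ^ (1 + η / 2)) := by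
    have h := Real.rpow_sum_le_const_mul_sum_rpow (Finset.range (numPts j))
      (fun a => lpn (2 + η) n (fun b => Λ b (lc j y (gv σ j a))) ^ 2) hp
    have habs : ∀ a, |lpn (2 + η) n (fun b => Λ b (lc j y (gv σ j a))) ^ 2| =
        lpn (2 + η) n (fun b => Λ b (lc j y (gv σ j a))) ^ 2 := fun a => abs_of_nonneg (sq_nonneg _)
    simp only [habs, Finset.card_range, e1, add_sub_cancel_left] at h
    refine h.trans (mul_le_mul_of_nonneg_left ?_ (by positivity))
    rw [Finset.sum_comm]
    refine (Finset.sum_le_sum fun b _ => e2 b).trans ?_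
    rw [← Finset.mul_sum]
    exact mul_le_mul_of_nonneg_left (sum_ssq_rpow_le hη n (2 ^ j) c) (by positivity)
  rw [← Real.rpow_le_rpow_iff hL0 (by positivity) hp0]
  refine h1.trans ?_
  have hn : (1 : ℝ) ≤ 2 ^ j := one_le_pow₀ (by norm_num)
  have hn0 : (0 : ℝ) < 2 ^ j := by positivity
  have e3 : (j : ℝ) ^ 2 * ((2 : ℝ) ^ j) ^ (η / 2) * ((j : ℝ) ^ cE * S) =
      (numPts j * S) * ((j : ℝ) ^ 2 * (((2 : ℝ) ^ j) ^ (η / 2) * (2 ^ j)⁻¹)) := by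
    rw [hA]; field_simp
  have e4 : (j : ℝ) ^ 2 * (2 ^ j)⁻¹ ≤
      ((j : ℝ) ^ 2 * (((2 : ℝ) ^ j) ^ (η / 2) * (2 ^ j)⁻¹)) ^ (1 + η / 2) := by
    rw [Real.mul_rpow (by positivity) (by positivity)]
    refine mul_le_mul ?_ ?_ (by positivity) (by positivity)
    · exact Real.self_le_rpow_of_one_le (one_le_pow₀ hj') hp
    · rw [← Real.rpow_neg_one, ← Real.rpow_add hn0, ← Real.rpow_mul hn0.le]
      exact Real.rpow_le_rpow_of_exponent_le hn (by nlinarith)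
  have e5 : (numPts j : ℝ) ^ (η / 2) * ((j : ℝ) ^ (cE + 2) * S ^ (1 + η / 2)) =
      (numPts j * S) ^ (1 + η / 2) * ((j : ℝ) ^ 2 * (2 ^ j)⁻¹) := by
    rw [Real.mul_rpow hA0.le hS0, add_comm 1, Real.rpow_add hA0, Real.rpow_one, hA,
      pow_add (j : ℝ) cE 2]
    field_simp
  rw [e3, e5, Real.mul_rpow (mul_nonneg hA0.le hS0) (by positivity)]
  exact mul_le_mul_of_nonneg_left e4 (by positivity)

theorem avgBd_px {σ : Signs} {J j : ℕ} (hj : 1 ≤ j) (hF : FrameBd (gv σ) j) {k l : ℕ}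
    (hl : 3 ≤ l) (hkl : l ≤ k) (n : ℕ) (Λ : ℕ → Vb →ₗ[ℝ] ℝ) :
    AvgBd σ j ((j : ℝ) ^ 2 * ((2 : ℝ) ^ j) ^ (et l / 2)) (fun x => lpn (px J k) n (fun b => Λ b x) ^ 2) := by
  refine (avgBd_lpn hj hF (et_nonneg (max k J)) n Λ).mono (fun _ => sq_nonneg _) ?_
  refine mul_le_mul_of_nonneg_left ?_ (by positivity)
  refine Real.rpow_le_rpow_of_exponent_le (one_le_pow₀ (by norm_num)) ?_
  have := et_antitone hl (show l ≤ max k J by omega)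
  linarith

theorem avgBd_EucN {σ : Signs} {j : ℕ} (hj : 1 ≤ j) (hF : FrameBd (gv σ) j) (r : ℕ) :
    AvgBd σ j ((j : ℝ) ^ 2) (fun x => EucN r x ^ 2) := by
  have := avgBd_lpn hj hF le_rfl (bIdx r + 1) cf
  simpa [EucN] using this

theorem avgBd_Nr {σ : Signs} {J j : ℕ} (hj : 1 ≤ j) (hF : FrameBd (gv σ) j) {r l : ℕ}
    (hl : 3 ≤ l) (hr : l + 1 ≤ r) :
    AvgBd σ j ((j : ℝ) ^ 2 * ((2 : ℝ) ^ j) ^ (et l / 2)) (fun x => Nr σ J r x ^ 2) := by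
  simp only [Nr_sq]
  have h1 : (1 : ℝ) ≤ ((2 : ℝ) ^ j) ^ (et l / 2) :=
    Real.one_le_rpow (one_le_pow₀ (by norm_num)) (by have := et_nonneg l; linarith)
  refine (((avgBd_EucN hj hF r).mono (fun _ => sq_nonneg _)
    (le_mul_of_one_le_right (by positivity) h1)).add ?_).add (AvgBd.const_mul ?_
    (Real.log_natCast_nonneg r))
  · exact avgBd_px hj hF hl (by omega) _ _
  · exact avgBd_px hj hF hl (by omega) _ _

theorem avgBd_Sm {σ : Signs} {J j : ℕ} (hj : 1 ≤ j) (hF : FrameBd (gv σ) j) {r l : ℕ}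
    (hl : 5 ≤ l) (hr : l + 1 ≤ r) :
    AvgBd σ j ((j : ℝ) ^ 2 * ((2 : ℝ) ^ j) ^ (et l / 2)) (fun x => Sm σ J r x) := by
  have h6 : 6 ≤ r := by omega
  simp only [Sm, if_pos h6]
  refine ((avgBd_Nr hj hF (by omega) hr).comp (projTo (VIdx r))).add
    ((((avgBd_Nr hj hF (by omega) hr).comp (projTo (WIdx r))).add
    ((avgBd_Nr hj hF (by omega) (by omega)).comp (projTo (WIdx r)))).const_mul ?_)
  exact one_div_nonneg.2 (Real.log_natCast_nonneg r)

/-! ### The main averaging estimate -/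

/-- The linear map `u ↦ lc j y u` has moderate growth from level `j`. -/
def Tame (σ : Signs) (J j : ℕ) (y : ℕ → Vb) : Prop :=
  ∀ u, VNorm (Nr σ J) (lc j y u) ≤ (j : ℝ) ^ 3 * (√(ssq (2 ^ j) u) + phi σ J j u)

theorem lc_unit {j i : ℕ} (hi : i < 2 ^ j) (y : ℕ → Vb) :
    lc j y (fun i' => if i' = i then 1 else 0) = y i := by
  simp [lc, hi]

theorem ssq_unit {j i : ℕ} (hi : i < 2 ^ j) : ssq (2 ^ j) (fun i' => if i' = i then 1 else 0) = 1 := by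
  simp [ssq, hi]

theorem Tame.norm_le {σ : Signs} {J j : ℕ} {y : ℕ → Vb} (hy : Tame σ J j y) (hS : Spread σ J j) {i : ℕ}
    (hi : i < 2 ^ j) : VNorm (Nr σ J) (y i) ≤ 2 * (j : ℝ) ^ 3 := by
  have h := hy fun i' => if i' = i then 1 else 0
  rw [lc_unit hi, ssq_unit hi, Real.sqrt_one] at h
  have h2 := mul_le_mul_of_nonneg_left (hS.unit i hi) (show (0 : ℝ) ≤ (j : ℝ) ^ 3 by positivity)
  linarith

theorem Tame.norm_sq_le {σ : Signs} {J j : ℕ} {y : ℕ → Vb} (hy : Tame σ J j y) (hS : Spread σ J j)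
    {i : ℕ} (hi : i < 2 ^ j) : VNorm (Nr σ J) (y i) ^ 2 ≤ 4 * (j : ℝ) ^ 6 :=
  (pow_le_pow_left₀ (VNorm_nonneg _ _) (hy.norm_le hS hi) 2).trans (le_of_eq (by ring))

theorem Tame.moderate {σ : Signs} {J j k : ℕ} {y : ℕ → Vb} (hy : Tame σ J j y) (hS : Spread σ J j)
    (hj : 5 ≤ j) (hJj : J ≤ j) (hk : 6 ≤ k) :
    Moderate (gv σ) j k (fun l i => cf (posn k l) (y i)) := by
  have hj' : (5 : ℝ) ≤ j := by exact_mod_cast hj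
  have hcf : ∀ l u, ip (2 ^ j) (fun i => cf (posn k l) (y i)) u = cf (posn k l) (lc j y u) :=
    fun l u => by rw [map_lc, ip_comm]
  refine ⟨fun l hl i hi => ?_, fun F hF hc c => ?_, ?_⟩
  · refine (abs_cf_le σ J hk hl (y i)).trans ((hy.norm_le hS hi).trans ?_)
    rw [pow_succ (j : ℝ) 3, mul_comm]
    exact mul_le_mul_of_nonneg_left (by linarith) (by positivity)
  · simp only [hcf]
    refine (ssq_cf_le σ J hk _).trans ?_
    obtain ⟨h1, h2⟩ := hS.comb F hF hc c
    rw [Dc_of_le hJj] at h2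
    have hs : 0 ≤ ∑ a ∈ F, c a ^ 2 := Finset.sum_nonneg fun _ _ => sq_nonneg _
    have hd : (1 : ℝ) ≤ (j : ℝ) ^ dE := one_le_pow₀ (by linarith)
    have h3 : VNorm (Nr σ J) (lc j y fun i => ∑ a ∈ F, c a * gv σ j a i) ≤
        (j : ℝ) ^ 4 * (j : ℝ) ^ dE * √(∑ a ∈ F, c a ^ 2) := by
      refine (hy _).trans ?_
      have h4 : √(ssq (2 ^ j) fun i => ∑ a ∈ F, c a * gv σ j a i) +
          phi σ J j (fun i => ∑ a ∈ F, c a * gv σ j a i) ≤ j * (j : ℝ) ^ dE * √(∑ a ∈ F, c a ^ 2) := by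
        have h5 : 2 + 3 * (j : ℝ) ^ dE ≤ j * (j : ℝ) ^ dE := by nlinarith
        have := mul_le_mul_of_nonneg_right h5 (Real.sqrt_nonneg (∑ a ∈ F, c a ^ 2))
        linarith
      refine (mul_le_mul_of_nonneg_left h4 (by positivity)).trans (le_of_eq (by ring))
    refine (pow_le_pow_left₀ (VNorm_nonneg _ _) h3 2).trans (le_of_eq ?_)
    rw [mul_pow, Real.sq_sqrt hs, pow_add, mul_pow, ← pow_mul, ← pow_mul, mul_comm dE 2]
    ring
  · have e : ∑ l ∈ Finset.range (2 ^ k), ssq (2 ^ j) (fun i => cf (posn k l) (y i)) =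
        ∑ i ∈ Finset.range (2 ^ j), ssq (2 ^ k) (fun l => cf (posn k l) (y i)) := by
      unfold ssq; rw [Finset.sum_comm]
    rw [e]
    refine (Finset.sum_le_card_nsmul _ _ (4 * (j : ℝ) ^ 6) fun i hi =>
      (ssq_cf_le σ J hk _).trans (hy.norm_sq_le hS (Finset.mem_range.1 hi))).trans (le_of_eq ?_)
    simp

theorem lpn_le_add_sum {p u : ℝ} (hp : 2 ≤ p) (hp3 : p ≤ 3) (hu : 0 < u) (hu1 : u ≤ 1) (n : ℕ) (f : ℕ → ℝ) :
    lpn p n f ≤ u + (u ^ 2)⁻¹ * ∑ i ∈ Finset.range n, |f i| ^ p := by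
  rw [← lpn_rpow (by linarith) n f]
  set s := lpn p n f
  have hs : 0 ≤ s := lpn_nonneg _ _ _
  rcases le_or_gt s u with h | h
  · have : 0 ≤ (u ^ 2)⁻¹ * s ^ p := by positivity
    linarith
  · have hs0 : 0 < s := hu.trans h
    have h1 : u ^ 2 ≤ s ^ (p - 1) := by
      calc u ^ 2 = u ^ (2 : ℝ) := (Real.rpow_natCast u 2).symm
        _ ≤ u ^ (p - 1) := Real.rpow_le_rpow_of_exponent_ge hu hu1 (by linarith)
        _ ≤ s ^ (p - 1) := Real.rpow_le_rpow hu.le h.le (by linarith)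
    have h2 : s ≤ (u ^ 2)⁻¹ * s ^ p := by
      rw [le_inv_mul_iff₀ (by positivity)]
      calc u ^ 2 * s ≤ s ^ (p - 1) * s := mul_le_mul_of_nonneg_right h1 hs
        _ = s ^ p := by
          rw [← Real.rpow_add_one hs0.ne', sub_add_cancel]
    linarith

theorem Psi_lc (σ : Signs) (J j k : ℕ) (y : ℕ → Vb) (a : ℕ) :
    Psi σ J k (lc j y (gv σ j a)) =
      Dc J k * lpn (px J k) (numPts k) (fun b => ment (gv σ) j k (fun l i => cf (posn k l) (y i)) b a) := by
  unfold Psi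
  rw [← abs_of_nonneg (Dc_nonneg J k), ← lpn_smul (px_pos J k)]
  refine lpn_congr fun b _ => ?_
  rw [Gc_apply, ment]
  congr 1
  exact ip_congr (fun _ _ => rfl) fun l _ => by rw [map_lc, ip_comm]

theorem sum_Psi_far_le {σ : Signs} {J j k : ℕ} {y : ℕ → Vb} (hj : 5 ≤ j) (hJ : 6 ≤ J) (hJj : J ≤ j)
    (hJk : J ≤ k) (hFj : FrameBd (gv σ) j) (hFk : FrameBd (gv σ) k) (hS : Spread σ J j)
    (hy : Tame σ J j y) (hkj : k ^ 5 < j) :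
    ∑ a ∈ Finset.range (numPts j), Psi σ J k (lc j y (gv σ j a)) ≤ numPts j * (5 * (j : ℝ) ^ 71) := by
  have hM := hy.moderate hS hj hJj (hJ.trans hJk)
  set T : ℕ → ℕ → ℝ := fun l i => cf (posn k l) (y i) with hT
  have hj' : (1 : ℝ) ≤ j := by exact_mod_cast (by omega : 1 ≤ j)
  have hk1 : (1 : ℝ) ≤ k := by exact_mod_cast (by omega : 1 ≤ k)
  have hk5 : (k : ℝ) ^ 5 ≤ j := by exact_mod_cast hkj.le
  have h1 : ∀ a, Psi σ J k (lc j y (gv σ j a)) ^ 2 ≤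
      (k : ℝ) ^ (2 * dE + cE + 2) * ssq (2 ^ k) (fun l => ip (2 ^ j) (T l) (gv σ j a)) := fun a => by
    rw [Psi_lc, Dc_of_le hJk, mul_pow]
    have h2 := pow_le_pow_left₀ (lpn_nonneg _ _ _)
      (lpn_antitone two_pos (two_le_px J k) (numPts k) (fun b => ment (gv σ) j k T b a)) 2
    rw [lpn_two_sq] at h2
    have h3 := hFk fun l => ip (2 ^ j) (T l) (gv σ j a)
    refine (mul_le_mul_of_nonneg_left (h2.trans h3) (by positivity)).trans (le_of_eq ?_)
    rw [← mul_assoc, ← pow_mul, ← pow_add]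
    congr 2; ring
  have h2 : ∑ a ∈ Finset.range (numPts j), ssq (2 ^ k) (fun l => ip (2 ^ j) (T l) (gv σ j a)) ≤
      (j : ℝ) ^ (cE + 2) * (2 ^ j * (4 * (j : ℝ) ^ 6)) := by
    refine le_trans ?_ (mul_le_mul_of_nonneg_left hM.hs (by positivity))
    unfold ssq
    rw [Finset.sum_comm, Finset.mul_sum]
    refine Finset.sum_le_sum fun l _ => ?_
    have := hFj (T l)
    simpa only [ip_comm _ (T l), ssq] using this
  have h3 : (k : ℝ) ^ (2 * dE + cE + 2) ≤ (j : ℝ) ^ 133 := by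
    calc (k : ℝ) ^ (2 * dE + cE + 2) ≤ (k : ℝ) ^ (5 * 133) := by
          refine pow_le_pow_right₀ hk1 ?_
          rw [dE_eq, cE_eq]; omega
      _ ≤ _ := by rw [pow_mul]; exact pow_le_pow_left₀ (by positivity) hk5 _
  have h4 : ∑ a ∈ Finset.range (numPts j), Psi σ J k (lc j y (gv σ j a)) ^ 2 ≤
      numPts j * (4 * (j : ℝ) ^ 141) := by
    refine (Finset.sum_le_sum fun a _ => h1 a).trans ?_
    rw [← Finset.mul_sum]
    refine (mul_le_mul h3 h2 (Finset.sum_nonneg fun _ _ => ssq_nonneg _ _) (by positivity)).trans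
      (le_of_eq ?_)
    unfold numPts; push_cast
    rw [pow_add (j : ℝ) cE 2]
    ring
  have hj0 : (0 : ℝ) < j := by linarith
  have h5 : ∀ a, Psi σ J k (lc j y (gv σ j a)) ≤
      (j : ℝ) ^ 71 + ((j : ℝ) ^ 71)⁻¹ * Psi σ J k (lc j y (gv σ j a)) ^ 2 := fun a => by
    have hx := Psi_nonneg σ J k (lc j y (gv σ j a))
    set x := Psi σ J k (lc j y (gv σ j a))
    set t := (j : ℝ) ^ 71
    have ht : 0 < t := by positivity
    rw [← sub_nonneg]
    have : t + t⁻¹ * x ^ 2 - x = t⁻¹ * (t ^ 2 + x ^ 2 - t * x) := by field_simp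
    rw [this]
    exact mul_nonneg (by positivity) (by nlinarith [sq_nonneg (t - x)])
  refine (Finset.sum_le_sum fun a _ => h5 a).trans ?_
  rw [Finset.sum_add_distrib, ← Finset.mul_sum, Finset.sum_const, Finset.card_range, nsmul_eq_mul]
  have h6 := mul_le_mul_of_nonneg_left h4 (show 0 ≤ ((j : ℝ) ^ 71)⁻¹ by positivity)
  have e : ((j : ℝ) ^ 71)⁻¹ * (numPts j * (4 * (j : ℝ) ^ 141)) = numPts j * (4 * (j : ℝ) ^ 70) := by
    field_simp
  rw [e] at h6
  have h7 : (j : ℝ) ^ 70 ≤ (j : ℝ) ^ 71 := pow_le_pow_right₀ hj' (by norm_num)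
  have h8 : (numPts j : ℝ) * (4 * (j : ℝ) ^ 70) ≤ numPts j * (4 * (j : ℝ) ^ 71) :=
    mul_le_mul_of_nonneg_left (by linarith) (by positivity)
  linarith

theorem sum_offdiag_eq (σ : Signs) (j k : ℕ) (T : ℕ → ℕ → ℝ) {p : ℝ} (hp : 0 < p) :
    ∑ a ∈ Finset.range (numPts j), ∑ b ∈ Finset.range (numPts k),
      |if (k, b) ≠ (j, a) then ment (gv σ) j k T b a else 0| ^ p =
    ∑ q ∈ offPairs j k, |ment (gv σ) j k T q.1 q.2| ^ p := by
  rw [offPairs, Finset.sum_filter, Finset.sum_product, Finset.sum_comm]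
  refine Finset.sum_congr rfl fun b _ => Finset.sum_congr rfl fun a _ => ?_
  split_ifs <;> simp [Real.zero_rpow hp.ne']

theorem sum_Psi_near_le {σ : Signs} {J j k : ℕ} {y : ℕ → Vb} (hj : 5 ≤ j) (hJ : 6 ≤ J) (hJj : J ≤ j)
    (hJk : J ≤ k) (hDj : DiagConc (gv σ) j) (hS : Spread σ J j) (hy : Tame σ J j y)
    (het : et k ≤ 1) (hk : k ≤ 600 * j)
    (hoff : ∑ q ∈ offPairs j k, |ment (gv σ) j k (fun l i => cf (posn k l) (y i)) q.1 q.2| ^ (2 + et k) ≤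
      numPts j / (j : ℝ) ^ 15)
    (htr : ∑ i ∈ Finset.range (2 ^ j), cf (posn j i) (y i) = 0) :
    ∑ a ∈ Finset.range (numPts j), Psi σ J k (lc j y (gv σ j a)) ≤
      numPts j * (3 * 600 ^ 110 * (j : ℝ) ^ 105) := by
  have hM := hy.moderate hS hj hJj (hJ.trans hJj)
  have hj' : (1 : ℝ) ≤ j := by exact_mod_cast (by omega : 1 ≤ j)
  have hj0 : (0 : ℝ) < j := by linarith
  set T : ℕ → ℕ → ℝ := fun l i => cf (posn k l) (y i) with hT
  simp only [Psi_lc, px_of_le hJk, ← Finset.mul_sum]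
  have hp : 2 ≤ 2 + et k := by linarith [et_nonneg k]
  set m : ℕ → ℕ → ℝ := fun a b => if (k, b) ≠ (j, a) then ment (gv σ) j k T b a else 0 with hm
  have h1 : ∀ a, lpn (2 + et k) (numPts k) (fun b => ment (gv σ) j k T b a) ≤
      lpn (2 + et k) (numPts k) (m a) + if k = j then |ment (gv σ) j k T a a| else 0 := fun a => by
    have e : lpn (2 + et k) (numPts k) (fun b => ment (gv σ) j k T b a) = lpn (2 + et k) (numPts k)
        (fun b => m a b + if (k, b) = (j, a) then ment (gv σ) j k T b a else 0) :=
      lpn_congr fun b _ => by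
        simp only [hm]; split_ifs <;> simp_all
    rw [e]
    refine (lpn_add_le (by linarith) _ _ _).trans (add_le_add le_rfl ?_)
    split_ifs with hkj
    · refine lpn_le_of_sum_le (by linarith) (abs_nonneg _) ?_
      refine (Finset.sum_le_sum (g := fun b => if b = a then |ment (gv σ) j k T a a| ^ (2 + et k) else 0)
        fun b _ => ?_).trans ?_
      · split_ifs with h h2 h2
        · rw [h2]
        · simp_all
        · simp_all
        · simp [Real.zero_rpow (show 2 + et k ≠ 0 by linarith)]
      · rw [Finset.sum_ite_eq']
        split_ifs
        · exact le_rfl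
        · positivity
    · refine (lpn_zero (by linarith) _ fun b _ => ?_).le
      rw [if_neg (by simp [hkj])]
  have h2 : ∀ a, lpn (2 + et k) (numPts k) (m a) ≤ ((j : ℝ) ^ 5)⁻¹ +
      ((((j : ℝ) ^ 5)⁻¹) ^ 2)⁻¹ * ∑ b ∈ Finset.range (numPts k), |m a b| ^ (2 + et k) := fun a =>
    lpn_le_add_sum hp (by linarith) (by positivity) (inv_le_one_of_one_le₀ (one_le_pow₀ hj')) _ _
  have h3 : ∑ a ∈ Finset.range (numPts j), lpn (2 + et k) (numPts k) (m a) ≤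
      2 * (numPts j / (j : ℝ) ^ 5) := by
    refine (Finset.sum_le_sum fun a _ => h2 a).trans ?_
    rw [Finset.sum_add_distrib, ← Finset.mul_sum, Finset.sum_const, Finset.card_range, nsmul_eq_mul,
      sum_offdiag_eq σ j k T (by linarith)]
    refine (add_le_add le_rfl (mul_le_mul_of_nonneg_left hoff (by positivity))).trans (le_of_eq ?_)
    field_simp
    ring
  have h4 : ∑ a ∈ Finset.range (numPts j), (if k = j then |ment (gv σ) j k T a a| else 0) ≤
      numPts j / (j : ℝ) ^ 5 := by
    split_ifs with hkj
    · subst hkj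
      have h := hDj T (hM.hs.trans ?_)
      · rw [show ∑ i ∈ Finset.range (2 ^ k), T i i = 0 from htr] at h
        simpa [ment, ip] using h
      · refine mul_le_mul_of_nonneg_left ?_ (by positivity)
        have h5 : (5 : ℝ) ≤ k := by exact_mod_cast hj
        rw [pow_add (k : ℝ) 6 2, mul_comm]
        exact mul_le_mul_of_nonneg_left (by nlinarith) (by positivity)
    · simp; positivity
  have hD : Dc J k ≤ 600 ^ 110 * (j : ℝ) ^ 110 := by
    rw [Dc_of_le hJk, dE_eq, ← mul_pow]
    exact pow_le_pow_left₀ (by positivity) (by exact_mod_cast hk) _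
  have h5 : ∑ a ∈ Finset.range (numPts j), lpn (2 + et k) (numPts k) (fun b => ment (gv σ) j k T b a) ≤
      3 * (numPts j / (j : ℝ) ^ 5) := by
    refine (Finset.sum_le_sum fun a _ => h1 a).trans ?_
    rw [Finset.sum_add_distrib]
    linarith
  refine (mul_le_mul hD h5 (Finset.sum_nonneg fun _ _ => lpn_nonneg _ _ _) (by positivity)).trans
    (le_of_eq ?_)
  field_simp

theorem two_pow_rpow_half_et {j : ℕ} (hj : 1 ≤ j) :
    ((2 : ℝ) ^ j) ^ (et (600 * j) / 2) = 600 ^ 200 * (j : ℝ) ^ 200 := by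
  have h := two_pow_rpow_et j (show 1 ≤ 600 * j by omega)
  have hj0 : (0 : ℝ) < j := by exact_mod_cast hj
  have e : (240000 * (j : ℝ) / ((600 * j : ℕ) : ℝ)) = 400 := by
    push_cast; field_simp; norm_num
  rw [e, Real.rpow_natCast] at h
  have h0 : (0 : ℝ) ≤ 2 ^ j := by positivity
  rw [div_eq_mul_inv, Real.rpow_mul h0, h, ← Real.rpow_mul (by positivity),
    show (400 : ℝ) * 2⁻¹ = (200 : ℕ) by norm_num, Real.rpow_natCast, ← mul_pow]
  push_cast; rfl

/-- The quadratic bookkeeping of a norm through early levels, with masses `q` and `s`, and late ones. -/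
theorem le_of_sq_le_early_late {x late L q s t : ℝ} (hx : x ^ 2 ≤ late + L * (q + 2 * s ^ 2))
    (hl : 0 ≤ late) (hL : 1 ≤ L) (hq : 0 ≤ q) (hs : 0 ≤ s) (ht : 0 < t) :
    x ≤ (t + t⁻¹ * late) + L * (1 + q + 2 * s) := by
  have h1 : late ≤ (t + t⁻¹ * late) ^ 2 := by
    have : (t + t⁻¹ * late) ^ 2 = t ^ 2 + 2 * late + (t⁻¹ * late) ^ 2 := by
      field_simp; ring
    nlinarith [sq_nonneg t, sq_nonneg (t⁻¹ * late)]
  have h2 : L * (q + 2 * s ^ 2) ≤ (L * (1 + q + 2 * s)) ^ 2 := by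
    rw [mul_pow]
    exact mul_le_mul (by nlinarith) (by nlinarith [mul_nonneg hq hs]) (by positivity) (by positivity)
  have h3 : 0 ≤ t + t⁻¹ * late := by positivity
  have h4 : 0 ≤ L * (1 + q + 2 * s) := by positivity
  refine le_of_sq_le_sq (a := x) ?_ (add_nonneg h3 h4)
  nlinarith [mul_nonneg h3 h4]

theorem sum_Sm_early_le (σ : Signs) {J : ℕ} (hJ : 3 ≤ J) (R : ℕ) (x : Vb) :
    ∑ r ∈ Finset.range (R + 1), Sm σ J r x ≤ 7 * Real.log R *
      ((∑ r ∈ (Finset.range (R + 1)).filter (6 ≤ ·), QV r x ^ 2) +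
        2 * (∑ k ∈ Finset.range (R + 1), Psi σ J k x) ^ 2) := by
  have e : ∑ r ∈ Finset.range (R + 1), Sm σ J r x =
      ∑ r ∈ (Finset.range (R + 1)).filter (6 ≤ ·), Sm σ J r x := by
    rw [Finset.sum_filter]
    refine Finset.sum_congr rfl fun r _ => ?_
    split_ifs with h
    · rfl
    · simp [Sm, h]
  have hsq : ∑ k ∈ Finset.range (R + 1), Psi σ J k x ^ 2 ≤
      (∑ k ∈ Finset.range (R + 1), Psi σ J k x) ^ 2 :=
    Finset.sum_sq_le_sq_sum_of_nonneg fun k _ => Psi_nonneg σ J k x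
  have hL : 0 ≤ Real.log R := Real.log_natCast_nonneg R
  have h1 : ∀ r ∈ (Finset.range (R + 1)).filter (6 ≤ ·), Sm σ J r x ≤
      7 * Real.log R * (QV r x ^ 2 + Psi σ J (r - 1) x ^ 2 + Psi σ J r x ^ 2) := fun r hr => by
    rw [Finset.mem_filter, Finset.mem_range] at hr
    refine (Sm_le_log σ hJ hr.2 x).trans (mul_le_mul_of_nonneg_right ?_ (by positivity))
    refine mul_le_mul_of_nonneg_left (Real.log_le_log ?_ ?_) (by norm_num)
    · have : 0 < r := by omega
      exact_mod_cast this
    · have : r ≤ R := by omega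
      exact_mod_cast this
  rw [e]
  refine (Finset.sum_le_sum h1).trans ?_
  rw [← Finset.mul_sum, Finset.sum_add_distrib, Finset.sum_add_distrib]
  have h2 : ∑ r ∈ (Finset.range (R + 1)).filter (6 ≤ ·), Psi σ J r x ^ 2 ≤
      ∑ k ∈ Finset.range (R + 1), Psi σ J k x ^ 2 :=
    Finset.sum_le_sum_of_subset_of_nonneg (Finset.filter_subset _ _) fun _ _ _ => sq_nonneg _
  have h3 : ∑ r ∈ (Finset.range (R + 1)).filter (6 ≤ ·), Psi σ J (r - 1) x ^ 2 ≤
      ∑ k ∈ Finset.range (R + 1), Psi σ J k x ^ 2 := by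
    have hinj : Set.InjOn (fun r => r - 1) ((Finset.range (R + 1)).filter (6 ≤ ·) : Finset ℕ) :=
      fun a ha b hb h => by
        simp only [Finset.coe_filter, Finset.mem_range, Set.mem_ofPred_eq] at ha hb h
        omega
    rw [← Finset.sum_image (f := fun k => Psi σ J k x ^ 2) hinj]
    refine Finset.sum_le_sum_of_subset_of_nonneg (fun k hk => ?_) fun _ _ _ => sq_nonneg _
    obtain ⟨r, hr, rfl⟩ := Finset.mem_image.1 hk
    rw [Finset.mem_filter, Finset.mem_range] at hr
    rw [Finset.mem_range]; omega
  exact mul_le_mul_of_nonneg_left (by linarith) (by positivity)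

theorem sum_QV_le (σ : Signs) (J : ℕ) (F : Finset ℕ) (x : Vb) :
    ∑ r ∈ F.filter (6 ≤ ·), QV r x ^ 2 ≤ VNorm (Nr σ J) x ^ 2 :=
  (Finset.sum_le_sum fun _ hr => QV_sq_le σ J (Finset.mem_filter.1 hr).2 x).trans (sum_Sm_le σ J x _)

theorem AvgBd.sum_le {σ : Signs} {J j : ℕ} {K : ℝ} {f : Vb → ℝ} {y : ℕ → Vb} (hf : AvgBd σ j K f)
    (hK : 0 ≤ K) (hS : Spread σ J j) (hy : Tame σ J j y) (h : ∀ x, f x ≤ VNorm (Nr σ J) x ^ 2) :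
    ∑ a ∈ Finset.range (numPts j), f (lc j y (gv σ j a)) ≤ numPts j * (K * (4 * (j : ℝ) ^ 6)) := by
  refine (hf y).trans ?_
  have h1 : ∑ i ∈ Finset.range (2 ^ j), f (y i) ≤ 2 ^ j * (4 * (j : ℝ) ^ 6) := by
    refine (Finset.sum_le_card_nsmul _ _ (4 * (j : ℝ) ^ 6) fun i hi =>
      (h _).trans (hy.norm_sq_le hS (Finset.mem_range.1 hi))).trans (le_of_eq (by simp))
  refine (mul_le_mul_of_nonneg_left (mul_le_mul_of_nonneg_left h1 (by positivity)) hK).trans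
    (le_of_eq ?_)
  unfold numPts; push_cast; ring

theorem exists_uniform_VNorm_sq_eq (σ : Signs) (J n R : ℕ) (x : ℕ → Vb) : ∃ M, R ≤ M ∧ ∀ a < n,
    VNorm (Nr σ J) (x a) ^ 2 = ∑ r ∈ Finset.range M, Sm σ J r (x a) := by
  choose f hf using fun a => VNorm_sq_eq σ J (x a)
  refine ⟨max R ((Finset.range n).sup f), le_max_left _ _, fun a ha => hf a _ ?_⟩
  exact (Finset.le_sup (Finset.mem_range.2 ha)).trans (le_max_right _ _)

theorem sum_Psi_le {σ : Signs} {J j : ℕ} {y : ℕ → Vb} (hj : 5 ≤ j) (hJ : 6 ≤ J) (hJj : J ≤ j)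
    (hT : Typical (gv σ) J) (hS : Spread σ J j) (hy : Tame σ J j y) (het : ∀ k, J ≤ k → et k ≤ 1)
    (hoff : ∀ k, J ≤ k → Near j k → ∀ T : ℕ → ℕ → ℝ, Moderate (gv σ) j k T →
      ∑ q ∈ offPairs j k, |ment (gv σ) j k T q.1 q.2| ^ (2 + et k) ≤ numPts j / (j : ℝ) ^ 15)
    (htr : ∑ i ∈ Finset.range (2 ^ j), cf (posn j i) (y i) = 0) {k : ℕ} (hk : k ≤ 600 * j) :
    ∑ a ∈ Finset.range (numPts j), Psi σ J k (lc j y (gv σ j a)) ≤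
      numPts j * (8 * 600 ^ 110 * (j : ℝ) ^ 105) := by
  have hj' : (1 : ℝ) ≤ j := by exact_mod_cast (by omega : 1 ≤ j)
  rcases lt_or_ge k J with h | hJk
  · have : ∀ x, Psi σ J k x = 0 := fun x => lpn_zero (px_pos _ _) _ fun a _ => by
      rw [Gc_apply, Dc, if_neg (not_le.2 h), zero_mul]
    simp only [this, Finset.sum_const_zero]
    positivity
  · rcases lt_or_ge (k ^ 5) j with hkj | hkj
    · refine (sum_Psi_far_le hj hJ hJj hJk (hT.frame j hJj) (hT.frame k hJk) hS hy hkj).trans ?_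
      refine mul_le_mul_of_nonneg_left (mul_le_mul (by norm_num) ?_ (by positivity) (by positivity))
        (by positivity)
      exact pow_le_pow_right₀ hj' (by norm_num)
    · refine (sum_Psi_near_le hj hJ hJj hJk (hT.diag j hJj) hS hy (het k hJk) hk
        (hoff k hJk ⟨hkj, hk⟩ _ (hy.moderate hS hj hJj (hJ.trans hJk))) htr).trans ?_
      refine mul_le_mul_of_nonneg_left (mul_le_mul_of_nonneg_right ?_ (by positivity)) (by positivity)
      norm_num

/-- A tame map without trace is small on average. -/
theorem exists_sum_VNorm_le : ∃ N : ℕ, ∀ (σ : Signs) (J : ℕ), Typical (gv σ) J → N ≤ J → ∀ j, J ≤ j →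
    Spread σ J j → ∀ y, Tame σ J j y → ∑ i ∈ Finset.range (2 ^ j), cf (posn j i) (y i) = 0 →
    ∑ a ∈ Finset.range (numPts j), VNorm (Nr σ J) (lc j y (gv σ j a)) ≤ numPts j * (j : ℝ) ^ 108 := by
  obtain ⟨N₁, h₁⟩ := Filter.eventually_atTop.1 eventually_et_le_one
  obtain ⟨N₂, h₂⟩ := offdiag_sum_le
  obtain ⟨N₃, h₃⟩ := Filter.eventually_atTop.1 (eventually_pow_le_exp (600 ^ 7) 7 zero_lt_one)
  obtain ⟨N₄, h₄⟩ := Filter.eventually_atTop.1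
    (eventually_mul_pow_le_pow (4 * 600 ^ 200 + 16 * 601 * 600 ^ 110 + 6) (show 107 < 108 by norm_num))
  refine ⟨max 6 (max N₁ (max N₂ (max N₃ N₄))), fun σ J hT hNJ j hJj hS y hy htr => ?_⟩
  simp only [max_le_iff] at hNJ
  obtain ⟨hJ, hn1, hn2, hn3, hn4⟩ := hNJ
  have hj : 5 ≤ j := by omega
  have hj' : (1 : ℝ) ≤ j := by exact_mod_cast (by omega : 1 ≤ j)
  have hj0 : (0 : ℝ) < j := by linarith
  have hF := hT.frame j hJj
  have hpsi := fun k (hk : k ≤ 600 * j) => sum_Psi_le hj hJ hJj hT hS hy (fun k hk => h₁ k (hn1.trans hk))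
    (fun k hk hn T hM => h₂ σ J hT j k (hn2.trans hJj) (hn2.trans hk) hJj hk hn T hM) htr hk
  obtain ⟨M, hRM, hM⟩ := exists_uniform_VNorm_sq_eq σ J (numPts j) (600 * j + 1)
    (fun a => lc j y (gv σ j a))
  set late : Vb → ℝ := fun x => ∑ r ∈ Finset.Ico (600 * j + 1) M, Sm σ J r x with hlate
  set q : Vb → ℝ := fun x => ∑ r ∈ (Finset.range (600 * j + 1)).filter (6 ≤ ·), QV r x ^ 2 with hq
  set s : Vb → ℝ := fun x => ∑ k ∈ Finset.range (600 * j + 1), Psi σ J k x with hs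
  set L : ℝ := 7 * Real.log (600 * j : ℕ) with hL
  have hL1 : 1 ≤ L := by
    have := one_le_log (show 3 ≤ 600 * j by omega)
    linarith
  have hLj : L ≤ j := by
    have h := h₃ j (hn3.trans hJj)
    rw [one_mul, ← mul_pow] at h
    have h2 := Real.log_le_log (by positivity) h
    rw [Real.log_exp, Real.log_pow] at h2
    rw [hL]; push_cast at h2 ⊢; exact h2
  have hptw : ∀ a ∈ Finset.range (numPts j), VNorm (Nr σ J) (lc j y (gv σ j a)) ≤
      ((j : ℝ) ^ 105 + ((j : ℝ) ^ 105)⁻¹ * late (lc j y (gv σ j a))) +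
        L * (1 + q (lc j y (gv σ j a)) + 2 * s (lc j y (gv σ j a))) := fun a ha => by
    refine le_of_sq_le_early_late ?_ (Finset.sum_nonneg fun _ _ => Sm_nonneg _ _ _ _) hL1
      (Finset.sum_nonneg fun _ _ => sq_nonneg _) (Finset.sum_nonneg fun _ _ => Psi_nonneg _ _ _ _)
      (by positivity)
    rw [hM a (Finset.mem_range.1 ha), ← Finset.sum_range_add_sum_Ico _ hRM, add_comm]
    exact add_le_add le_rfl (sum_Sm_early_le σ (by omega) _ _)
  have hlate_le : ∑ a ∈ Finset.range (numPts j), late (lc j y (gv σ j a)) ≤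
      numPts j * ((j : ℝ) ^ 105 * (4 * 600 ^ 200 * (j : ℝ) ^ 103)) := by
    have h1 : AvgBd σ j ((j : ℝ) ^ 2 * ((2 : ℝ) ^ j) ^ (et (600 * j) / 2)) late :=
      avgBd_sum _ fun r hr => avgBd_Sm (by omega) hF (by omega) (Finset.mem_Ico.1 hr).1
    refine (h1.sum_le (by positivity) hS hy fun x => sum_Sm_le σ J x _).trans (le_of_eq ?_)
    rw [two_pow_rpow_half_et (by omega)]
    ring
  have hq_le : ∑ a ∈ Finset.range (numPts j), q (lc j y (gv σ j a)) ≤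
      numPts j * ((j : ℝ) ^ 2 * (4 * (j : ℝ) ^ 6)) := by
    have h1 : AvgBd σ j ((j : ℝ) ^ 2) q :=
      avgBd_sum _ fun r _ => (avgBd_EucN (by omega) hF r).comp (projTo (VIdx r))
    exact h1.sum_le (by positivity) hS hy fun x => sum_QV_le σ J _ x
  have hs_le : ∑ a ∈ Finset.range (numPts j), s (lc j y (gv σ j a)) ≤
      numPts j * (8 * 601 * 600 ^ 110 * (j : ℝ) ^ 106) := by
    rw [hs, Finset.sum_comm]
    refine (Finset.sum_le_card_nsmul _ _ _ fun k hk =>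
      hpsi k (by rw [Finset.mem_range] at hk; omega)).trans ?_
    rw [Finset.card_range, nsmul_eq_mul]
    have h1 : ((600 * j + 1 : ℕ) : ℝ) ≤ 601 * j := by push_cast; linarith
    refine (mul_le_mul_of_nonneg_right h1 (by positivity)).trans (le_of_eq (by ring))
  have hp : ∀ m ≤ 107, (j : ℝ) ^ m ≤ (j : ℝ) ^ 107 := fun m hm => pow_le_pow_right₀ hj' hm
  refine (Finset.sum_le_sum hptw).trans ?_
  simp only [Finset.sum_add_distrib, ← Finset.mul_sum, Finset.sum_const, Finset.card_range,
    nsmul_eq_mul, mul_one]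
  have e1 : ((j : ℝ) ^ 105)⁻¹ * ∑ a ∈ Finset.range (numPts j), late (lc j y (gv σ j a)) ≤
      numPts j * (4 * 600 ^ 200 * (j : ℝ) ^ 107) := by
    rw [inv_mul_le_iff₀ (by positivity)]
    refine hlate_le.trans ?_
    rw [mul_left_comm]
    refine mul_le_mul_of_nonneg_left (mul_le_mul_of_nonneg_left ?_ (by positivity)) (by positivity)
    exact mul_le_mul_of_nonneg_left (hp 103 (by norm_num)) (by positivity)
  have e2 : L * (numPts j + ∑ a ∈ Finset.range (numPts j), q (lc j y (gv σ j a)) +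
      2 * ∑ a ∈ Finset.range (numPts j), s (lc j y (gv σ j a))) ≤
      numPts j * ((5 + 16 * 601 * 600 ^ 110) * (j : ℝ) ^ 107) := by
    have h1 : (numPts j : ℝ) + ∑ a ∈ Finset.range (numPts j), q (lc j y (gv σ j a)) +
        2 * ∑ a ∈ Finset.range (numPts j), s (lc j y (gv σ j a)) ≤
        numPts j * ((5 + 16 * 601 * 600 ^ 110) * (j : ℝ) ^ 106) := by
      have h8 : (j : ℝ) ^ 2 * (4 * (j : ℝ) ^ 6) ≤ 4 * (j : ℝ) ^ 106 := by
        rw [mul_left_comm, ← pow_add]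
        exact mul_le_mul_of_nonneg_left (pow_le_pow_right₀ hj' (by norm_num)) (by norm_num)
      have h9 := mul_le_mul_of_nonneg_left h8 (show (0 : ℝ) ≤ numPts j by positivity)
      have h10 := mul_le_mul_of_nonneg_left (one_le_pow₀ (n := 106) hj') (show (0 : ℝ) ≤ numPts j by positivity)
      linarith
    refine (mul_le_mul_of_nonneg_left h1 (by linarith)).trans ?_
    refine (mul_le_mul_of_nonneg_right hLj (by positivity)).trans (le_of_eq ?_)
    ring
  have e3 := mul_le_mul_of_nonneg_left (hp 105 (by norm_num)) (show (0 : ℝ) ≤ numPts j by positivity)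
  have e4 := mul_le_mul_of_nonneg_left (h₄ j (hn4.trans hJj)) (show (0 : ℝ) ≤ numPts j by positivity)
  linarith

/-! ### Vectors joining two consecutive levels -/

/-- The multiple of the point `a` of level `j` normalized by the functional `Gc σ J j a`. -/
def xv (σ : Signs) (J j a : ℕ) : Vb := zv j fun i => (Dc J j)⁻¹ * gv σ j a i

theorem Dc_pos {J j : ℕ} (hj : 1 ≤ j) (h : J ≤ j) : 0 < Dc J j := by
  rw [Dc_of_le h]
  have : (0 : ℝ) < j := by exact_mod_cast hj
  positivity

theorem one_le_Dc {J j : ℕ} (hj : 1 ≤ j) (h : J ≤ j) : 1 ≤ Dc J j := by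
  rw [Dc_of_le h]
  exact one_le_pow₀ (by exact_mod_cast hj)

theorem ip_mul_right (n : ℕ) (x y : ℕ → ℝ) (c : ℝ) : ip n x (fun i => c * y i) = c * ip n x y := by
  unfold ip
  rw [Finset.mul_sum]
  exact Finset.sum_congr rfl fun i _ => by ring

theorem ssq_mul (n : ℕ) (y : ℕ → ℝ) (c : ℝ) : ssq n (fun i => c * y i) = c ^ 2 * ssq n y := by
  unfold ssq
  rw [Finset.mul_sum]
  exact Finset.sum_congr rfl fun i _ => by ring

theorem Gc_xv (σ : Signs) {J j : ℕ} (hj : 5 ≤ j) (h : J ≤ j) (a b : ℕ) :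
    Gc σ J j b (xv σ J j a) = ip (2 ^ j) (gv σ j b) (gv σ j a) := by
  have := (Dc_pos (by omega) h).ne'
  rw [xv, Gc_zv σ J hj, ip_mul_right, mul_inv_cancel_left₀ this]

theorem Gc_xv_self (σ : Signs) {J j : ℕ} (hj : 5 ≤ j) (h : J ≤ j) (a : ℕ) :
    Gc σ J j a (xv σ J j a) = 1 := by
  rw [Gc_xv σ hj h, ip_self, ssq_gv]

theorem Gc_xv_of_ne (σ : Signs) (J : ℕ) {j k : ℕ} (hj : 1 ≤ j) (hk : 1 ≤ k) (h : k ≠ j) (a b : ℕ) :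
    Gc σ J k b (xv σ J j a) = 0 := Gc_zv_of_ne σ J hj hk h _ _

theorem Spread.Psi_xv_le {σ : Signs} {J j : ℕ} (hS : Spread σ J j) (hj : 5 ≤ j) (h : J ≤ j) {a : ℕ}
    (ha : a < numPts j) : Psi σ J j (xv σ J j a) ≤ 3 := by
  have h1 := (hS.comb {a} (by simpa using ha) (by simp [Nat.one_le_two_pow]) fun _ => (Dc J j)⁻¹).2
  have hD := Dc_pos (by omega) h
  simp only [Finset.sum_singleton, Real.sqrt_sq (inv_nonneg.2 hD.le)] at h1
  rw [xv, Psi_zv σ J hj]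
  refine h1.trans (le_of_eq ?_)
  field_simp

theorem QV_xv_sq_le (σ : Signs) {J j : ℕ} (hj : 5 ≤ j) (h : J ≤ j) (r a : ℕ) :
    QV r (xv σ J j a) ^ 2 ≤ 1 := by
  refine (QV_zv_sq_le hj r _).trans ?_
  rw [ssq_mul, ssq_gv, mul_one, inv_pow]
  exact inv_le_one_of_one_le₀ (one_le_pow₀ (one_le_Dc (by omega) h))

/-- Away from the diagonal the pairings at one level are small in `ℓ_p`. -/
theorem Spread.lpn_off_le {σ : Signs} {J j : ℕ} (hS : Spread σ J j) (hj : 1 ≤ j) (h : J ≤ j)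
    (het : et j ≤ 1) {a : ℕ} (ha : a < numPts j) {q : ℝ} (hq : px J j ≤ q) {n : ℕ} {f : ℕ → ℕ}
    (hf : Function.Injective f) (hfn : ∀ b < n, f b < numPts j) :
    lpn q n (fun b => if f b = a then 0 else ip (2 ^ j) (gv σ j (f b)) (gv σ j a)) ≤ (j : ℝ)⁻¹ := by
  have hj' : (1 : ℝ) ≤ j := by exact_mod_cast hj
  have hp := px_pos J j
  refine (lpn_antitone hp hq n _).trans ((lpn_comp_le hp hf hfn
    (fun b => if b = a then 0 else ip (2 ^ j) (gv σ j b) (gv σ j a))).trans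
    (lpn_le_of_sum_le hp (by positivity) ?_))
  rw [← Finset.add_sum_erase _ _ (Finset.mem_range.2 ha)]
  have e : ∑ b ∈ (Finset.range (numPts j)).erase a,
      |if b = a then 0 else ip (2 ^ j) (gv σ j b) (gv σ j a)| ^ px J j =
      ∑ b ∈ (Finset.range (numPts j)).erase a, |ip (2 ^ j) (gv σ j b) (gv σ j a)| ^ px J j :=
    Finset.sum_congr rfl fun b hb => by rw [if_neg (Finset.ne_of_mem_erase hb)]
  rw [e, if_pos rfl, abs_zero, Real.zero_rpow hp.ne', zero_add]
  refine (hS.off a ha).trans ?_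
  rw [← inv_pow, ← Real.rpow_natCast]
  refine Real.rpow_le_rpow_of_exponent_ge (by positivity) (inv_le_one_of_one_le₀ hj') ?_
  rw [px_of_le h]; push_cast; linarith

/-- The sum of matching points of the levels `j` and `j + 1`. -/
def wv (σ : Signs) (J j a : ℕ) : Vb := xv σ J j (2 * a) + xv σ J (j + 1) (2 * a + 1)

theorem EucN_add_le (r : ℕ) (x y : Vb) : EucN r (x + y) ≤ EucN r x + EucN r y := by
  unfold EucN
  simp only [map_add]
  exact lpn_add_le (by norm_num) _ _ _

theorem QV_add_le (r : ℕ) (x y : Vb) : QV r (x + y) ≤ QV r x + QV r y := by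
  unfold QV
  rw [map_add]
  exact EucN_add_le _ _ _

theorem Psi_add_le (σ : Signs) (J k : ℕ) (x y : Vb) : Psi σ J k (x + y) ≤ Psi σ J k x + Psi σ J k y := by
  unfold Psi
  simp only [map_add]
  exact lpn_add_le (one_le_px J k) _ _ _

theorem numPts_even {j a : ℕ} (ha : a < numPts j / 2) : 2 * a + 1 < numPts j := by omega

section
variable {σ : Signs} {J j a : ℕ}

theorem Psi_wv_le (hj : 6 ≤ j) (hJ : J ≤ j) (hS : Spread σ J j) (hS' : Spread σ J (j + 1))
    (ha : a < numPts j / 2) {k : ℕ} (hk : 1 ≤ k) :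
    Psi σ J k (wv σ J j a) ≤ if k = j ∨ k = j + 1 then 3 else 0 := by
  have h1 := numPts_even ha
  have h2 := numPts_mono (show j ≤ j + 1 by omega)
  refine (Psi_add_le σ J k _ _).trans ?_
  rcases eq_or_ne k j with rfl | hkj
  · have := hS.Psi_xv_le (by omega) hJ (show 2 * a < numPts k by omega)
    have h0 : Psi σ J k (xv σ J (k + 1) (2 * a + 1)) = 0 :=
      Psi_zv_of_ne σ J (by omega) hk (by omega) _
    simp only [true_or, if_true]
    linarith
  · have h0 : Psi σ J k (xv σ J j (2 * a)) = 0 := Psi_zv_of_ne σ J (by omega) hk hkj _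
    rcases eq_or_ne k (j + 1) with rfl | hkj'
    · have := hS'.Psi_xv_le (by omega) (by omega) (show 2 * a + 1 < numPts (j + 1) by omega)
      simp only [or_true, if_true]
      linarith
    · have h0' : Psi σ J k (xv σ J (j + 1) (2 * a + 1)) = 0 :=
        Psi_zv_of_ne σ J (by omega) hk hkj' _
      simp [hkj, hkj', h0, h0']

theorem TieN_wv_le (hj : 6 ≤ j) (hJ3 : 3 ≤ J) (hJ : J ≤ j) (het : ∀ k, J ≤ k → et k ≤ 1)
    (hS : Spread σ J j) (hS' : Spread σ J (j + 1)) (ha : a < numPts j / 2) {r : ℕ} (hr : 2 ≤ r) :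
    TieN σ J r (wv σ J j a) ≤ if r = j ∨ r = j + 1 ∨ r = j + 2 then 2 * (j : ℝ)⁻¹ else 0 := by
  have h1 := numPts_even ha
  have h2 := numPts_mono (show j ≤ j + 1 by omega)
  have hinv : ((j + 1 : ℕ) : ℝ)⁻¹ ≤ (j : ℝ)⁻¹ := by
    have : (0 : ℝ) < j := by exact_mod_cast (by omega : 0 < j)
    refine inv_anti₀ this ?_
    push_cast; linarith
  have hj0 : (0 : ℝ) ≤ (j : ℝ)⁻¹ := by positivity
  have inj0 : Function.Injective fun b : ℕ => 2 * b := fun x y h => by simpa using h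
  have inj1 : Function.Injective fun b : ℕ => 2 * b + 1 := fun x y h => by simpa using h
  have hT : ∀ b, Tie σ J r b (wv σ J j a) =
      Gc σ J (r - 1) (2 * b) (wv σ J j a) - Gc σ J r (2 * b + 1) (wv σ J j a) := fun b => rfl
  have hG : ∀ k b, 1 ≤ k → Gc σ J k b (wv σ J j a) =
      if k = j then ip (2 ^ j) (gv σ j b) (gv σ j (2 * a)) else
      if k = j + 1 then ip (2 ^ (j + 1)) (gv σ (j + 1) b) (gv σ (j + 1) (2 * a + 1)) else 0 := by
    intro k b hk
    rw [wv, map_add]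
    split_ifs with e e
    · subst e
      rw [Gc_xv σ (by omega) hJ, Gc_xv_of_ne σ J (by omega) hk (by omega), add_zero]
    · subst e
      rw [Gc_xv σ (by omega) (by omega), Gc_xv_of_ne σ J (by omega) hk (by omega), zero_add]
    · rw [Gc_xv_of_ne σ J (by omega) hk e, Gc_xv_of_ne σ J (by omega) hk (by omega), zero_add]
  unfold TieN
  simp only [hT, hG _ _ (show 1 ≤ r - 1 by omega), hG _ _ (show 1 ≤ r by omega)]
  rcases eq_or_ne r j with rfl | hrj
  · have h3 := hS.lpn_off_le (by omega) hJ (het _ hJ) (show 2 * a < numPts r by omega)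
      (px_antitone hJ3 (show r - 1 ≤ r by omega)) (n := numPts (r - 1) / 2) inj1 fun b hb => by
        have := numPts_mono (show r - 1 ≤ r by omega)
        omega
    rw [if_pos (by simp)]
    refine le_trans (le_of_eq ?_) (h3.trans (by linarith))
    rw [← lpn_neg]
    refine lpn_congr fun b _ => ?_
    rw [if_neg (by omega), if_neg (by omega), if_pos rfl, if_neg (by omega)]
    ring
  rcases eq_or_ne r (j + 1) with rfl | hrj'
  · have h3 := hS.lpn_off_le (by omega) hJ (het _ hJ) (show 2 * a < numPts j by omega)
      (le_refl (px J j)) (n := numPts j / 2) inj0 fun b hb => by omega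
    have h4 := hS'.lpn_off_le (by omega) (by omega) (het _ (by omega))
      (show 2 * a + 1 < numPts (j + 1) by omega) (px_antitone hJ3 (show j ≤ j + 1 by omega))
      (n := numPts j / 2) inj1 fun b hb => by omega
    rw [if_pos (by simp), Nat.add_sub_cancel]
    have h5 := (lpn_sub_le (one_le_px J j) (numPts j / 2)
      (fun b => if 2 * b = 2 * a then 0 else ip (2 ^ j) (gv σ j (2 * b)) (gv σ j (2 * a)))
      (fun b => if 2 * b + 1 = 2 * a + 1 then 0 else
        ip (2 ^ (j + 1)) (gv σ (j + 1) (2 * b + 1)) (gv σ (j + 1) (2 * a + 1)))).trans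
      (add_le_add h3 h4)
    refine le_trans (le_of_eq ?_) (h5.trans (by linarith))
    refine lpn_congr fun b _ => ?_
    rw [if_pos (show j = j from rfl), if_neg (show ¬ (j + 1 = j) by omega),
      if_pos (show j + 1 = j + 1 from rfl)]
    rcases eq_or_ne b a with rfl | hba
    · rw [if_pos (show 2 * b = 2 * b from rfl), if_pos (show 2 * b + 1 = 2 * b + 1 from rfl),
        ip_self, ip_self, ssq_gv, ssq_gv, sub_self, sub_self]
    · rw [if_neg (show ¬ (2 * b = 2 * a) by omega),
        if_neg (show ¬ (2 * b + 1 = 2 * a + 1) by omega)]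
  rcases eq_or_ne r (j + 2) with rfl | hrj''
  · have h4 := hS'.lpn_off_le (by omega) (by omega) (het _ (by omega))
      (show 2 * a + 1 < numPts (j + 1) by omega) (le_refl (px J (j + 1)))
      (n := numPts (j + 1) / 2) inj0 fun b hb => by omega
    rw [if_pos (by simp), show j + 2 - 1 = j + 1 by omega]
    refine le_trans (le_of_eq ?_) (h4.trans (by linarith))
    refine lpn_congr fun b _ => ?_
    rw [if_neg (by omega), if_pos rfl, if_neg (by omega), if_neg (by omega), if_neg (by omega), sub_zero]
  · rw [if_neg (by simp [hrj, hrj', hrj'']), lpn_zero (px_pos _ _)]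
    intro b _
    rw [if_neg (by omega), if_neg (by omega), if_neg (by omega), if_neg (by omega), sub_zero]

theorem Sm_wv_le (hj : 6 ≤ j) (hJ3 : 3 ≤ J) (hJ : J ≤ j) (het : ∀ k, J ≤ k → et k ≤ 1)
    (hS : Spread σ J j) (hS' : Spread σ J (j + 1)) (ha : a < numPts j / 2) (r : ℕ) :
    Sm σ J r (wv σ J j a) ≤ if r ∈ ({j, j + 1, j + 2} : Finset ℕ) then 61 else 0 := by
  by_cases hr : 6 ≤ r
  swap
  · rw [Sm, if_neg hr]; split_ifs <;> norm_num
  refine (Sm_le σ hJ3 hr _).trans ?_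
  have hpsi := Psi_wv_le hj hJ hS hS' ha (show 1 ≤ r by omega)
  have htie := TieN_wv_le hj hJ3 hJ het hS hS' ha (show 2 ≤ r by omega)
  have hq := QV_add_le r (xv σ J j (2 * a)) (xv σ J (j + 1) (2 * a + 1))
  rw [← wv] at hq
  have hp0 := Psi_nonneg σ J r (wv σ J j a)
  have ht0 := TieN_nonneg σ J r (wv σ J j a)
  have hq0 := QV_nonneg r (wv σ J j a)
  split_ifs with hm
  · have e1 : Psi σ J r (wv σ J j a) ^ 2 ≤ 9 := by
      have : Psi σ J r (wv σ J j a) ≤ 3 := hpsi.trans (by split_ifs <;> norm_num)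
      nlinarith
    have e2 : QV r (wv σ J j a) ^ 2 ≤ 4 := by
      have h1 := abs_le_of_sq_le_sq (show QV r (xv σ J j (2 * a)) ^ 2 ≤ 1 ^ 2 by
        rw [one_pow]; exact QV_xv_sq_le σ (by omega) hJ r _) zero_le_one
      have h2 := abs_le_of_sq_le_sq (show QV r (xv σ J (j + 1) (2 * a + 1)) ^ 2 ≤ 1 ^ 2 by
        rw [one_pow]; exact QV_xv_sq_le σ (by omega) (by omega) r _) zero_le_one
      have : QV r (wv σ J j a) ≤ 2 := by linarith [le_abs_self (QV r (xv σ J j (2 * a))), le_abs_self (QV r (xv σ J (j + 1) (2 * a + 1)))]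
      nlinarith
    have e3 : Real.log r * TieN σ J r (wv σ J j a) ^ 2 ≤ 4 := by
      have hj' : (6 : ℝ) ≤ j := by exact_mod_cast hj
      have hrj : r ≤ j + 2 := by
        simp only [Finset.mem_insert, Finset.mem_singleton] at hm; omega
      have hrj' : (r : ℝ) ≤ j + 2 := by exact_mod_cast hrj
      have h1 : TieN σ J r (wv σ J j a) ≤ 2 * (j : ℝ)⁻¹ :=
        htie.trans (by split_ifs; exact le_rfl; positivity)
      have h2 : Real.log r ≤ 2 * j := (Real.log_le_self (by positivity)).trans (by linarith)
      calc Real.log r * TieN σ J r (wv σ J j a) ^ 2 ≤ 2 * j * (2 * (j : ℝ)⁻¹) ^ 2 :=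
            mul_le_mul h2 (pow_le_pow_left₀ ht0 h1 2) (by positivity) (by positivity)
        _ = 8 * (j : ℝ)⁻¹ := by field_simp; norm_num
        _ ≤ 4 := by
          have : (j : ℝ)⁻¹ ≤ 6⁻¹ := inv_anti₀ (by norm_num) hj'
          linarith
    linarith
  · simp only [Finset.mem_insert, Finset.mem_singleton, not_or] at hm
    obtain ⟨m1, m2, m3⟩ := hm
    rw [if_neg (by simp [m1, m2])] at hpsi
    rw [if_neg (by simp [m1, m2, m3])] at htie
    have q1 : QV r (xv σ J j (2 * a)) = 0 := QV_zv_of_ne (by omega) m1 m2 _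
    have q2 : QV r (xv σ J (j + 1) (2 * a + 1)) = 0 := QV_zv_of_ne (by omega) m2 m3 _
    rw [q1, q2, add_zero] at hq
    rw [le_antisymm hq hq0, le_antisymm hpsi hp0, le_antisymm htie ht0]
    norm_num

theorem VNorm_wv_le (hj : 6 ≤ j) (hJ3 : 3 ≤ J) (hJ : J ≤ j) (het : ∀ k, J ≤ k → et k ≤ 1)
    (hS : Spread σ J j) (hS' : Spread σ J (j + 1)) (ha : a < numPts j / 2) :
    VNorm (Nr σ J) (wv σ J j a) ≤ 14 := by
  obtain ⟨R, hR⟩ := VNorm_sq_eq σ J (wv σ J j a)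
  refine le_of_sq_le_sq ?_ (by norm_num)
  rw [hR R le_rfl]
  refine (Finset.sum_le_sum fun r _ => Sm_wv_le hj hJ3 hJ het hS hS' ha r).trans ?_
  rw [← Finset.sum_filter, Finset.sum_const, nsmul_eq_mul]
  have h1 : ((Finset.range R).filter (· ∈ ({j, j + 1, j + 2} : Finset ℕ))).card ≤ 3 :=
    (Finset.card_le_card fun r hr => (Finset.mem_filter.1 hr).2).trans Finset.card_le_three
  have : (((Finset.range R).filter (· ∈ ({j, j + 1, j + 2} : Finset ℕ))).card : ℝ) ≤ 3 := by
    exact_mod_cast h1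
  linarith

end

/-! ### Operators on the completion -/

section
variable {R : Type} [NormedAddCommGroup R] [NormedSpace ℝ R] {eV : Vb →ₗ[ℝ] R} {σ : Signs} {J : ℕ}

theorem extend_apply (he : ∀ x, ‖eV x‖ = VNorm (Nr σ J) x) (hd : DenseRange eV) {f : Vb →ₗ[ℝ] ℝ} {C : ℝ}
    (hf : ∀ x, |f x| ≤ C * VNorm (Nr σ J) x) (x : Vb) : f.extendOfNorm eV (eV x) = f x :=
  LinearMap.extendOfNorm_eq hd ⟨C, fun y => by rw [he]; exact hf y⟩ x

theorem abs_extend_le (he : ∀ x, ‖eV x‖ = VNorm (Nr σ J) x) (hd : DenseRange eV) {f : Vb →ₗ[ℝ] ℝ} {C : ℝ}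
    (hf : ∀ x, |f x| ≤ C * VNorm (Nr σ J) x) (y : R) : |f.extendOfNorm eV y| ≤ C * ‖y‖ :=
  LinearMap.norm_extendOfNorm_apply_le (f := f) (e := eV) hd C (fun y => by rw [he]; exact hf y) y

theorem abs_cf_le_one_mul (σ : Signs) (J : ℕ) {k i : ℕ} (hk : 6 ≤ k) (hi : i < 2 ^ k) (x : Vb) :
    |cf (posn k i) x| ≤ 1 * VNorm (Nr σ J) x := by
  rw [one_mul]; exact abs_cf_le σ J hk hi x

/-- The extension to the completion of the coordinate functional at `posn j i`. -/
def crd (eV : Vb →ₗ[ℝ] R) (j i : ℕ) : R →L[ℝ] ℝ := (cf (posn j i)).extendOfNorm eV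

theorem sum_abs_le {n : ℕ} (u : ℕ → ℝ) : ∑ i ∈ Finset.range n, |u i| ≤ n * √(ssq n u) := by
  refine (Finset.sum_le_card_nsmul _ _ (√(ssq n u)) fun i hi => ?_).trans (by simp)
  refine Real.abs_le_sqrt ?_
  exact Finset.single_le_sum (f := fun i => u i ^ 2) (fun _ _ => sq_nonneg _) hi

theorem eV_zv (j : ℕ) (u : ℕ → ℝ) :
    eV (zv j u) = ∑ i ∈ Finset.range (2 ^ j), u i • eV (eb (posn j i)) := by
  simp [zv]

theorem eV_lc (j : ℕ) (y : ℕ → Vb) (u : ℕ → ℝ) :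
    eV (lc j y u) = ∑ i ∈ Finset.range (2 ^ j), u i • eV (y i) := by
  simp [lc]

theorem VNorm_eb_le (hJ : 3 ≤ J) {j : ℕ} (hj : 14 ≤ j) (hS : Spread σ J j) {i : ℕ} (hi : i < 2 ^ j) :
    VNorm (Nr σ J) (eb (posn j i)) ≤ 2 * j := by
  have h := VNorm_zv_le σ hJ hj fun i' => if i' = i then 1 else 0
  have e : zv j (fun i' => if i' = i then 1 else 0) = eb (posn j i) := by simp [zv, hi]
  rw [e, ssq_unit hi, Real.sqrt_one] at h
  have := mul_le_mul_of_nonneg_left (hS.unit i hi) (Nat.cast_nonneg (α := ℝ) j)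
  linarith

theorem norm_sum_smul_le (n : ℕ) (u : ℕ → ℝ) (d : ℕ → R) {τ : ℝ} (hd : ∀ i < n, ‖d i‖ ≤ τ) :
    ‖∑ i ∈ Finset.range n, u i • d i‖ ≤ (∑ i ∈ Finset.range n, |u i|) * τ := by
  refine (norm_sum_le _ _).trans ?_
  rw [Finset.sum_mul]
  refine Finset.sum_le_sum fun i hi => ?_
  rw [norm_smul, Real.norm_eq_abs]
  exact mul_le_mul_of_nonneg_left (hd i (Finset.mem_range.1 hi)) (abs_nonneg _)

theorem sum_norm_sub_le_of_contraction (he : ∀ x, ‖eV x‖ = VNorm (Nr σ J) x) (hd : DenseRange eV) {j : ℕ}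
    (hJ : 3 ≤ J) (hj : 14 ≤ j) (hS : Spread σ J j)
    (havg : ∀ y, Tame σ J j y → ∑ i ∈ Finset.range (2 ^ j), cf (posn j i) (y i) = 0 →
      ∑ a ∈ Finset.range (numPts j), VNorm (Nr σ J) (lc j y (gv σ j a)) ≤ numPts j * (j : ℝ) ^ 108)
    (t : ℕ → R) (ht : ∀ u, ‖∑ i ∈ Finset.range (2 ^ j), u i • t i‖ ≤ VNorm (Nr σ J) (zv j u)) :
    ∑ a ∈ Finset.range (numPts j), ‖∑ i ∈ Finset.range (2 ^ j), gv σ j a i • t i -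
      ((∑ i ∈ Finset.range (2 ^ j), crd eV j i (t i)) / 2 ^ j) • eV (zv j (gv σ j a))‖ ≤
      2 * (numPts j * (j : ℝ) ^ 108) := by
  have hj' : (14 : ℝ) ≤ j := by exact_mod_cast hj
  have h2j : (0 : ℝ) < 2 ^ j := by positivity
  set lam := (∑ i ∈ Finset.range (2 ^ j), crd eV j i (t i)) / 2 ^ j with hlam
  set B : ℝ := 2 ^ j * (1 + 2 * j) with hB
  have hB0 : 0 < B := by positivity
  set τ : ℝ := B⁻¹ with hτ
  have hτ0 : 0 < τ := by positivity
  have hτB : τ * B = 1 := inv_mul_cancel₀ hB0.ne'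
  have happ : ∀ i, ∃ v, ‖t i - eV v‖ ≤ τ := fun i => by
    obtain ⟨v, hv⟩ := hd.exists_dist_lt (t i) hτ0
    exact ⟨v, by rw [← dist_eq_norm]; exact hv.le⟩
  choose v hv using happ
  set lam' := (∑ i ∈ Finset.range (2 ^ j), cf (posn j i) (v i)) / 2 ^ j with hlam'
  have hcrd : ∀ i < 2 ^ j, ∀ x, crd eV j i (eV x) = cf (posn j i) x := fun i hi x =>
    extend_apply he hd (abs_cf_le_one_mul σ J (by omega) hi) x
  have hcrd_le : ∀ i < 2 ^ j, ∀ x, |crd eV j i x| ≤ ‖x‖ := fun i hi x => by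
    exact (abs_extend_le he hd (abs_cf_le_one_mul σ J (by omega) hi) x).trans_eq (one_mul _)
  have heb : ∀ i < 2 ^ j, ‖eV (eb (posn j i))‖ ≤ 2 * j := fun i hi => by
    rw [he]; exact VNorm_eb_le hJ hj hS hi
  have hti : ∀ i < 2 ^ j, ‖t i‖ ≤ 2 * j := fun i hi => by
    have h := ht fun i' => if i' = i then 1 else 0
    have e : zv j (fun i' => if i' = i then 1 else 0) = eb (posn j i) := by simp [zv, hi]
    rw [e] at h
    simpa [hi] using h.trans (VNorm_eb_le hJ hj hS hi)
  have hmean : ∀ (f : ℕ → ℝ) (c : ℝ), (∀ i < 2 ^ j, |f i| ≤ c) →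
      |(∑ i ∈ Finset.range (2 ^ j), f i) / 2 ^ j| ≤ c := fun f c hf => by
    rw [abs_div, abs_of_pos h2j, div_le_iff₀ h2j, mul_comm]
    refine (Finset.abs_sum_le_sum_abs _ _).trans ((Finset.sum_le_card_nsmul _ _ c fun i hi =>
      hf i (Finset.mem_range.1 hi)).trans (by simp))
  have hdiff : |lam - lam'| ≤ τ := by
    rw [hlam, hlam', ← sub_div, ← Finset.sum_sub_distrib]
    refine hmean _ _ fun i hi => ?_
    rw [← hcrd i hi, ← map_sub]
    exact (hcrd_le i hi _).trans (hv i)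
  have hlam_le : |lam| ≤ 2 * j := hmean _ _ fun i hi => (hcrd_le i hi _).trans (hti i hi)
  set y : ℕ → Vb := fun i => v i - lam' • eb (posn j i) with hy
  set d : ℕ → R := fun i => (eV (v i) - t i) + (lam - lam') • eV (eb (posn j i)) with hdd
  have hd_le : ∀ i < 2 ^ j, ‖d i‖ ≤ τ * (1 + 2 * j) := fun i hi => by
    refine (norm_add_le _ _).trans ?_
    rw [norm_sub_rev, norm_smul, Real.norm_eq_abs, mul_add, mul_one]
    exact add_le_add (hv i) (mul_le_mul hdiff (heb i hi) (norm_nonneg _) hτ0.le)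
  have hdec : ∀ u, eV (lc j y u) = (∑ i ∈ Finset.range (2 ^ j), u i • t i - lam • eV (zv j u)) +
      ∑ i ∈ Finset.range (2 ^ j), u i • d i := fun u => by
    rw [eV_lc, eV_zv, Finset.smul_sum, ← Finset.sum_sub_distrib, ← Finset.sum_add_distrib]
    refine Finset.sum_congr rfl fun i _ => ?_
    rw [hy, hdd]
    simp only [map_sub, map_smul]
    module
  have hsmall : ∀ u, ‖∑ i ∈ Finset.range (2 ^ j), u i • d i‖ ≤ √(ssq (2 ^ j) u) := fun u => by
    refine (norm_sum_smul_le _ u d hd_le).trans ?_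
    have h1 := sum_abs_le (n := 2 ^ j) u
    push_cast at h1
    calc (∑ i ∈ Finset.range (2 ^ j), |u i|) * (τ * (1 + 2 * j)) ≤
          2 ^ j * √(ssq (2 ^ j) u) * (τ * (1 + 2 * j)) :=
          mul_le_mul_of_nonneg_right h1 (by positivity)
      _ = τ * B * √(ssq (2 ^ j) u) := by rw [hB]; ring
      _ = √(ssq (2 ^ j) u) := by rw [hτB, one_mul]
  have htame : Tame σ J j y := fun u => by
    rw [← he, hdec]
    have h1 := VNorm_zv_le σ hJ hj u
    set s := √(ssq (2 ^ j) u) with hs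
    have hs0 : 0 ≤ s := Real.sqrt_nonneg _
    have hp0 := phi_nonneg σ J j u
    have h2 : ‖lam • eV (zv j u)‖ ≤ 2 * j * VNorm (Nr σ J) (zv j u) := by
      rw [norm_smul, he, Real.norm_eq_abs]
      exact mul_le_mul_of_nonneg_right hlam_le (VNorm_nonneg _ _)
    calc _ ≤ (VNorm (Nr σ J) (zv j u) + 2 * j * VNorm (Nr σ J) (zv j u)) + s :=
          (norm_add_le _ _).trans (add_le_add ((norm_sub_le _ _).trans (add_le_add (ht u) h2)) (hsmall u))
      _ = (1 + 2 * j) * VNorm (Nr σ J) (zv j u) + s := by ring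
      _ ≤ (1 + 2 * j) * (j * (s + phi σ J j u)) + (s + phi σ J j u) :=
          add_le_add (mul_le_mul_of_nonneg_left h1 (by positivity)) (by linarith)
      _ = ((1 + 2 * j) * j + 1) * (s + phi σ J j u) := by ring
      _ ≤ (j : ℝ) ^ 3 * (s + phi σ J j u) :=
          mul_le_mul_of_nonneg_right (by nlinarith [sq_nonneg ((j : ℝ) - 14)]) (by positivity)
  have htr : ∑ i ∈ Finset.range (2 ^ j), cf (posn j i) (y i) = 0 := by
    have e : ∀ i ∈ Finset.range (2 ^ j), cf (posn j i) (y i) = cf (posn j i) (v i) - lam' := fun i _ => by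
      rw [hy]
      simp only [map_sub, map_smul]
      rw [cf_eb, if_pos ⟨rfl, lt_posn (by omega)⟩, smul_eq_mul, mul_one]
    rw [Finset.sum_congr rfl e, Finset.sum_sub_distrib, hlam']
    simp
    field_simp
    ring
  have hA := havg y htame htr
  have hone : (1 : ℝ) ≤ (j : ℝ) ^ 108 := one_le_pow₀ (by linarith)
  calc _ ≤ ∑ a ∈ Finset.range (numPts j), (VNorm (Nr σ J) (lc j y (gv σ j a)) + 1) := by
        refine Finset.sum_le_sum fun a _ => ?_
        have h1 := hsmall (gv σ j a)
        rw [ssq_gv, Real.sqrt_one] at h1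
        rw [← he, hdec]
        have := norm_sub_le ((∑ i ∈ Finset.range (2 ^ j), gv σ j a i • t i - lam • eV (zv j (gv σ j a))) +
          ∑ i ∈ Finset.range (2 ^ j), gv σ j a i • d i) (∑ i ∈ Finset.range (2 ^ j), gv σ j a i • d i)
        rw [add_sub_cancel_right] at this
        linarith
    _ ≤ numPts j * (j : ℝ) ^ 108 + numPts j := by
        rw [Finset.sum_add_distrib]; simpa using hA
    _ ≤ _ := by
        have := mul_le_mul_of_nonneg_left hone (Nat.cast_nonneg (α := ℝ) (numPts j))
        linarith

theorem sum_norm_sub_le (he : ∀ x, ‖eV x‖ = VNorm (Nr σ J) x) (hd : DenseRange eV) {j : ℕ}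
    (hJ : 3 ≤ J) (hj : 14 ≤ j) (hS : Spread σ J j)
    (havg : ∀ y, Tame σ J j y → ∑ i ∈ Finset.range (2 ^ j), cf (posn j i) (y i) = 0 →
      ∑ a ∈ Finset.range (numPts j), VNorm (Nr σ J) (lc j y (gv σ j a)) ≤ numPts j * (j : ℝ) ^ 108)
    (t : ℕ → R) {C : ℝ} (hC : 0 ≤ C)
    (ht : ∀ u, ‖∑ i ∈ Finset.range (2 ^ j), u i • t i‖ ≤ C * VNorm (Nr σ J) (zv j u)) :
    ∑ a ∈ Finset.range (numPts j), ‖∑ i ∈ Finset.range (2 ^ j), gv σ j a i • t i -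
      ((∑ i ∈ Finset.range (2 ^ j), crd eV j i (t i)) / 2 ^ j) • eV (zv j (gv σ j a))‖ ≤
      2 * (numPts j * (j : ℝ) ^ 108) * C := by
  rcases hC.eq_or_lt with rfl | hC
  · have h0 : ∀ i ∈ Finset.range (2 ^ j), t i = 0 := fun i hi => by
      have h := ht fun i' => if i' = i then 1 else 0
      have hi' := Finset.mem_range.1 hi
      simpa [hi'] using h
    have e1 : ∀ u : ℕ → ℝ, ∑ i ∈ Finset.range (2 ^ j), u i • t i = 0 := fun u =>
      Finset.sum_eq_zero fun i hi => by rw [h0 i hi, smul_zero]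
    have e2 : ∑ i ∈ Finset.range (2 ^ j), crd eV j i (t i) = 0 :=
      Finset.sum_eq_zero fun i hi => by rw [h0 i hi, map_zero]
    simp [e1, e2]
  · have h := sum_norm_sub_le_of_contraction he hd hJ hj hS havg (fun i => C⁻¹ • t i) fun u => by
      have e : ∑ i ∈ Finset.range (2 ^ j), u i • C⁻¹ • t i =
          C⁻¹ • ∑ i ∈ Finset.range (2 ^ j), u i • t i := by
        rw [Finset.smul_sum]; exact Finset.sum_congr rfl fun i _ => smul_comm _ _ _
      rw [e, norm_smul, Real.norm_eq_abs, abs_of_pos (inv_pos.2 hC), inv_mul_le_iff₀ hC]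
      exact ht u
    rw [← div_le_iff₀ hC, div_eq_mul_inv, Finset.sum_mul]
    refine (le_of_eq (Finset.sum_congr rfl fun a _ => ?_)).trans h
    rw [← abs_of_pos (inv_pos.2 hC), ← Real.norm_eq_abs, mul_comm, ← norm_smul, Real.norm_eq_abs,
      abs_of_pos (inv_pos.2 hC), smul_sub, Finset.smul_sum]
    simp only [map_smul, smul_eq_mul, ← Finset.mul_sum, mul_div_assoc, mul_smul]
    congr 2
    exact Finset.sum_congr rfl fun i _ => smul_comm _ _ _

end

/-! ### The functionals `ξ` -/

section
variable {R : Type} [NormedAddCommGroup R] [NormedSpace ℝ R] {eV : Vb →ₗ[ℝ] R} {σ : Signs} {J : ℕ} {A : Set ℕ}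

theorem WIdx_subset_EIdx {j : ℕ} (hj : 6 ≤ j) : WIdx j ⊆ EIdx j := by
  rintro m ⟨h1, h2⟩
  unfold EIdx
  split_ifs with h
  · subst h
    exact ⟨(aIdx_mono (by norm_num)).trans_lt h1, h2⟩
  · refine ⟨lt_of_le_of_lt ?_ h1, h2⟩
    unfold bIdx aIdx
    rw [show j + 1 - 2 = j - 1 by omega]
    omega

theorem eV_mem_RA (eV : Vb →ₗ[ℝ] R) {j : ℕ} (hj : 6 ≤ j) (hA : j ∈ A) {v : Vb} (hv : SuppIn v (WIdx j)) :
    eV v ∈ RA eV A := by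
  refine Submodule.le_topologicalClosure _ (Submodule.subset_span ⟨v, fun i hi => ?_, rfl⟩)
  exact Set.mem_biUnion hA (WIdx_subset_EIdx hj (hv i hi))

theorem suppIn_eb {m : ℕ} {s : Set ℕ} (hm : m ∈ s) : SuppIn (eb m) s := by
  intro i hi
  have h := cf_eb i m
  rw [cf_of_lt i.2] at h
  by_contra h'
  rw [if_neg fun h1 : (i : ℕ) = m ∧ aIdx 6 < (i : ℕ) => h' (h1.1 ▸ hm)] at h
  exact hi h

/-- The basis vector at `posn j i`, as an element of `R_A`. -/
def bvec (eV : Vb →ₗ[ℝ] R) (A : Set ℕ) (j i : ℕ) : RA eV A :=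
  if h : eV (eb (posn j i)) ∈ RA eV A then ⟨eV (eb (posn j i)), h⟩ else 0

theorem coe_bvec (eV : Vb →ₗ[ℝ] R) {j i : ℕ} (hj : 6 ≤ j) (hA : j ∈ A) (hi : i < 2 ^ j) :
    (bvec eV A j i : R) = eV (eb (posn j i)) := by
  rw [bvec, dif_pos (eV_mem_RA eV hj hA (suppIn_eb (posn_mem_WIdx (by omega) hi)))]

/-- The vector `zv j u`, as an element of `R_A`. -/
def zA (eV : Vb →ₗ[ℝ] R) (A : Set ℕ) (j : ℕ) (u : ℕ → ℝ) : RA eV A :=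
  ∑ i ∈ Finset.range (2 ^ j), u i • bvec eV A j i

theorem coe_zA (eV : Vb →ₗ[ℝ] R) {j : ℕ} (hj : 6 ≤ j) (hA : j ∈ A) (u : ℕ → ℝ) :
    (zA eV A j u : R) = eV (zv j u) := by
  rw [eV_zv, zA, Submodule.coe_sum]
  refine Finset.sum_congr rfl fun i hi => ?_
  rw [Submodule.coe_smul, coe_bvec eV hj hA (Finset.mem_range.1 hi)]

theorem norm_zA (he : ∀ x, ‖eV x‖ = VNorm (Nr σ J) x) {j : ℕ} (hj : 6 ≤ j) (hA : j ∈ A) (u : ℕ → ℝ) :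
    ‖zA eV A j u‖ = VNorm (Nr σ J) (zv j u) := by
  rw [← Submodule.norm_coe, coe_zA eV hj hA, he]

/-- The average diagonal entry of `T` over the distinguished coordinates of level `j`. -/
def xi (eV : Vb →ₗ[ℝ] R) (A : Set ℕ) (j : ℕ) (T : RA eV A →L[ℝ] RA eV A) : ℝ :=
  (∑ i ∈ Finset.range (2 ^ j), crd eV j i (T (bvec eV A j i) : R)) / 2 ^ j

theorem abs_xi_le (he : ∀ x, ‖eV x‖ = VNorm (Nr σ J) x) (hd : DenseRange eV) {j : ℕ} (hj : 6 ≤ j)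
    (hA : j ∈ A) {K : ℝ} (hK : ∀ i < 2 ^ j, VNorm (Nr σ J) (eb (posn j i)) ≤ K)
    (T : RA eV A →L[ℝ] RA eV A) : |xi eV A j T| ≤ K * ‖T‖ := by
  have h2j : (0 : ℝ) < 2 ^ j := by positivity
  rw [xi, abs_div, abs_of_pos h2j, div_le_iff₀ h2j, mul_comm]
  refine (Finset.abs_sum_le_sum_abs _ _).trans ((Finset.sum_le_card_nsmul _ _ (K * ‖T‖) fun i hi => ?_).trans
    (by simp))
  have hi' := Finset.mem_range.1 hi
  refine (abs_extend_le he hd (abs_cf_le_one_mul σ J hj hi') _).trans ?_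
  rw [one_mul, Submodule.norm_coe, mul_comm K]
  refine (T.le_opNorm _).trans (mul_le_mul_of_nonneg_left ?_ (norm_nonneg _))
  rw [← Submodule.norm_coe, coe_bvec eV hj hA hi', he]
  exact hK i hi'

theorem sum_norm_sub_xi_le (he : ∀ x, ‖eV x‖ = VNorm (Nr σ J) x) (hd : DenseRange eV) {j : ℕ}
    (hJ : 3 ≤ J) (hj : 14 ≤ j) (hA : j ∈ A) (hS : Spread σ J j)
    (havg : ∀ y, Tame σ J j y → ∑ i ∈ Finset.range (2 ^ j), cf (posn j i) (y i) = 0 →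
      ∑ a ∈ Finset.range (numPts j), VNorm (Nr σ J) (lc j y (gv σ j a)) ≤ numPts j * (j : ℝ) ^ 108)
    (T : RA eV A →L[ℝ] RA eV A) :
    ∑ a ∈ Finset.range (numPts j), ‖T (zA eV A j (gv σ j a)) - xi eV A j T • zA eV A j (gv σ j a)‖ ≤
      2 * (numPts j * (j : ℝ) ^ 108) * ‖T‖ := by
  have hT : ∀ u, (T (zA eV A j u) : R) = ∑ i ∈ Finset.range (2 ^ j), u i • (T (bvec eV A j i) : R) := fun u => by
    rw [zA, map_sum, Submodule.coe_sum]
    exact Finset.sum_congr rfl fun i _ => by rw [map_smul, Submodule.coe_smul]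
  refine le_trans (le_of_eq (Finset.sum_congr rfl fun a _ => ?_))
    (sum_norm_sub_le he hd hJ hj hS havg (fun i => (T (bvec eV A j i) : R)) (norm_nonneg T) fun u => ?_)
  · rw [← Submodule.norm_coe, Submodule.coe_sub, Submodule.coe_smul, coe_zA eV (by omega) hA, hT, xi]
  · rw [← hT, Submodule.norm_coe, ← norm_zA he (by omega) hA]
    exact T.le_opNorm _

theorem abs_Gc_le (σ : Signs) (J : ℕ) {k a : ℕ} (hk : 6 ≤ k) (ha : a < numPts k) (x : Vb) :
    |Gc σ J k a x| ≤ 1 * VNorm (Nr σ J) x := by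
  rw [one_mul]
  exact (abs_le_lpn (px_pos J k) ha fun a => Gc σ J k a x).trans (Psi_le_VNorm σ J hk x)

theorem abs_Tie_le (σ : Signs) (J : ℕ) {j a : ℕ} (hj : 6 ≤ j) (ha : a < numPts j / 2) (x : Vb) :
    |Tie σ J (j + 1) a x| ≤ (√(Real.log (j + 1 : ℕ)))⁻¹ * VNorm (Nr σ J) x := by
  have hl : 0 < √(Real.log (j + 1 : ℕ)) :=
    Real.sqrt_pos.2 (by linarith [one_le_log (show 3 ≤ j + 1 by omega)])
  rw [le_inv_mul_iff₀ hl]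
  have h1 : |Tie σ J (j + 1) a x| ≤ TieN σ J (j + 1) x :=
    abs_le_lpn (px_pos J j) ha fun a => Tie σ J (j + 1) a x
  refine (mul_le_mul_of_nonneg_left h1 hl.le).trans (le_of_sq_le_sq ?_ (VNorm_nonneg _ _))
  rw [mul_pow, Real.sq_sqrt (Real.sqrt_pos.1 hl).le]
  exact log_mul_TieN_sq_le σ J (by omega) x

/-- Multiplicativity of `ξ` up to a small error, at high levels. -/
theorem abs_xi_comp_sub_le (he : ∀ x, ‖eV x‖ = VNorm (Nr σ J) x) (hd : DenseRange eV) {j : ℕ}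
    (hJ : 3 ≤ J) (hj : 14 ≤ j) (hJj : J ≤ j) (hA : j ∈ A) (hS : Spread σ J j)
    (havg : ∀ y, Tame σ J j y → ∑ i ∈ Finset.range (2 ^ j), cf (posn j i) (y i) = 0 →
      ∑ a ∈ Finset.range (numPts j), VNorm (Nr σ J) (lc j y (gv σ j a)) ≤ numPts j * (j : ℝ) ^ 108)
    (T S : RA eV A →L[ℝ] RA eV A) :
    |xi eV A j (T.comp S) - xi eV A j T * xi eV A j S| ≤ 8 * (j : ℝ)⁻¹ * ‖T‖ * ‖S‖ := by
  have hj' : (14 : ℝ) ≤ j := by exact_mod_cast hj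
  set Δ := xi eV A j (T.comp S) - xi eV A j T * xi eV A j S with hΔ
  let res : (RA eV A →L[ℝ] RA eV A) → ℕ → RA eV A := fun T a =>
    T (zA eV A j (gv σ j a)) - xi eV A j T • zA eV A j (gv σ j a)
  have hres : ∀ T, ∑ a ∈ Finset.range (numPts j), ‖res T a‖ ≤ 2 * (numPts j * (j : ℝ) ^ 108) * ‖T‖ := fun T =>
    sum_norm_sub_xi_le he hd hJ hj hA hS havg T
  have hid : ∀ a, Δ • zA eV A j (gv σ j a) = xi eV A j S • res T a + T (res S a) - res (T.comp S) a := fun a => by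
    simp only [res, hΔ, map_sub, map_smul, ContinuousLinearMap.comp_apply]
    module
  have hpt : ∀ a ∈ Finset.range (numPts j), |Δ| * Dc J j ≤
      2 * j * ‖S‖ * ‖res T a‖ + ‖T‖ * ‖res S a‖ + ‖res (T.comp S) a‖ := fun a ha => by
    have ha' := Finset.mem_range.1 ha
    have h1 : (Gc σ J j a).extendOfNorm eV ((Δ • zA eV A j (gv σ j a) : RA eV A) : R) = Δ * Dc J j := by
      rw [Submodule.coe_smul, coe_zA eV (by omega) hA, map_smul,
        extend_apply he hd (abs_Gc_le σ J (by omega) ha'), Gc_zv σ J (by omega), ip_self, ssq_gv, mul_one,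
        smul_eq_mul]
    have h2 := abs_extend_le he hd (abs_Gc_le σ J (show 6 ≤ j by omega) ha')
      ((Δ • zA eV A j (gv σ j a) : RA eV A) : R)
    rw [h1, one_mul, abs_mul, abs_of_nonneg (Dc_nonneg J j), hid, Submodule.norm_coe] at h2
    refine h2.trans ((norm_sub_le _ _).trans (add_le_add ((norm_add_le _ _).trans (add_le_add ?_
      (T.le_opNorm _))) le_rfl))
    rw [norm_smul, Real.norm_eq_abs]
    exact mul_le_mul_of_nonneg_right (abs_xi_le he hd (by omega) hA
      (fun i hi => VNorm_eb_le hJ hj hS hi) S) (norm_nonneg _)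
  have hsum := Finset.sum_le_sum hpt
  rw [Finset.sum_const, Finset.card_range, nsmul_eq_mul, Finset.sum_add_distrib, Finset.sum_add_distrib,
    ← Finset.mul_sum, ← Finset.mul_sum] at hsum
  have hn : (0 : ℝ) < numPts j := by exact_mod_cast numPts_pos (show 1 ≤ j by omega)
  have hTS := T.opNorm_comp_le S
  have hT0 := norm_nonneg T
  have hS0 := norm_nonneg S
  set n : ℝ := (numPts j : ℝ)
  have e1 := mul_le_mul_of_nonneg_left (hres T) (show 0 ≤ 2 * j * ‖S‖ by positivity)
  have e2 := mul_le_mul_of_nonneg_left (hres S) hT0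
  have e3 := (hres (T.comp S)).trans (mul_le_mul_of_nonneg_left hTS
    (show 0 ≤ 2 * (n * (j : ℝ) ^ 108) by positivity))
  have hfin : n * (|Δ| * Dc J j) ≤ n * (8 * (j : ℝ)⁻¹ * ‖T‖ * ‖S‖ * Dc J j) := by
    calc n * (|Δ| * Dc J j) ≤ (4 * j + 4) * (n * (j : ℝ) ^ 108 * (‖T‖ * ‖S‖)) := by linarith
      _ ≤ (8 * j) * (n * (j : ℝ) ^ 108 * (‖T‖ * ‖S‖)) :=
        mul_le_mul_of_nonneg_right (by linarith) (by positivity)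
      _ = n * (8 * (j : ℝ)⁻¹ * ‖T‖ * ‖S‖ * Dc J j) := by
        rw [Dc_of_le hJj, dE_eq]
        field_simp
  exact le_of_mul_le_mul_right (le_of_mul_le_mul_left hfin hn) (Dc_pos (by omega) hJj)

theorem abs_xi_comp_sub_le_of_bound (he : ∀ x, ‖eV x‖ = VNorm (Nr σ J) x) (hd : DenseRange eV) {j : ℕ}
    (hj : 6 ≤ j) (hA : j ∈ A) {K : ℝ} (hK0 : 0 ≤ K) (hK : ∀ i < 2 ^ j, VNorm (Nr σ J) (eb (posn j i)) ≤ K)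
    (T S : RA eV A →L[ℝ] RA eV A) :
    |xi eV A j (T.comp S) - xi eV A j T * xi eV A j S| ≤ (K + K ^ 2) * ‖T‖ * ‖S‖ := by
  have h1 := (abs_xi_le he hd hj hA hK (T.comp S)).trans
    (mul_le_mul_of_nonneg_left (T.opNorm_comp_le S) hK0)
  have h2 := mul_le_mul (abs_xi_le he hd hj hA hK T) (abs_xi_le he hd hj hA hK S) (abs_nonneg _)
    (by positivity)
  rw [← abs_mul] at h2
  refine (abs_sub _ _).trans ((add_le_add h1 h2).trans (le_of_eq (by ring)))

end

section
variable {R : Type} [NormedAddCommGroup R] [NormedSpace ℝ R] {eV : Vb →ₗ[ℝ] R} {σ : Signs} {J : ℕ} {A : Set ℕ}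

theorem sum_half_range_le {f : ℕ → ℝ} (hf : ∀ a, 0 ≤ f a) {n m : ℕ} {g : ℕ → ℕ} (hg : Function.Injective g)
    (hgm : ∀ a < n, g a < m) : ∑ a ∈ Finset.range n, f (g a) ≤ ∑ a ∈ Finset.range m, f a := by
  rw [← Finset.sum_image (f := f) (s := Finset.range n) hg.injOn]
  refine Finset.sum_le_sum_of_subset_of_nonneg (fun b hb => ?_) fun a _ _ => hf a
  obtain ⟨a, ha, rfl⟩ := Finset.mem_image.1 hb
  exact Finset.mem_range.2 (hgm a (Finset.mem_range.1 ha))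

theorem xv_eq_smul (σ : Signs) (J j a : ℕ) : xv σ J j a = (Dc J j)⁻¹ • zv j (gv σ j a) := by
  rw [xv, zv, zv, Finset.smul_sum]
  exact Finset.sum_congr rfl fun i _ => mul_smul _ _ _

set_option exponentiation.threshold 500 in
theorem numPts_succ_le {j : ℕ} (hj : 1 ≤ j) : (numPts (j + 1) : ℝ) ≤ 2 * 2 ^ 440 * numPts j := by
  have hj' : (1 : ℝ) ≤ j := by exact_mod_cast hj
  unfold numPts
  rw [cE_eq]
  push_cast
  calc (2 : ℝ) ^ (j + 1) * ((j : ℝ) + 1) ^ 440 ≤ 2 ^ (j + 1) * (2 * j) ^ 440 :=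
        mul_le_mul_of_nonneg_left (pow_le_pow_left₀ (by positivity) (by linarith) _) (by positivity)
    _ = 2 * 2 ^ 440 * (2 ^ j * (j : ℝ) ^ 440) := by rw [mul_pow, pow_succ]; ring

theorem inv_Dc_mul_le {J j : ℕ} (hj : 1 ≤ j) (h : J ≤ j) : (Dc J j)⁻¹ * (j : ℝ) ^ 108 ≤ 1 := by
  have hj' : (1 : ℝ) ≤ j := by exact_mod_cast hj
  rw [inv_mul_le_one₀ (Dc_pos hj h), Dc_of_le h, dE_eq]
  exact pow_le_pow_right₀ hj' (by norm_num)

set_option exponentiation.threshold 500 in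
/-- The functionals `ξ` vary slowly, at high levels. -/
theorem abs_xi_succ_sub_le (he : ∀ x, ‖eV x‖ = VNorm (Nr σ J) x) (hd : DenseRange eV) {j : ℕ}
    (hJ : 3 ≤ J) (hj : 14 ≤ j) (hJj : J ≤ j) (het : ∀ k, J ≤ k → et k ≤ 1) (hA : j ∈ A) (hA' : j + 1 ∈ A)
    (hS : ∀ k, J ≤ k → Spread σ J k)
    (havg : ∀ k, J ≤ k → ∀ y, Tame σ J k y → ∑ i ∈ Finset.range (2 ^ k), cf (posn k i) (y i) = 0 →
      ∑ a ∈ Finset.range (numPts k), VNorm (Nr σ J) (lc k y (gv σ k a)) ≤ numPts k * (k : ℝ) ^ 108)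
    (T : RA eV A →L[ℝ] RA eV A) :
    |xi eV A (j + 1) T - xi eV A j T| ≤
      (18 + 8 * 2 ^ 440) * (√(Real.log (j + 1 : ℕ)))⁻¹ * ‖T‖ := by
  have hj' : (14 : ℝ) ≤ j := by exact_mod_cast hj
  set L := (√(Real.log (j + 1 : ℕ)))⁻¹ with hL
  have hL0 : 0 ≤ L := by positivity
  set x₀ := xi eV A j T with hx₀
  set x₁ := xi eV A (j + 1) T with hx₁
  set D₀ := (Dc J j)⁻¹ with hD₀
  set D₁ := (Dc J (j + 1))⁻¹ with hD₁
  have hD₀0 : 0 ≤ D₀ := inv_nonneg.2 (Dc_nonneg _ _)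
  have hD₁0 : 0 ≤ D₁ := inv_nonneg.2 (Dc_nonneg _ _)
  let r₀ : ℕ → RA eV A := fun a => T (zA eV A j (gv σ j a)) - x₀ • zA eV A j (gv σ j a)
  let r₁ : ℕ → RA eV A := fun a =>
    T (zA eV A (j + 1) (gv σ (j + 1) a)) - x₁ • zA eV A (j + 1) (gv σ (j + 1) a)
  have hr₀ := sum_norm_sub_xi_le he hd hJ hj hA (hS j hJj) (havg j hJj) T
  have hr₁ := sum_norm_sub_xi_le he hd hJ (show 14 ≤ j + 1 by omega) hA' (hS (j + 1) (by omega))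
    (havg (j + 1) (by omega)) T
  let w : ℕ → RA eV A := fun a =>
    D₀ • zA eV A j (gv σ j (2 * a)) + D₁ • zA eV A (j + 1) (gv σ (j + 1) (2 * a + 1))
  have hw : ∀ a, (w a : R) = eV (wv σ J j a) := fun a => by
    simp only [w, wv, Submodule.coe_add, Submodule.coe_smul, coe_zA eV (show 6 ≤ j by omega) hA,
      coe_zA eV (show 6 ≤ j + 1 by omega) hA', xv_eq_smul, map_add, map_smul, hD₀, hD₁]
  have hid : ∀ a, x₀ • D₀ • zA eV A j (gv σ j (2 * a)) +
      x₁ • D₁ • zA eV A (j + 1) (gv σ (j + 1) (2 * a + 1)) =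
      T (w a) - D₀ • r₀ (2 * a) - D₁ • r₁ (2 * a + 1) := fun a => by
    simp only [w, r₀, r₁, map_add, map_smul]
    module
  have hpt : ∀ a ∈ Finset.range (numPts j / 2), |x₁ - x₀| ≤
      L * (14 * ‖T‖ + D₀ * ‖r₀ (2 * a)‖ + D₁ * ‖r₁ (2 * a + 1)‖) := fun a ha => by
    have ha' := Finset.mem_range.1 ha
    have hb := abs_Tie_le σ J (show 6 ≤ j by omega) ha'
    have e : (Tie σ J (j + 1) a).extendOfNorm eV ((x₀ • D₀ • zA eV A j (gv σ j (2 * a)) +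
        x₁ • D₁ • zA eV A (j + 1) (gv σ (j + 1) (2 * a + 1)) : RA eV A) : R) = x₀ - x₁ := by
      have hT : ∀ x, Tie σ J (j + 1) a x = Gc σ J j (2 * a) x - Gc σ J (j + 1) (2 * a + 1) x := fun x => rfl
      rw [Submodule.coe_add, Submodule.coe_smul, Submodule.coe_smul, Submodule.coe_smul, Submodule.coe_smul,
        coe_zA eV (by omega) hA, coe_zA eV (by omega) hA', ← map_smul eV, ← map_smul eV (Dc J (j + 1))⁻¹,
        hD₀, ← xv_eq_smul, ← xv_eq_smul, map_add, map_smul, map_smul, extend_apply he hd hb,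
        extend_apply he hd hb, hT, hT, Gc_xv_self σ (by omega) hJj, Gc_xv_self σ (by omega) (by omega),
        Gc_xv_of_ne σ J (by omega) (by omega) (by omega), Gc_xv_of_ne σ J (by omega) (by omega) (by omega)]
      simp [sub_eq_add_neg]
    have h2 := abs_extend_le he hd hb ((x₀ • D₀ • zA eV A j (gv σ j (2 * a)) +
        x₁ • D₁ • zA eV A (j + 1) (gv σ (j + 1) (2 * a + 1)) : RA eV A) : R)
    rw [e, abs_sub_comm, hid, Submodule.norm_coe] at h2
    refine h2.trans (mul_le_mul_of_nonneg_left ?_ hL0)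
    have hwn : ‖w a‖ ≤ 14 := by
      rw [← Submodule.norm_coe, hw, he]
      exact VNorm_wv_le (by omega) hJ hJj het (hS j hJj) (hS _ (by omega)) ha'
    have h3 := (T.le_opNorm (w a)).trans (mul_le_mul_of_nonneg_left hwn (norm_nonneg T))
    refine (norm_sub_le _ _).trans (add_le_add ((norm_sub_le _ _).trans (add_le_add ?_ ?_)) ?_)
    · linarith
    · rw [norm_smul, Real.norm_eq_abs, abs_of_nonneg hD₀0]
    · rw [norm_smul, Real.norm_eq_abs, abs_of_nonneg hD₁0]
  have hsum := Finset.sum_le_sum hpt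
  rw [Finset.sum_const, Finset.card_range, nsmul_eq_mul, ← Finset.mul_sum, Finset.sum_add_distrib,
    Finset.sum_add_distrib, ← Finset.mul_sum, ← Finset.mul_sum, ← Finset.mul_sum, Finset.sum_const,
    Finset.card_range, nsmul_eq_mul] at hsum
  have hmono := numPts_mono (show j ≤ j + 1 by omega)
  have hs₀ := (sum_half_range_le (f := fun a => ‖r₀ a‖) (fun _ => norm_nonneg _) (n := numPts j / 2)
    (m := numPts j) (g := fun a => 2 * a) (fun x y h => by simpa using h) fun a ha => by omega).trans hr₀
  have hs₁ := (sum_half_range_le (f := fun a => ‖r₁ a‖) (fun _ => norm_nonneg _) (n := numPts j / 2)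
    (m := numPts (j + 1)) (g := fun a => 2 * a + 1) (fun x y h => by simpa using h)
    fun a ha => by omega).trans hr₁
  have heven : ((numPts j / 2 : ℕ) : ℝ) = numPts j / 2 := by
    refine Nat.cast_div ?_ (by norm_num)
    unfold numPts
    exact Dvd.dvd.mul_right (dvd_pow_self 2 (by omega)) _
  rw [heven] at hsum
  have hn : (0 : ℝ) < numPts j := by exact_mod_cast numPts_pos (show 1 ≤ j by omega)
  have hnn := numPts_succ_le (show 1 ≤ j by omega)
  have hT0 := norm_nonneg T
  have hd0 := inv_Dc_mul_le (show 1 ≤ j by omega) hJj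
  have hd1 := inv_Dc_mul_le (show 1 ≤ j + 1 by omega) (show J ≤ j + 1 by omega)
  have b₀ : D₀ * ∑ a ∈ Finset.range (numPts j / 2), ‖r₀ (2 * a)‖ ≤ 2 * numPts j * ‖T‖ := by
    calc _ ≤ D₀ * (2 * (numPts j * (j : ℝ) ^ 108) * ‖T‖) := mul_le_mul_of_nonneg_left hs₀ hD₀0
      _ = (2 * numPts j * ‖T‖) * (D₀ * (j : ℝ) ^ 108) := by ring
      _ ≤ (2 * numPts j * ‖T‖) * 1 := mul_le_mul_of_nonneg_left hd0 (by positivity)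
      _ = _ := mul_one _
  have b₁ : D₁ * ∑ a ∈ Finset.range (numPts j / 2), ‖r₁ (2 * a + 1)‖ ≤
      2 * (2 * 2 ^ 440 * numPts j) * ‖T‖ := by
    calc _ ≤ D₁ * (2 * (numPts (j + 1) * ((j + 1 : ℕ) : ℝ) ^ 108) * ‖T‖) :=
          mul_le_mul_of_nonneg_left hs₁ hD₁0
      _ = (2 * numPts (j + 1) * ‖T‖) * (D₁ * ((j + 1 : ℕ) : ℝ) ^ 108) := by ring
      _ ≤ (2 * numPts (j + 1) * ‖T‖) * 1 := mul_le_mul_of_nonneg_left hd1 (by positivity)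
      _ = 2 * numPts (j + 1) * ‖T‖ := mul_one _
      _ ≤ _ := mul_le_mul_of_nonneg_right (mul_le_mul_of_nonneg_left hnn two_pos.le) hT0
  have hfin : (numPts j / 2 : ℝ) * |x₁ - x₀| ≤
      (numPts j / 2 : ℝ) * ((18 + 8 * 2 ^ 440) * L * ‖T‖) := by
    refine hsum.trans ((mul_le_mul_of_nonneg_left (add_le_add (add_le_add le_rfl b₀) b₁) hL0).trans
      (le_of_eq ?_))
    ring
  exact le_of_mul_le_mul_left hfin (by positivity)

/-- The sum of the norms of the distinguished basis vectors of level `j`. -/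
def basisSum (σ : Signs) (J j : ℕ) : ℝ := ∑ i ∈ Finset.range (2 ^ j), VNorm (Nr σ J) (eb (posn j i))

theorem basisSum_nonneg (σ : Signs) (J j : ℕ) : 0 ≤ basisSum σ J j :=
  Finset.sum_nonneg fun _ _ => VNorm_nonneg _ _

theorem VNorm_eb_le_basisSum (σ : Signs) (J j : ℕ) : ∀ i < 2 ^ j,
    VNorm (Nr σ J) (eb (posn j i)) ≤ basisSum σ J j := fun _ hi =>
  Finset.single_le_sum (f := fun i => VNorm (Nr σ J) (eb (posn j i))) (fun _ _ => VNorm_nonneg _ _)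
    (Finset.mem_range.2 hi)

theorem eq_sum_cf_smul_eb {x : Vb} {n : ℕ} (hx : ∀ i, x i ≠ 0 → (i : ℕ) < n) :
    x = ∑ m ∈ Finset.range n, cf m x • eb m := by
  ext i
  have h : ∀ y : Vb, y i = cf i y := fun y => (cf_of_lt i.2 y).symm
  rw [h, h, map_sum]
  simp only [map_smul, cf_eb, smul_eq_mul]
  by_cases hi : (i : ℕ) < n
  · rw [Finset.sum_eq_single (i : ℕ)]
    · rw [if_pos ⟨rfl, i.2⟩, mul_one]
    · intro b _ hb
      rw [if_neg fun h1 : (i : ℕ) = b ∧ aIdx 6 < (i : ℕ) => hb h1.1.symm, mul_zero]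
    · intro h1
      exact absurd (Finset.mem_range.2 hi) h1
  · rw [Finset.sum_eq_zero]
    · rw [← h]; by_contra h1; exact hi (hx i h1)
    · intro b hb
      rw [if_neg fun h1 : (i : ℕ) = b ∧ aIdx 6 < (i : ℕ) => hi (h1.1 ▸ Finset.mem_range.1 hb), mul_zero]

theorem abs_cf_le_of_mem_VIdx (σ : Signs) (J : ℕ) {r m : ℕ} (hr : 6 ≤ r) (hm : m ∈ VIdx r) (x : Vb) :
    |cf m x| ≤ VNorm (Nr σ J) x := by
  have h := abs_le_lpn two_pos (show m < bIdx r + 1 from Nat.lt_succ_of_le hm.2)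
    fun m => cf m (projTo (VIdx r) x)
  simp only [cf_projTo, if_pos hm] at h
  refine h.trans (le_trans (le_of_eq ?_) (le_of_sq_le_sq ((QV_sq_le σ J hr x).trans (Sm_le_VNorm_sq σ J r x))
    (VNorm_nonneg _ _)))
  unfold QV EucN
  simp only [cf_projTo]

theorem exists_norm_projTo_le (he : ∀ x, ‖eV x‖ = VNorm (Nr σ J) x) {j : ℕ} (hj : 6 ≤ j) :
    ∃ C, ∀ x, ‖eV (projTo (WIdx j) x)‖ ≤ C * ‖eV x‖ := by
  refine ⟨∑ m ∈ Finset.range (bIdx j + 1), ‖eV (eb m)‖, fun x => ?_⟩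
  have hsup : ∀ i, projTo (WIdx j) x i ≠ 0 → (i : ℕ) < bIdx j + 1 := fun i hi => by
    by_contra h
    rw [← cf_of_lt i.2, cf_projTo, if_neg fun h1 : (i : ℕ) ∈ WIdx j => h (Nat.lt_succ_of_le h1.2)] at hi
    exact hi rfl
  rw [eq_sum_cf_smul_eb hsup, map_sum, Finset.sum_mul]
  refine (norm_sum_le _ _).trans (Finset.sum_le_sum fun m _ => ?_)
  rw [map_smul, norm_smul, mul_comm, cf_projTo]
  refine mul_le_mul_of_nonneg_left ?_ (norm_nonneg _)
  split_ifs with h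
  · rw [he, Real.norm_eq_abs]
    exact abs_cf_le_of_mem_VIdx σ J hj (WIdx_subset_VIdx le_rfl (by omega) h) x
  · rw [norm_zero]; exact norm_nonneg _

/-- The extension of `π_j^W` to the completion. -/
def projExt (eV : Vb →ₗ[ℝ] R) [CompleteSpace R] (j : ℕ) : R →L[ℝ] R :=
  (eV ∘ₗ projTo (WIdx j)).extendOfNorm eV

theorem projExt_apply [CompleteSpace R] (he : ∀ x, ‖eV x‖ = VNorm (Nr σ J) x) (hd : DenseRange eV) {j : ℕ}
    (hj : 6 ≤ j) (v : Vb) : projExt eV j (eV v) = eV (projTo (WIdx j) v) :=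
  LinearMap.extendOfNorm_eq (f := eV ∘ₗ projTo (WIdx j)) hd (exists_norm_projTo_le he hj) v

theorem crd_projExt [CompleteSpace R] (he : ∀ x, ‖eV x‖ = VNorm (Nr σ J) x) (hd : DenseRange eV) {j i : ℕ}
    (hj : 6 ≤ j) (hi : i < 2 ^ j) (x : R) : crd eV j i (projExt eV j x) = crd eV j i x := by
  refine hd.induction_on (p := fun x => crd eV j i (projExt eV j x) = crd eV j i x) x ?_ fun v => ?_
  · exact isClosed_eq (by fun_prop) (by fun_prop)
  · rw [projExt_apply he hd hj, crd, extend_apply he hd (abs_cf_le_one_mul σ J hj hi),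
      extend_apply he hd (abs_cf_le_one_mul σ J hj hi), cf_projTo, if_pos (posn_mem_WIdx (by omega) hi)]

theorem xi_eq_of_projExt [CompleteSpace R] (he : ∀ x, ‖eV x‖ = VNorm (Nr σ J) x) (hd : DenseRange eV) {j : ℕ}
    (hj : 6 ≤ j) (hA : j ∈ A) (T : RA eV A →L[ℝ] RA eV A) (μ : ℝ)
    (h : ∀ v : Vb, SuppIn v (WIdx j) → ∀ hw : eV v ∈ RA eV A,
      projExt eV j (T ⟨eV v, hw⟩ : R) = μ • eV v) : xi eV A j T = μ := by
  have hterm : ∀ i ∈ Finset.range (2 ^ j), crd eV j i (T (bvec eV A j i) : R) = μ := fun i hi => by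
    have hi' := Finset.mem_range.1 hi
    have hsup := suppIn_eb (posn_mem_WIdx (show 1 ≤ j by omega) hi')
    have hb : bvec eV A j i = ⟨eV (eb (posn j i)), eV_mem_RA eV hj hA hsup⟩ :=
      Subtype.ext (coe_bvec eV hj hA hi')
    rw [← crd_projExt he hd hj hi', hb, h _ hsup, map_smul, crd,
      extend_apply he hd (abs_cf_le_one_mul σ J hj hi'), cf_eb, if_pos ⟨rfl, lt_posn (by omega)⟩,
      smul_eq_mul, mul_one]
  rw [xi, Finset.sum_congr rfl hterm]
  simp

end

theorem Typical.mono {g : ℕ → ℕ → ℕ → ℝ} {J J' : ℕ} (h : Typical g J) (hJ : J ≤ J') : Typical g J' :=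
  ⟨fun j hj => h.frame j (hJ.trans hj), fun j hj => h.incoherent j (hJ.trans hj),
    fun j hj => h.diag j (hJ.trans hj), fun j k hj hk => h.cross j k (hJ.trans hj) (hJ.trans hk)⟩

/-- **Theorem 2, after C. J. Read.** For some collection of norms `‖·‖_(r)`
on the `V_r` there exist a null sequence of positive numbers `(ε r)_{r≥6}` and constants
`0 < α, β < ∞` such that, for every realization `R` of the completion of `(V, ‖·‖)` (a real
Banach space with a dense isometric embedding `eV` of `V`), every `A ⊆ ℕ₆` and every
`j ∈ A`, there is a map `ξ j : L(R_A) → ℝ` with: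
(a) if `π_j^W (T w) = μ • w` for all `w ∈ W_j`, then `ξ j T = μ` (here `π_j^W` denotes the
continuous extension to `R` of the coordinate projection onto `W_j`);
(b) `|ξ j (T S) − ξ j T · ξ j S| ≤ α j^(−β) ‖T‖ ‖S‖`;
(c) if `j, j+1 ∈ A` then `|ξ (j+1) T − ξ j T| ≤ ε (j+1) ‖T‖`. -/
theorem statement2 :
    ∃ (N : ℕ → Vb → ℝ) (ε : ℕ → ℝ) (α β : ℝ),
      NormFamily N ∧ (∀ r, 6 ≤ r → 0 < ε r) ∧
      Filter.Tendsto ε Filter.atTop (nhds 0) ∧ 0 < α ∧ 0 < β ∧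
      ∀ (R : Type) [NormedAddCommGroup R] [NormedSpace ℝ R] [CompleteSpace R]
        (eV : Vb →ₗ[ℝ] R), (∀ x, ‖eV x‖ = VNorm N x) → DenseRange eV →
        ∀ A ⊆ {r : ℕ | 6 ≤ r},
          ∃ ξ : ℕ → ((RA eV A →L[ℝ] RA eV A) → ℝ),
            ∀ j ∈ A,
              -- (a)
              (∃ Pj : R →L[ℝ] R, (∀ v : Vb, Pj (eV v) = eV (projTo (WIdx j) v)) ∧
                ∀ (T : RA eV A →L[ℝ] RA eV A) (μ : ℝ),
                  (∀ (v : Vb), SuppIn v (WIdx j) → ∀ (hw : eV v ∈ RA eV A),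
                    Pj (T ⟨eV v, hw⟩ : R) = μ • eV v) →
                  ξ j T = μ) ∧
              -- (b)
              (∀ T S : RA eV A →L[ℝ] RA eV A,
                |ξ j (T.comp S) - ξ j T * ξ j S| ≤ α * (j : ℝ) ^ (-β) * ‖T‖ * ‖S‖) ∧
              -- (c)
              ((j + 1) ∈ A →
                ∀ T : RA eV A →L[ℝ] RA eV A,
                  |ξ (j + 1) T - ξ j T| ≤ ε (j + 1) * ‖T‖) := by
  obtain ⟨σ, J₀, h₀⟩ := exists_typical
  obtain ⟨N₁, h₁⟩ := exists_spread
  obtain ⟨N₂, h₂⟩ := exists_sum_VNorm_le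
  obtain ⟨N₃, h₃⟩ := Filter.eventually_atTop.1 eventually_et_le_one
  obtain ⟨J, hJ₀, hJ₁, hJ₂, hJ₃, hJ⟩ : ∃ J, J₀ ≤ J ∧ N₁ ≤ J ∧ N₂ ≤ J ∧ N₃ ≤ J ∧ 14 ≤ J :=
    ⟨J₀ + N₁ + N₂ + N₃ + 14, by omega, by omega, by omega, by omega, by omega⟩
  have htyp := h₀.mono hJ₀
  have hS : ∀ k, J ≤ k → Spread σ J k := fun k hk => h₁ σ J htyp k (hJ₁.trans hk) hk
  have havg := fun k (hk : J ≤ k) => h₂ σ J htyp hJ₂ k hk (hS k hk)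
  have het : ∀ k, J ≤ k → et k ≤ 1 := fun k hk => h₃ k (hJ₃.trans hk)
  let M := basisSum σ J
  have hM0 : ∀ j, 0 ≤ M j := basisSum_nonneg σ J
  have hM : ∀ j, ∀ i < 2 ^ j, VNorm (Nr σ J) (eb (posn j i)) ≤ M j := VNorm_eb_le_basisSum σ J
  have hb0 : ∀ j : ℕ, 0 ≤ (j : ℝ) * (M j + M j ^ 2) := fun j => by have := hM0 j; positivity
  have hc0 : ∀ j : ℕ, 0 ≤ (M (j + 1) + M j) * √(Real.log (j + 1 : ℕ)) := fun j => by
    have := hM0 j; have := hM0 (j + 1); positivity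
  let B := ∑ j ∈ Finset.range J, (j : ℝ) * (M j + M j ^ 2)
  let C := ∑ j ∈ Finset.range J, (M (j + 1) + M j) * √(Real.log (j + 1 : ℕ))
  have hB : 0 ≤ B := Finset.sum_nonneg fun j _ => hb0 j
  have hC : 0 ≤ C := Finset.sum_nonneg fun j _ => hc0 j
  refine ⟨Nr σ J, fun r => (18 + 8 * 2 ^ 440 + C) * (√(Real.log r))⁻¹, 8 + B, 1, normFamily_Nr σ J,
    fun r hr => ?_, ?_, by positivity, one_pos, ?_⟩
  · have := one_le_log (show 3 ≤ r by omega)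
    have : 0 < √(Real.log r) := Real.sqrt_pos.2 (by linarith)
    positivity
  · simpa only [mul_zero, Function.comp_def] using (tendsto_inv_atTop_zero.comp (Real.tendsto_sqrt_atTop.comp
      (Real.tendsto_log_atTop.comp tendsto_natCast_atTop_atTop))).const_mul (18 + 8 * 2 ^ 440 + C)
  intro R _ _ _ eV he hd A hA
  refine ⟨fun j T => xi eV A j T, fun j hjA => ?_⟩
  have hj : 6 ≤ j := hA hjA
  have hj0 : (0 : ℝ) < j := by exact_mod_cast (show 0 < j by omega)
  refine ⟨⟨projExt eV j, projExt_apply he hd hj, xi_eq_of_projExt he hd hj hjA⟩, fun T S => ?_, fun hjA' T => ?_⟩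
  · rw [Real.rpow_neg_one]
    obtain h | h := le_or_gt J j
    · refine (abs_xi_comp_sub_le he hd (by omega) (by omega) h hjA (hS j h) (havg j h) T S).trans ?_
      gcongr
      linarith
    · refine (abs_xi_comp_sub_le_of_bound he hd hj hjA (hM0 j) (hM j) T S).trans ?_
      gcongr
      rw [← div_eq_mul_inv, le_div_iff₀ hj0, mul_comm]
      have := Finset.single_le_sum (fun i _ => hb0 i) (Finset.mem_range.2 h)
      exact this.trans (le_add_of_nonneg_left (by norm_num))
  · obtain h | h := le_or_gt J j
    · refine (abs_xi_succ_sub_le he hd (by omega) (by omega) h het hjA hjA' hS havg T).trans ?_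
      exact mul_le_mul_of_nonneg_right
        (mul_le_mul_of_nonneg_right (le_add_of_nonneg_right hC) (by positivity)) (norm_nonneg T)
    · have hT := norm_nonneg T
      refine (abs_sub _ _).trans ((add_le_add (abs_xi_le he hd (show 6 ≤ j + 1 by omega) hjA' (hM (j + 1)) T)
        (abs_xi_le he hd hj hjA (hM j) T)).trans ?_)
      rw [← add_mul]
      refine mul_le_mul_of_nonneg_right ?_ hT
      change _ ≤ (18 + 8 * 2 ^ 440 + C) * (√(Real.log (j + 1 : ℕ)))⁻¹
      have := one_le_log (show 3 ≤ j + 1 by omega)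
      have hs : 0 < √(Real.log (j + 1 : ℕ)) := Real.sqrt_pos.2 (by linarith)
      rw [← div_eq_mul_inv, le_div_iff₀ hs]
      have := Finset.single_le_sum (fun i _ => hc0 i) (Finset.mem_range.2 h)
      exact this.trans (le_add_of_nonneg_left (by positivity))
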